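/- Let W be a d-dimensional Brownian sheet on [0,1]^2, let ξ ∈ ℝ^d, and let b : [0,1]^2 × ℝ^d → ℝ^d be Borel measurable and uniformly bounded such that b = b̂ − b̌ where every component b̂_i(s,t,·) and b̌_i(s,t,·) is bounded and componentwise nondecreasing. Then there exists a full ℙ-measure set Ω₀ such that for every ω ∈ Ω₀ there exists exactly one continuous function X : [0,1]^2 → ℝ^d satisfying X(s,t) = ξ + ∫_0^t ∫_0^s b(s₁,t₁,X(s₁,t₁)) ds₁ dt₁ + W_{s,t}(ω) for all (s,t) ∈ [0,1]^2. -/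

import Mathlib

open MeasureTheory ProbabilityTheory Set Filter

noncomputable section

/-- A `d`-dimensional Brownian sheet on `[0,1]²`. -/
def IsBrownianSheet {Ω : Type*} [MeasurableSpace Ω] (P : Measure Ω) (d : ℕ)
    (W : ℝ × ℝ → Ω → EuclideanSpace ℝ (Fin d)) : Prop :=
  (∀ p, Measurable (W p)) ∧
  (∀ ω, ContinuousOn (fun p => W p ω) (Set.Icc (0 : ℝ × ℝ) 1)) ∧
  (∀ ω, ∀ p ∈ Set.Icc (0 : ℝ × ℝ) 1, p.1 = 0 ∨ p.2 = 0 → W p ω = 0) ∧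
  (∀ (n : ℕ) (p : Fin n → ℝ × ℝ) (idx : Fin n → Fin d) (c : Fin n → ℝ),
    (∀ j, p j ∈ Set.Icc (0 : ℝ × ℝ) 1) →
    P.map (fun ω => ∑ j, c j * W (p j) ω (idx j)) =
      gaussianReal 0 (∑ j, ∑ k, c j * c k *
        (if idx j = idx k then min (p j).1 (p k).1 * min (p j).2 (p k).2 else 0)).toNNReal)

/-- The σ-algebra generated by the sheet up to `p`. -/
def sheetSigma {Ω : Type*} [MeasurableSpace Ω] {d : ℕ}
    (W : ℝ × ℝ → Ω → EuclideanSpace ℝ (Fin d)) (p : ℝ × ℝ) : MeasurableSpace Ω :=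
  ⨆ q ∈ Set.Icc (0 : ℝ × ℝ) p, MeasurableSpace.comap (W q) inferInstance

/-- A strong solution of the sheet SDE. -/
def IsStrongSolution {Ω : Type*} [MeasurableSpace Ω] (P : Measure Ω) {d : ℕ}
    (W : ℝ × ℝ → Ω → EuclideanSpace ℝ (Fin d))
    (b : ℝ × ℝ → EuclideanSpace ℝ (Fin d) → EuclideanSpace ℝ (Fin d))
    (ξ : EuclideanSpace ℝ (Fin d))
    (X : ℝ × ℝ → Ω → EuclideanSpace ℝ (Fin d)) : Prop :=
  (∀ ω, ContinuousOn (fun p => X p ω) (Set.Icc (0 : ℝ × ℝ) 1)) ∧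
  (∀ p ∈ Set.Icc (0 : ℝ × ℝ) 1, ∃ Y : Ω → EuclideanSpace ℝ (Fin d),
      Measurable[sheetSigma W p] Y ∧ ∀ᵐ ω ∂P, X p ω = Y ω) ∧
  (∀ᵐ ω ∂P, ∀ p ∈ Set.Icc (0 : ℝ × ℝ) 1,
      X p ω = ξ + (∫ t₁ in (0:ℝ)..p.2, ∫ s₁ in (0:ℝ)..p.1, b (s₁, t₁) (X (s₁, t₁) ω)) + W p ω)

section

lemma integrable_of_abs_le {α : Type*} [MeasurableSpace α] {μ : Measure α} [IsFiniteMeasure μ]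
    {f : α → ℝ} (hf : Measurable f) {M : ℝ} (hM : ∀ x, |f x| ≤ M) : Integrable f μ :=
  Integrable.of_bound hf.aestronglyMeasurable M (ae_of_all _ hM)

lemma gaussianPDFReal_shift (h z : ℝ) :
    gaussianPDFReal h 1 z = gaussianPDFReal 0 1 z * Real.exp (h * z - h ^ 2 / 2) := by
  simp only [gaussianPDFReal, mul_assoc, ← Real.exp_add]
  congr 2
  simp
  ring

lemma abs_integral_gaussianReal_shift_sub_le {U : ℝ → ℝ} (hU : Measurable U) {M : ℝ}
    (hM : ∀ x, |U x| ≤ M) (h : ℝ) (hh : 0 ≤ h) :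
    |∫ z, U (z + h) ∂(gaussianReal 0 1) - ∫ z, U z ∂(gaussianReal 0 1)| ≤ 2 * M * h := by
  have hM0 : 0 ≤ M := (abs_nonneg _).trans (hM 0)
  have hi1 : Integrable (fun z => U (z + h)) (gaussianReal 0 1) :=
    integrable_of_abs_le (by fun_prop) (fun x => hM _)
  have hi2 : Integrable U (gaussianReal 0 1) := integrable_of_abs_le hU hM
  rcases hh.eq_or_lt with rfl | hpos
  · simp
  by_cases h1 : 1 ≤ h
  · rw [← integral_sub hi1 hi2]
    have := norm_integral_le_of_norm_le_const (μ := gaussianReal 0 1)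
      (f := fun z => U (z + h) - U z) (C := 2 * M)
      (ae_of_all _ fun z => by
        rw [Real.norm_eq_abs]
        have := abs_sub (U (z + h)) (U z)
        linarith [hM (z + h), hM z])
    simp only [probReal_univ, mul_one, Real.norm_eq_abs] at this
    nlinarith
  push Not at h1
  set L : ℝ → ℝ := fun z => Real.exp (h * z - h ^ 2 / 2) with hL
  have hexp : ∀ t : ℝ, Integrable (fun z => Real.exp (t * z)) (gaussianReal 0 1) :=
    fun t => integrable_exp_mul_gaussianReal t
  have hmgf : ∀ t : ℝ, ∫ z, Real.exp (t * z) ∂(gaussianReal 0 1) = Real.exp (t ^ 2 / 2) := by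
    intro t
    have := congrFun (mgf_fun_id_gaussianReal (μ := 0) (v := 1)) t
    simpa [mgf] using this
  have hLi : Integrable L (gaussianReal 0 1) := by
    have := (hexp h).mul_const (Real.exp (- (h ^ 2 / 2)))
    simpa [hL, sub_eq_add_neg, Real.exp_add] using this
  have hLint : ∫ z, L z ∂(gaussianReal 0 1) = 1 := by
    have : ∀ z, L z = Real.exp (h * z) * Real.exp (- (h ^ 2 / 2)) := fun z => by
      simp only [hL]; rw [← Real.exp_add, sub_eq_add_neg]
    simp_rw [this, integral_mul_const, hmgf, ← Real.exp_add]
    simp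
  have hL2e : ∀ z, L z ^ 2 = Real.exp ((2 * h) * z) * Real.exp (- (h ^ 2)) := fun z => by
    rw [hL, ← Real.exp_add, ← Real.exp_nat_mul]; congr 1; push_cast; ring
  have hL2i : Integrable (fun z => L z ^ 2) (gaussianReal 0 1) := by
    simp_rw [hL2e]; exact (hexp _).mul_const _
  have hL2 : ∫ z, L z ^ 2 ∂(gaussianReal 0 1) = Real.exp (h ^ 2) := by
    simp_rw [hL2e, integral_mul_const, hmgf, ← Real.exp_add]
    congr 1; ring
  have hshift : ∫ z, U (z + h) ∂(gaussianReal 0 1) = ∫ z, U z * L z ∂(gaussianReal 0 1) := by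
    have e1 : ∫ z, U (z + h) ∂(gaussianReal 0 1) = ∫ z, U z ∂(gaussianReal h 1) := by
      have := gaussianReal_map_add_const (μ := 0) (v := 1) h
      rw [zero_add] at this
      rw [← this, integral_map (by fun_prop) hU.aestronglyMeasurable]
    rw [e1, integral_gaussianReal_eq_integral_smul one_ne_zero,
      integral_gaussianReal_eq_integral_smul one_ne_zero]
    congr 1; ext z
    rw [gaussianPDFReal_shift]
    simp [hL]; ring
  have hULi : Integrable (fun z => U z * L z) (gaussianReal 0 1) :=
    hLi.bdd_mul hU.aestronglyMeasurable (c := M) (ae_of_all _ fun z => by simpa using hM z)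
  rw [hshift, ← integral_sub hULi hi2]
  have hdom : Integrable (fun z => M * ((h + (L z ^ 2 - 2 * L z + 1) / h) / 2))
      (gaussianReal 0 1) := by
    refine Integrable.const_mul ?_ _
    refine Integrable.div_const ?_ _
    refine (integrable_const _).add (Integrable.div_const ?_ _)
    exact ((hL2i.sub (hLi.const_mul 2)).add (integrable_const _))
  have hb : |∫ z, (U z * L z - U z) ∂(gaussianReal 0 1)| ≤
      ∫ z, M * ((h + (L z ^ 2 - 2 * L z + 1) / h) / 2) ∂(gaussianReal 0 1) := by
    rw [← Real.norm_eq_abs]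
    refine norm_integral_le_of_norm_le hdom (ae_of_all _ fun z => ?_)
    rw [Real.norm_eq_abs, ← mul_sub_one, abs_mul]
    refine mul_le_mul (hM z) ?_ (abs_nonneg _) hM0
    have hx : L z ^ 2 - 2 * L z + 1 = |L z - 1| ^ 2 := by rw [sq_abs]; ring
    rw [hx, le_div_iff₀ (by norm_num), ← sub_nonneg]
    have : h + |L z - 1| ^ 2 / h - |L z - 1| * 2 = (h - |L z - 1|) ^ 2 / h := by
      field_simp; ring
    rw [this]; positivity
  refine hb.trans ?_
  have : ∫ z, M * ((h + (L z ^ 2 - 2 * L z + 1) / h) / 2) ∂(gaussianReal 0 1) =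
      M * ((h + (Real.exp (h ^ 2) - 2 + 1) / h) / 2) := by
    have i1 : Integrable (fun z => L z ^ 2 - 2 * L z) (gaussianReal 0 1) :=
      hL2i.sub (hLi.const_mul 2)
    have i2 : Integrable (fun z => (L z ^ 2 - 2 * L z + 1) / h) (gaussianReal 0 1) :=
      (i1.add (integrable_const _)).div_const _
    rw [integral_const_mul, integral_div, integral_add (integrable_const _) i2, integral_div,
      integral_add i1 (integrable_const _),
      integral_sub hL2i (hLi.const_mul 2), integral_const_mul, hL2, hLint]
    simp
  rw [this]
  have he : Real.exp (h ^ 2) - 1 ≤ 2 * h ^ 2 := by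
    have := Real.abs_exp_sub_one_le (x := h ^ 2) (by rw [abs_of_nonneg (by positivity)]; nlinarith)
    rw [abs_of_nonneg (sq_nonneg h)] at this
    exact (le_abs_self _).trans this
  have : (Real.exp (h ^ 2) - 2 + 1) / h ≤ 2 * h := by
    rw [div_le_iff₀ hpos]; nlinarith
  nlinarith

section Std
variable {E : Type*} [NormedAddCommGroup E] [InnerProductSpace ℝ E] [FiniteDimensional ℝ E]
  [MeasurableSpace E] [BorelSpace E]

lemma stdGaussian_eq_conv_direction {u : E} (hu : ‖u‖ = 1) :
    stdGaussian E = ((gaussianReal 0 1).map (fun g : ℝ => g • u)) ∗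
      ((stdGaussian E).map (fun z => z - inner ℝ u z • u)) := by
  have hm1 : Measurable (fun g : ℝ => g • u) := by fun_prop
  have hm2 : Measurable (fun z : E => z - inner ℝ u z • u) := by fun_prop
  have : IsProbabilityMeasure ((gaussianReal 0 1).map (fun g : ℝ => g • u)) :=
    Measure.isProbabilityMeasure_map hm1.aemeasurable
  have : IsProbabilityMeasure ((stdGaussian E).map (fun z => z - inner ℝ u z • u)) :=
    Measure.isProbabilityMeasure_map hm2.aemeasurable
  refine Measure.ext_of_charFun ?_
  ext t
  have e1 : charFun ((gaussianReal 0 1).map (fun g : ℝ => g • u)) t =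
      charFun (gaussianReal 0 1) (inner ℝ u t) := by
    rw [charFun_apply, charFun_apply, integral_map hm1.aemeasurable (by fun_prop)]
    simp only [real_inner_smul_left, RCLike.inner_apply, conj_trivial]
    simp_rw [mul_comm]
  have e2 : charFun ((stdGaussian E).map (fun z => z - inner ℝ u z • u)) t =
      charFun (stdGaussian E) (t - inner ℝ u t • u) := by
    rw [charFun_apply, charFun_apply, integral_map hm2.aemeasurable (by fun_prop)]
    congr 1; ext z
    congr 3
    rw [inner_sub_left, inner_sub_right, real_inner_smul_left, real_inner_smul_right,
      real_inner_comm u z]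
    ring
  have hn : ‖t - inner ℝ u t • u‖ ^ 2 = ‖t‖ ^ 2 - (inner ℝ u t) ^ 2 := by
    rw [norm_sub_sq_real, real_inner_smul_right, norm_smul, hu, mul_one, Real.norm_eq_abs, sq_abs,
      real_inner_comm]
    ring
  rw [charFun_conv, e1, e2, charFun_stdGaussian, charFun_stdGaussian, charFun_gaussianReal,
    ← Complex.exp_add, ← Complex.ofReal_pow ‖t - _‖, hn]
  congr 1; push_cast; ring

lemma abs_integral_stdGaussian_shift_sub_le {U : E → ℝ} (hU : Measurable U) {M : ℝ}
    (hM : ∀ x, |U x| ≤ M) (h : E) :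
    |∫ z, U (z + h) ∂(stdGaussian E) - ∫ z, U z ∂(stdGaussian E)| ≤ 2 * M * ‖h‖ := by
  rcases eq_or_ne h 0 with rfl | hne
  · simp
  have hn : 0 < ‖h‖ := norm_pos_iff.2 hne
  set u : E := ‖h‖⁻¹ • h with hu
  have hu1 : ‖u‖ = 1 := by rw [hu, norm_smul, norm_inv, norm_norm, inv_mul_cancel₀ hn.ne']
  have hhu : h = ‖h‖ • u := by rw [hu, smul_smul, mul_inv_cancel₀ hn.ne', one_smul]
  have hm1 : Measurable (fun g : ℝ => g • u) := by fun_prop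
  have hm2 : Measurable (fun z : E => z - inner ℝ u z • u) := by fun_prop
  have : IsProbabilityMeasure ((gaussianReal 0 1).map (fun g : ℝ => g • u)) :=
    Measure.isProbabilityMeasure_map hm1.aemeasurable
  have : IsProbabilityMeasure ((stdGaussian E).map (fun z => z - inner ℝ u z • u)) :=
    Measure.isProbabilityMeasure_map hm2.aemeasurable
  set ν := (stdGaussian E).map (fun z => z - inner ℝ u z • u) with hν
  have key : ∀ F : E → ℝ, Measurable F → (∀ x, |F x| ≤ M) →
      Integrable (fun y => ∫ g, F (g • u + y) ∂(gaussianReal 0 1)) ν ∧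
      ∫ z, F z ∂(stdGaussian E) = ∫ y, ∫ g, F (g • u + y) ∂(gaussianReal 0 1) ∂ν := by
    intro F hF hFM
    have hI : Integrable (fun p : ℝ × E => F (p.1 • u + p.2)) ((gaussianReal 0 1).prod ν) :=
      integrable_of_abs_le (by fun_prop) (fun _ => hFM _)
    refine ⟨hI.integral_prod_right, ?_⟩
    rw [stdGaussian_eq_conv_direction hu1, Measure.conv, ← hν]
    rw [integral_map (by fun_prop) hF.aestronglyMeasurable]
    have : ((gaussianReal 0 1).map (fun g : ℝ => g • u)).prod ν =
        ((gaussianReal 0 1).prod ν).map (Prod.map (fun g : ℝ => g • u) id) := by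
      rw [← Measure.map_prod_map _ _ hm1 measurable_id, Measure.map_id]
    rw [this, integral_map (by fun_prop) (Measurable.aestronglyMeasurable (by fun_prop))]
    simp only [Prod.map_fst, Prod.map_snd, id]
    rw [integral_prod_symm _ hI]
  obtain ⟨i1, k1⟩ := key (fun z => U (z + h)) (by fun_prop) (fun _ => hM _)
  obtain ⟨i2, k2⟩ := key U hU hM
  rw [k1, k2, ← integral_sub i1 i2, ← Real.norm_eq_abs]
  refine (norm_integral_le_of_norm_le_const (C := 2 * M * ‖h‖) (ae_of_all _ fun y => ?_)).trans ?_
  · have := abs_integral_gaussianReal_shift_sub_le (U := fun g => U (g • u + y)) (by fun_prop)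
      (fun _ => hM _) ‖h‖ (norm_nonneg _)
    rw [Real.norm_eq_abs]
    convert this using 6 with g
    rw [add_smul, ← hhu]; abel
  · simp

lemma stdGaussian_eq_map_prod :
    stdGaussian E = ((stdGaussian E).prod (stdGaussian E)).map
      (fun p => (√2)⁻¹ • p.1 + (√2)⁻¹ • p.2) := by
  have hm1 : Measurable (fun z : E => (√2)⁻¹ • z) := by fun_prop
  have : IsProbabilityMeasure ((stdGaussian E).map (fun z : E => (√2)⁻¹ • z)) :=
    Measure.isProbabilityMeasure_map hm1.aemeasurable
  have : stdGaussian E = ((stdGaussian E).map (fun z : E => (√2)⁻¹ • z)) ∗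
      ((stdGaussian E).map (fun z : E => (√2)⁻¹ • z)) := by
    refine Measure.ext_of_charFun ?_
    ext t
    rw [charFun_conv, charFun_map_smul, charFun_stdGaussian, charFun_stdGaussian, ← Complex.exp_add,
      norm_smul, norm_inv, Real.norm_eq_abs, abs_of_nonneg (Real.sqrt_nonneg _)]
    congr 1
    push_cast
    rw [mul_pow, inv_pow, ← Complex.ofReal_pow √2, Real.sq_sqrt (by norm_num)]
    push_cast; ring
  conv_lhs => rw [this]
  rw [Measure.conv, Measure.map_prod_map _ _ hm1 hm1, Measure.map_map (by fun_prop) (by fun_prop)]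
  rfl

lemma abs_integral_stdGaussian_second_difference_le {U : E → ℝ} (hU : Measurable U) {M : ℝ}
    (hM : ∀ x, |U x| ≤ M) (a h : E) :
    |∫ z, (U (z + a + h) - U (z + a) - U (z + h) + U z) ∂(stdGaussian E)|
      ≤ 8 * M * ‖a‖ * ‖h‖ := by
  have hM0 : 0 ≤ M := (abs_nonneg _).trans (hM 0)
  set N := stdGaussian E
  set G : E → ℝ := fun y => ∫ z, (U ((√2)⁻¹ • z + (y + h)) - U ((√2)⁻¹ • z + y)) ∂N with hG
  have hs : (0:ℝ) < √2 := by positivity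
  have hGm : Measurable G := by
    refine StronglyMeasurable.measurable ?_
    refine StronglyMeasurable.integral_prod_right
      (f := fun y z => U ((√2)⁻¹ • z + (y + h)) - U ((√2)⁻¹ • z + y)) ?_
    refine Measurable.stronglyMeasurable ?_
    fun_prop
  have hGb : ∀ y, |G y| ≤ 2 * M * (√2 * ‖h‖) := by
    intro y
    have := abs_integral_stdGaussian_shift_sub_le (U := fun z : E => U ((√2)⁻¹ • z + y))
      (by fun_prop) (fun _ => hM _) (√2 • h)
    rw [norm_smul, Real.norm_eq_abs, abs_of_pos hs] at this
    rw [hG]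
    dsimp only
    rw [integral_sub]
    · convert this using 6 with z
      rw [smul_add, smul_smul, inv_mul_cancel₀ hs.ne', one_smul]; abel
    · exact integrable_of_abs_le (by fun_prop) (fun _ => hM _)
    · exact integrable_of_abs_le (by fun_prop) (fun _ => hM _)
  have h2 := abs_integral_stdGaussian_shift_sub_le (U := fun z : E => G ((√2)⁻¹ • z))
      (by fun_prop) (fun _ => hGb _) (√2 • a)
  have hF : ∀ F : E → ℝ, Measurable F → (∀ x, |F x| ≤ 4 * M) →
      ∫ z, F z ∂N = ∫ y, ∫ z, F ((√2)⁻¹ • z + (√2)⁻¹ • y) ∂N ∂N := by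
    intro F hF hFM
    have hI : Integrable (fun p : E × E => F ((√2)⁻¹ • p.1 + (√2)⁻¹ • p.2)) (N.prod N) :=
      integrable_of_abs_le (by fun_prop) (fun _ => hFM _)
    conv_lhs => rw [show N = (N.prod N).map _ from stdGaussian_eq_map_prod]
    rw [integral_map (by fun_prop) hF.aestronglyMeasurable, integral_prod_symm _ hI]
  rw [hF _ (by fun_prop)]
  · have e : ∀ y : E, ∫ z, (U ((√2)⁻¹ • z + (√2)⁻¹ • y + a + h) - U ((√2)⁻¹ • z + (√2)⁻¹ • y + a)
        - U ((√2)⁻¹ • z + (√2)⁻¹ • y + h) + U ((√2)⁻¹ • z + (√2)⁻¹ • y)) ∂N =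
        G ((√2)⁻¹ • (y + √2 • a)) - G ((√2)⁻¹ • y) := by
      intro y
      rw [hG]
      dsimp only
      rw [← integral_sub]
      · congr 1; ext z
        rw [smul_add (√2)⁻¹ y, smul_smul, inv_mul_cancel₀ hs.ne', one_smul]
        simp only [add_assoc]
        ring
      · exact integrable_of_abs_le (M := 2 * M) (by fun_prop)
          (fun x => (abs_sub _ _).trans (by
            linarith [hM ((√2)⁻¹ • x + ((√2)⁻¹ • (y + √2 • a) + h)),
              hM ((√2)⁻¹ • x + (√2)⁻¹ • (y + √2 • a))]))
      · exact integrable_of_abs_le (M := 2 * M) (by fun_prop)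
          (fun x => (abs_sub _ _).trans (by
            linarith [hM ((√2)⁻¹ • x + ((√2)⁻¹ • y + h)), hM ((√2)⁻¹ • x + (√2)⁻¹ • y)]))
    simp_rw [e]
    rw [integral_sub]
    · refine h2.trans (le_of_eq ?_)
      rw [norm_smul, Real.norm_eq_abs, abs_of_pos hs]
      have : √2 * √2 = 2 := Real.mul_self_sqrt (by norm_num)
      linear_combination (4 * M * ‖a‖ * ‖h‖) * this
    · exact integrable_of_abs_le (by fun_prop) (fun _ => hGb _)
    · exact integrable_of_abs_le (by fun_prop) (fun _ => hGb _)
  · intro x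
    have h1 := hM (x + a + h)
    have h2 := hM (x + a)
    have h3 := hM (x + h)
    have h4 := hM x
    rw [abs_le] at *
    constructor <;> linarith

/-- Gaussian average of `V` at scale `σ`. -/
def gaussAvg (V : E → ℝ) (σ : ℝ) (x : E) : ℝ := ∫ z, V (σ • z + x) ∂(stdGaussian E)

lemma abs_gaussAvg_sub_le {V : E → ℝ} (hV : Measurable V) {M : ℝ} (hM : ∀ x, |V x| ≤ M)
    {σ : ℝ} (hσ : 0 < σ) (x y : E) :
    |gaussAvg V σ x - gaussAvg V σ y| ≤ 2 * M * (‖x - y‖ / σ) := by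
  have := abs_integral_stdGaussian_shift_sub_le (U := fun z => V (σ • z + y)) (by fun_prop)
    (fun _ => hM _) (σ⁻¹ • (x - y))
  rw [norm_smul, norm_inv, Real.norm_eq_abs, abs_of_pos hσ, inv_mul_eq_div] at this
  have e : gaussAvg V σ x = ∫ z, V (σ • (z + σ⁻¹ • (x - y)) + y) ∂(stdGaussian E) := by
    unfold gaussAvg
    congr 1; ext z
    rw [smul_add, smul_smul, mul_inv_cancel₀ hσ.ne', one_smul]
    congr 1; abel
  rw [e]
  exact this

lemma abs_gaussAvg_second_difference_le {V : E → ℝ} (hV : Measurable V) {M : ℝ}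
    (hM : ∀ x, |V x| ≤ M) {σ : ℝ} (hσ : 0 < σ) (x a h : E) :
    |gaussAvg V σ (x + a + h) - gaussAvg V σ (x + a) - gaussAvg V σ (x + h) + gaussAvg V σ x|
      ≤ 8 * M * (‖a‖ * ‖h‖ / σ ^ 2) := by
  have := abs_integral_stdGaussian_second_difference_le (U := fun z => V (σ • z + x)) (by fun_prop)
    (fun _ => hM _) (σ⁻¹ • a) (σ⁻¹ • h)
  have hI : ∀ y : E, Integrable (fun z => V (σ • z + y)) (stdGaussian E) := fun y =>
    integrable_of_abs_le (by fun_prop) (fun _ => hM _)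
  rw [norm_smul, norm_smul, norm_inv, Real.norm_eq_abs, abs_of_pos hσ] at this
  have e : 8 * M * (σ⁻¹ * ‖a‖) * (σ⁻¹ * ‖h‖) = 8 * M * (‖a‖ * ‖h‖ / σ ^ 2) := by
    field_simp
  rw [e] at this
  convert this using 2
  simp only [gaussAvg]
  have hI2 : ∀ y y' : E, Integrable (fun z => V (σ • z + y) - V (σ • z + y')) (stdGaussian E) :=
    fun y y' => (hI y).sub (hI y')
  have hI3 : ∀ y y' y'' : E, Integrable
      (fun z => V (σ • z + y) - V (σ • z + y') - V (σ • z + y'')) (stdGaussian E) :=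
    fun y y' y'' => (hI2 y y').sub (hI y'')
  rw [← integral_sub (hI _) (hI _), ← integral_sub (hI2 _ _) (hI _),
    ← integral_add (hI3 _ _ _) (hI _)]
  congr 1; ext z
  simp only [smul_add, smul_smul, mul_inv_cancel₀ hσ.ne', one_smul]
  congr 1
  · congr 1
    · congr 1
      · congr 1; abel
      · congr 1; abel
    · congr 1; abel

end Std

end

section

/-- Projection of the plane onto the unit square. -/
def clampSquare (p : ℝ × ℝ) : ℝ × ℝ := (max 0 (min p.1 1), max 0 (min p.2 1))

lemma clampSquare_mem (p : ℝ × ℝ) : clampSquare p ∈ Icc (0 : ℝ × ℝ) 1 := by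
  simp [clampSquare, Prod.le_def]

lemma clampSquare_of_mem {p : ℝ × ℝ} (hp : p ∈ Icc (0 : ℝ × ℝ) 1) : clampSquare p = p := by
  obtain ⟨h0, h1⟩ := hp
  simp only [Prod.le_def, Prod.fst_zero, Prod.snd_zero, Prod.fst_one, Prod.snd_one] at h0 h1
  ext <;> simp [clampSquare, h0, h1]

lemma continuous_clampSquare : Continuous clampSquare := by
  unfold clampSquare; fun_prop

section Sheet
variable {Ω : Type*} [MeasurableSpace Ω] {P : Measure Ω} {d : ℕ}
  {W : ℝ × ℝ → Ω → EuclideanSpace ℝ (Fin d)}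

/-- Extension of a sheet on the unit square to the plane, constant along rays off the square. -/
def sheetExt (W : ℝ × ℝ → Ω → EuclideanSpace ℝ (Fin d)) (p : ℝ × ℝ) (ω : Ω) :
    EuclideanSpace ℝ (Fin d) := W (clampSquare p) ω

lemma IsBrownianSheet.measurable_sheetExt (hW : IsBrownianSheet P d W) (p : ℝ × ℝ) :
    Measurable (sheetExt W p) := hW.1 _

lemma IsBrownianSheet.continuous_sheetExt (hW : IsBrownianSheet P d W) (ω : Ω) :
    Continuous (fun p => sheetExt W p ω) :=
  (hW.2.1 ω).comp_continuous continuous_clampSquare clampSquare_mem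

lemma IsBrownianSheet.map_sum (hW : IsBrownianSheet P d W) {ι : Type*} [Fintype ι]
    (p : ι → (ℝ × ℝ) × Fin d) (c : ι → ℝ) :
    P.map (fun ω => ∑ j, c j * sheetExt W (p j).1 ω (p j).2) =
      gaussianReal 0 (∑ j, ∑ k, c j * c k *
        (if (p j).2 = (p k).2 then min (clampSquare (p j).1).1 (clampSquare (p k).1).1 *
          min (clampSquare (p j).1).2 (clampSquare (p k).1).2 else 0)).toNNReal := by
  let e := Fintype.equivFin ι
  have := hW.2.2.2 (Fintype.card ι) (fun j => clampSquare (p (e.symm j)).1)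
    (fun j => (p (e.symm j)).2) (fun j => c (e.symm j)) (fun j => clampSquare_mem _)
  have e1 : ∀ ω, ∑ j, c j * sheetExt W (p j).1 ω (p j).2 =
      ∑ j, c (e.symm j) * W (clampSquare (p (e.symm j)).1) ω (p (e.symm j)).2 := fun ω =>
    (Equiv.sum_comp e.symm (fun j => c j * sheetExt W (p j).1 ω (p j).2)).symm
  simp_rw [e1]
  rw [this]
  congr 2
  rw [← Equiv.sum_comp e.symm]
  refine Finset.sum_congr rfl fun j _ => ?_
  rw [← Equiv.sum_comp e.symm]

lemma IsBrownianSheet.measurable_coord (hW : IsBrownianSheet P d W) (p : (ℝ × ℝ) × Fin d) :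
    Measurable (fun ω => sheetExt W p.1 ω p.2) := by
  have := hW.measurable_sheetExt p.1
  fun_prop

lemma IsBrownianSheet.isGaussianProcess (hW : IsBrownianSheet P d W) :
    IsGaussianProcess (fun (p : (ℝ × ℝ) × Fin d) ω => sheetExt W p.1 ω p.2) P where
  hasGaussianLaw I := by
    have hm : Measurable (fun ω => I.restrict
        (fun p : (ℝ × ℝ) × Fin d => sheetExt W p.1 ω p.2)) :=
      measurable_pi_lambda _ fun i => hW.measurable_coord i.1
    refine ⟨isGaussian_of_map_eq_gaussianReal fun L => ?_⟩
    refine ⟨0, _, Eq.trans ?_ (hW.map_sum (ι := I) (fun i => i.1) (fun i => L (Pi.single i 1)))⟩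
    · rw [Measure.map_map (by fun_prop) hm]
      congr 1
      ext ω
      simp only [Function.comp]
      conv_lhs => rw [← Finset.univ_sum_single (I.restrict
        (fun p : (ℝ × ℝ) × Fin d => sheetExt W p.1 ω p.2)), _root_.map_sum]
      refine Finset.sum_congr rfl fun i _ => ?_
      rw [mul_comm, ← smul_eq_mul, ← map_smul]
      congr 1
      ext j
      rcases eq_or_ne j i with rfl | h
      · simp
      · simp [h]

lemma IsBrownianSheet.memLp_coord (hW : IsBrownianSheet P d W) (p : (ℝ × ℝ) × Fin d) :
    MemLp (fun ω => sheetExt W p.1 ω p.2) 2 P :=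
  (hW.isGaussianProcess.hasGaussianLaw_eval p).memLp_two

lemma IsBrownianSheet.variance_sum (hW : IsBrownianSheet P d W) {ι : Type*} [Fintype ι]
    (p : ι → (ℝ × ℝ) × Fin d) (c : ι → ℝ) :
    Var[fun ω => ∑ j, c j * sheetExt W (p j).1 ω (p j).2; P] =
      (∑ j, ∑ k, c j * c k *
        (if (p j).2 = (p k).2 then min (clampSquare (p j).1).1 (clampSquare (p k).1).1 *
          min (clampSquare (p j).1).2 (clampSquare (p k).1).2 else 0)).toNNReal := by
  have hm : Measurable (fun ω => ∑ j, c j * sheetExt W (p j).1 ω (p j).2) :=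
    Finset.measurable_sum _ fun j _ => (hW.measurable_coord (p j)).const_mul _
  rw [← Function.id_comp (fun ω => ∑ j, c j * sheetExt W (p j).1 ω (p j).2),
    ← variance_map (by fun_prop) hm.aemeasurable, hW.map_sum, variance_id_gaussianReal]

lemma IsBrownianSheet.covariance [IsProbabilityMeasure P] (hW : IsBrownianSheet P d W)
    (p q : (ℝ × ℝ) × Fin d) :
    cov[fun ω => sheetExt W p.1 ω p.2, fun ω => sheetExt W q.1 ω q.2; P] =
      if p.2 = q.2 then min (clampSquare p.1).1 (clampSquare q.1).1 *
          min (clampSquare p.1).2 (clampSquare q.1).2 else 0 := by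
  have h1 := hW.variance_sum (fun i : Fin 1 => p) (fun _ => 1)
  have h2 := hW.variance_sum (fun i : Fin 1 => q) (fun _ => 1)
  have h3 := hW.variance_sum ![p, q] (fun _ => 1)
  simp only [Finset.univ_unique, Finset.sum_const, Finset.card_singleton, one_smul, one_mul,
    Fin.sum_univ_two, Matrix.cons_val_zero, Matrix.cons_val_one, if_true, min_self] at h1 h2 h3
  have h4 := variance_add (hW.memLp_coord p) (hW.memLp_coord q)
  have hp := clampSquare_mem p.1
  have hq := clampSquare_mem q.1
  simp only [mem_Icc, Prod.le_def, Prod.fst_zero, Prod.snd_zero, Prod.fst_one, Prod.snd_one]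
    at hp hq
  have hp0 : 0 ≤ (clampSquare p.1).1 * (clampSquare p.1).2 := mul_nonneg hp.1.1 hp.1.2
  have hq0 : 0 ≤ (clampSquare q.1).1 * (clampSquare q.1).2 := mul_nonneg hq.1.1 hq.1.2
  have hpq0 : 0 ≤ min (clampSquare p.1).1 (clampSquare q.1).1 *
          min (clampSquare p.1).2 (clampSquare q.1).2 :=
    mul_nonneg (le_min hp.1.1 hq.1.1) (le_min hp.1.2 hq.1.2)
  change Var[fun ω => sheetExt W p.1 ω p.2 + sheetExt W q.1 ω q.2; P] = _ at h4
  rw [h1, h2, h3] at h4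
  rw [min_comm (clampSquare q.1).1, min_comm (clampSquare q.1).2] at h4
  by_cases h : p.2 = q.2
  · simp only [h, if_true] at h4 ⊢
    rw [Real.coe_toNNReal _ hp0, Real.coe_toNNReal _ hq0,
      Real.coe_toNNReal _ (by positivity)] at h4
    linarith
  · simp only [h, Ne.symm h, if_false, add_zero, zero_add] at h4 ⊢
    rw [Real.coe_toNNReal _ hp0, Real.coe_toNNReal _ hq0,
      Real.coe_toNNReal _ (by positivity)] at h4
    linarith

/-- The sheet stopped at time `u` in its second parameter. -/
def stoppedSheet (W : ℝ × ℝ → Ω → EuclideanSpace ℝ (Fin d)) (u : ℝ) (ω : Ω) (q : ℝ × ℝ) :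
    EuclideanSpace ℝ (Fin d) := sheetExt W (q.1, min q.2 u) ω

lemma IsBrownianSheet.indepFun_increment [IsProbabilityMeasure P] (hW : IsBrownianSheet P d W)
    {s u t : ℝ} (hut : u ≤ t) :
    IndepFun (fun ω => sheetExt W (s, t) ω - sheetExt W (s, u) ω) (stoppedSheet W u) P := by
  let Y : Fin d → Ω → ℝ := fun k ω => sheetExt W (s, t) ω k - sheetExt W (s, u) ω k
  let Z : (ℝ × ℝ) × Fin d → Ω → ℝ := fun q ω => sheetExt W (q.1.1, min q.1.2 u) ω q.2
  have hY : ∀ k, Measurable (Y k) := fun k =>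
    (hW.measurable_coord ((s, t), k)).sub (hW.measurable_coord ((s, u), k))
  have hZ : ∀ q, Measurable (Z q) := fun q => hW.measurable_coord ((q.1.1, min q.1.2 u), q.2)
  have hYZ : IsGaussianProcess (Sum.elim Y Z) P := by
    classical
    refine hW.isGaussianProcess.of_isGaussianProcess fun x => ?_
    rcases x with k | q
    · refine ⟨{((s, t), k), ((s, u), k)},
        ContinuousLinearMap.proj (R := ℝ) (φ := fun _ => ℝ) ⟨((s, t), k), by simp⟩ -
        ContinuousLinearMap.proj (R := ℝ) (φ := fun _ => ℝ) ⟨((s, u), k), by simp⟩, fun ω => ?_⟩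
      simp [Y]
    · exact ⟨{((q.1.1, min q.1.2 u), q.2)},
        ContinuousLinearMap.proj (R := ℝ) (φ := fun _ => ℝ) ⟨((q.1.1, min q.1.2 u), q.2), by simp⟩,
        fun ω => by simp [Z]⟩
  have h := hYZ.indepFun_of_covariance_eq_zero (fun k => (hY k).aemeasurable)
    (fun q => (hZ q).aemeasurable) (fun k q => by
      have := covariance_fun_sub_left (hW.memLp_coord ((s, t), k)) (hW.memLp_coord ((s, u), k))
        (hW.memLp_coord ((q.1.1, min q.1.2 u), q.2))
      simp only [Y, Z]
      rw [this, hW.covariance, hW.covariance]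
      by_cases hk : k = q.2
      · simp only [hk, if_true, clampSquare]
        have e : min (max 0 (min t 1)) (max 0 (min (min q.1.2 u) 1)) =
            min (max 0 (min u 1)) (max 0 (min (min q.1.2 u) 1)) := by
          have h1 : max 0 (min (min q.1.2 u) 1) ≤ max 0 (min u 1) :=
            max_le_max le_rfl (min_le_min (min_le_right _ _) le_rfl)
          have h2 : max 0 (min u 1) ≤ max 0 (min t 1) :=
            max_le_max le_rfl (min_le_min hut le_rfl)
          rw [min_eq_right h1, min_eq_right (h1.trans h2)]
        rw [e, sub_self]
      · simp [hk])
  have h2 := h.comp (φ := fun y : Fin d → ℝ => WithLp.toLp 2 y)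
    (ψ := fun (z : (ℝ × ℝ) × Fin d → ℝ) (q : ℝ × ℝ) => WithLp.toLp 2 (fun k => z (q, k)))
    (by fun_prop) (by fun_prop)
  exact h2

lemma IsBrownianSheet.map_increment [IsProbabilityMeasure P] (hW : IsBrownianSheet P d W)
    {s u t : ℝ} (hs : 0 ≤ s) (hs1 : s ≤ 1) (hu : 0 ≤ u) (hut : u ≤ t) (ht : t ≤ 1) :
    P.map (fun ω => sheetExt W (s, t) ω - sheetExt W (s, u) ω) =
      (stdGaussian (EuclideanSpace ℝ (Fin d))).map (fun z => √(s * (t - u)) • z) := by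
  have hm : Measurable (fun ω => sheetExt W (s, t) ω - sheetExt W (s, u) ω) :=
    (hW.measurable_sheetExt _).sub (hW.measurable_sheetExt _)
  have : IsProbabilityMeasure (P.map (fun ω => sheetExt W (s, t) ω - sheetExt W (s, u) ω)) :=
    Measure.isProbabilityMeasure_map hm.aemeasurable
  have : IsProbabilityMeasure ((stdGaussian (EuclideanSpace ℝ (Fin d))).map
      (fun z => √(s * (t - u)) • z)) :=
    Measure.isProbabilityMeasure_map (Measurable.aemeasurable (by fun_prop))
  refine Measure.ext_of_charFun ?_
  ext x
  have hv : 0 ≤ s * (t - u) := mul_nonneg hs (by linarith)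
  rw [charFun_map_smul, charFun_stdGaussian, norm_smul, Real.norm_eq_abs,
    abs_of_nonneg (Real.sqrt_nonneg _)]
  have e1 : charFun (P.map (fun ω => sheetExt W (s, t) ω - sheetExt W (s, u) ω)) x =
      charFun (P.map (fun ω => inner ℝ (sheetExt W (s, t) ω - sheetExt W (s, u) ω) x)) 1 := by
    rw [charFun_apply, charFun_apply, integral_map hm.aemeasurable (by fun_prop),
      integral_map (Measurable.aemeasurable (by fun_prop)) (by fun_prop)]
    simp
  have e2 : ∀ ω, inner ℝ (sheetExt W (s, t) ω - sheetExt W (s, u) ω) x =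
      ∑ j : Fin d ⊕ Fin d, Sum.elim (fun k => x k) (fun k => - x k) j *
        sheetExt W (Sum.elim (fun k => ((s, t), k)) (fun k => ((s, u), k)) j).1 ω
        (Sum.elim (fun k => ((s, t), k)) (fun k => ((s, u), k)) j : (ℝ × ℝ) × Fin d).2 := by
    intro ω
    rw [Fintype.sum_sum_type, PiLp.inner_apply]
    simp only [Sum.elim_inl, Sum.elim_inr, PiLp.sub_apply, RCLike.inner_apply, conj_trivial]
    rw [← Finset.sum_add_distrib]
    refine Finset.sum_congr rfl fun k _ => by ring
  simp_rw [e1, e2]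
  have hc1 : clampSquare (s, t) = (s, t) :=
    clampSquare_of_mem ⟨⟨hs, hu.trans hut⟩, ⟨hs1, ht⟩⟩
  have hc2 : clampSquare (s, u) = (s, u) :=
    clampSquare_of_mem ⟨⟨hs, hu⟩, ⟨hs1, hut.trans ht⟩⟩
  rw [hW.map_sum, charFun_gaussianReal]
  simp only [Fintype.sum_sum_type, Sum.elim_inl, Sum.elim_inr, hc1, hc2, min_self,
    min_eq_left hut, min_eq_right hut, mul_ite, mul_zero, Finset.sum_ite_eq, Finset.mem_univ,
    if_true]
  have e3 : (∑ i : Fin d, (x i * x i * (s * t) + x i * -x i * (s * u))) +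
      ∑ i : Fin d, (-x i * x i * (s * u) + -x i * -x i * (s * u)) = s * (t - u) * ‖x‖ ^ 2 := by
    rw [EuclideanSpace.real_norm_sq_eq, Finset.mul_sum, ← Finset.sum_add_distrib]
    refine Finset.sum_congr rfl fun k _ => by ring
  have e4 : ((∑ i : Fin d, (x i * x i * (s * t)) + ∑ i : Fin d, x i * -x i * (s * u)) +
      (∑ i : Fin d, -x i * x i * (s * u) + ∑ i : Fin d, -x i * -x i * (s * u))) =
      s * (t - u) * ‖x‖ ^ 2 := by
    rw [← e3, Finset.sum_add_distrib, Finset.sum_add_distrib]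
  simp only [Finset.sum_add_distrib]
  rw [e4, ← Complex.ofReal_pow (√(s * (t - u)) * ‖x‖), mul_pow, Real.sq_sqrt hv]
  have : (((s * (t - u) * ‖x‖ ^ 2).toNNReal : ℝ) : ℂ) = ((s * (t - u) * ‖x‖ ^ 2 : ℝ) : ℂ) := by
    rw [Real.coe_toNNReal _ (by positivity)]
  rw [this]
  congr 1
  push_cast; ring

lemma IsBrownianSheet.integral_comp_increment_add [IsProbabilityMeasure P]
    (hW : IsBrownianSheet P d W)
    {s u t : ℝ} (hs : 0 ≤ s) (hs1 : s ≤ 1) (hu : 0 ≤ u) (hut : u ≤ t) (ht : t ≤ 1)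
    {V : EuclideanSpace ℝ (Fin d) → ℝ} (hV : Measurable V) {M : ℝ} (hM : ∀ x, |V x| ≤ M)
    {X : Ω → EuclideanSpace ℝ (Fin d)} (hXm : Measurable X)
    (hX : Measurable[MeasurableSpace.comap (stoppedSheet W u) inferInstance] X) :
    ∫ ω, V (sheetExt W (s, t) ω - sheetExt W (s, u) ω + X ω) ∂P =
      ∫ ω, gaussAvg V √(s * (t - u)) (X ω) ∂P := by
  have hm : Measurable (fun ω => sheetExt W (s, t) ω - sheetExt W (s, u) ω) :=
    (hW.measurable_sheetExt _).sub (hW.measurable_sheetExt _)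
  have hind : IndepFun (fun ω => sheetExt W (s, t) ω - sheetExt W (s, u) ω) X P := by
    have := hW.indepFun_increment (s := s) hut
    rw [IndepFun_iff_Indep] at this ⊢
    exact indep_of_indep_of_le_right this (measurable_iff_comap_le.1 hX)
  rw [indepFun_iff_map_prod_eq_prod_map_map hm.aemeasurable hXm.aemeasurable] at hind
  have : IsProbabilityMeasure (P.map X) := Measure.isProbabilityMeasure_map hXm.aemeasurable
  have e1 : ∫ ω, V (sheetExt W (s, t) ω - sheetExt W (s, u) ω + X ω) ∂P =
      ∫ q, V (q.1 + q.2) ∂(P.map (fun ω => (sheetExt W (s, t) ω - sheetExt W (s, u) ω, X ω))) := by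
    rw [integral_map (hm.prodMk hXm).aemeasurable (Measurable.aestronglyMeasurable (by fun_prop))]
  have : IsProbabilityMeasure (P.map (fun ω => sheetExt W (s, t) ω - sheetExt W (s, u) ω)) :=
    Measure.isProbabilityMeasure_map hm.aemeasurable
  rw [e1, hind, integral_prod_symm _ (integrable_of_abs_le (by fun_prop) (fun _ => hM _)),
    integral_map hXm.aemeasurable]
  · congr 1; ext ω
    rw [hW.map_increment hs hs1 hu hut ht, gaussAvg, integral_map (by fun_prop)
      (Measurable.aestronglyMeasurable (by fun_prop))]
  · refine StronglyMeasurable.aestronglyMeasurable ?_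
    exact StronglyMeasurable.integral_prod_right (f := fun y x => V (x + y))
      (Measurable.stronglyMeasurable (by fun_prop))

end Sheet

end

section

/-- The diagonal vector `(1, …, 1)`. -/
def diagVec (d : ℕ) : EuclideanSpace ℝ (Fin d) := WithLp.toLp 2 (fun _ => 1)

@[simp] lemma diagVec_apply {d : ℕ} (k : Fin d) : diagVec d k = 1 := rfl

/-- Componentwise monotonicity of a real function on `ℝ^d`. -/
def CoordMono {d : ℕ} (f : EuclideanSpace ℝ (Fin d) → ℝ) : Prop :=
  ∀ x y : EuclideanSpace ℝ (Fin d), (∀ k, x k ≤ y k) → f x ≤ f y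

/-- `V` is a measurable, bounded, componentwise monotone function which dominates the
oscillation of `b` along measurable curves. -/
structure Dominates {α : Type*} [MeasurableSpace α] {d : ℕ} (μ : Measure α)
    (b : α → EuclideanSpace ℝ (Fin d) → EuclideanSpace ℝ (Fin d))
    (V : α → EuclideanSpace ℝ (Fin d) → ℝ) (M : ℝ) : Prop where
  meas : Measurable (fun q : α × EuclideanSpace ℝ (Fin d) => V q.1 q.2)
  nonneg : ∀ p x, 0 ≤ V p x
  le : ∀ p x, V p x ≤ M
  mono : ∀ p, CoordMono (V p)
  osc : ∀ x y : α → EuclideanSpace ℝ (Fin d), Measurable x → Measurable y →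
    ∀ θ : α → ℝ, ∀ κ : ℝ, 0 < κ →
    ∀ᵐ p ∂μ, (∀ k, |x p k - y p k| ≤ θ p) →
      ‖b p (x p) - b p (y p)‖ ≤
        V p (y p + (θ p + κ) • diagVec d) - V p (y p - (θ p + κ) • diagVec d)

lemma ae_le_of_le_of_lintegral_eq {α : Type*} [MeasurableSpace α] {μ : Measure α}
    {A V O : α → ENNReal} (hA : Measurable A) (hV : Measurable V) (hVO : V ≤ O) (hAO : A ≤ O)
    (hint : ∫⁻ a, O a ∂μ = ∫⁻ a, V a ∂μ) (hfin : ∫⁻ a, O a ∂μ ≠ ⊤) : A ≤ᵐ[μ] V := by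
  have h1 : V ≤ᵐ[μ] fun a => max (A a) (V a) := ae_of_all _ fun a => le_max_right _ _
  have h2 : ∫⁻ a, max (A a) (V a) ∂μ ≤ ∫⁻ a, V a ∂μ := by
    rw [← hint]
    exact lintegral_mono fun a => max_le (hAO a) (hVO a)
  have h3 := ae_eq_of_ae_le_of_lintegral_le h1 (hint ▸ hfin) (hA.max hV).aemeasurable h2
  filter_upwards [h3] with a ha
  rw [ha]; exact le_max_left _ _

lemma exists_dominates {α : Type*} [MeasurableSpace α] {d : ℕ} (μ : Measure α)
    [IsFiniteMeasure μ]
    {b : α → EuclideanSpace ℝ (Fin d) → EuclideanSpace ℝ (Fin d)}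
    (hb : Measurable (fun q : α × EuclideanSpace ℝ (Fin d) => b q.1 q.2))
    {g : α → EuclideanSpace ℝ (Fin d) → ℝ} {M : ℝ} (hg0 : ∀ p x, 0 ≤ g p x)
    (hgM : ∀ p x, g p x ≤ M)
    (hbg : ∀ p (q q' x y : EuclideanSpace ℝ (Fin d)), (∀ k, q k ≤ x k) → (∀ k, q k ≤ y k) →
      (∀ k, x k ≤ q' k) → (∀ k, y k ≤ q' k) → ‖b p x - b p y‖ ≤ g p q' - g p q) :
    ∃ V, Dominates μ b V M := by
  let r : (Fin d → ℚ) → EuclideanSpace ℝ (Fin d) := fun q => WithLp.toLp 2 fun k => (q k : ℝ)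
  have hr : ∀ q k, r q k = (q k : ℝ) := fun _ _ => rfl
  have hex : ∀ q : Fin d → ℚ, ∃ v : α → ENNReal, Measurable v ∧
      v ≤ (fun p => ENNReal.ofReal (g p (r q))) ∧
      ∫⁻ p, ENNReal.ofReal (g p (r q)) ∂μ = ∫⁻ p, v p ∂μ :=
    fun q => exists_measurable_le_lintegral_eq μ _
  choose v hvm hvle hvint using hex
  let VE : α → EuclideanSpace ℝ (Fin d) → ENNReal := fun p x =>
    ⨆ q : Fin d → ℚ, if ∀ k, (q k : ℝ) ≤ x k then v q p else 0
  have hM0 : ∀ p : α, 0 ≤ M := fun p => (hg0 p 0).trans (hgM p 0)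
  have hvM : ∀ q p, v q p ≤ ENNReal.ofReal M := fun q p =>
    (hvle q p).trans (ENNReal.ofReal_le_ofReal (hgM _ _))
  have hVEM : ∀ p x, VE p x ≤ ENNReal.ofReal M := fun p x => iSup_le fun q => by
    split_ifs
    · exact hvM q p
    · exact zero_le
  have hVEtop : ∀ p x, VE p x ≠ ⊤ := fun p x => ne_top_of_le_ne_top ENNReal.ofReal_ne_top (hVEM p x)
  have hVEmono : ∀ p (x y : EuclideanSpace ℝ (Fin d)), (∀ k, x k ≤ y k) → VE p x ≤ VE p y := by
    intro p x y hxy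
    refine iSup_mono fun q => ?_
    split_ifs with h1 h2
    · exact le_rfl
    · exact absurd (fun k => (h1 k).trans (hxy k)) h2
    · exact zero_le
    · exact le_rfl
  refine ⟨fun p x => (VE p x).toReal, ?_, fun _ _ => ENNReal.toReal_nonneg, fun p x => ?_,
    fun p x y hxy => ENNReal.toReal_mono (hVEtop _ _) (hVEmono p x y hxy), ?_⟩
  · refine Measurable.ennreal_toReal ?_
    refine Measurable.iSup fun q => ?_
    refine Measurable.ite ?_ ((hvm q).comp measurable_fst) measurable_const
    simp only [ofPred_forall]
    refine MeasurableSet.iInter fun k => measurableSet_le measurable_const (by fun_prop)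
  · exact ENNReal.toReal_le_of_le_ofReal (hM0 p) (hVEM p x)
  · intro x y hx hy θ κ hκ
    have hbm : Measurable (fun p => ENNReal.ofReal ‖b p (x p) - b p (y p)‖) := by
      have h1 : Measurable (fun p => b p (x p)) := hb.comp (measurable_id.prodMk hx)
      have h2 : Measurable (fun p => b p (y p)) := hb.comp (measurable_id.prodMk hy)
      exact (h1.sub h2).norm.ennreal_ofReal
    have key : ∀ q q' : Fin d → ℚ, ∀ᵐ p ∂μ, ((∀ k, (q k : ℝ) ≤ x p k) ∧ (∀ k, (q k : ℝ) ≤ y p k) ∧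
        (∀ k, x p k ≤ q' k) ∧ (∀ k, y p k ≤ q' k)) →
        v q p + ENNReal.ofReal ‖b p (x p) - b p (y p)‖ ≤ v q' p := by
      intro q q'
      let S : Set α := {p | (∀ k, (q k : ℝ) ≤ x p k) ∧ (∀ k, (q k : ℝ) ≤ y p k) ∧
        (∀ k, x p k ≤ q' k) ∧ (∀ k, y p k ≤ q' k)}
      have hS : MeasurableSet S := by
        have hxk : ∀ k, Measurable (fun p => x p k) := fun k => by fun_prop
        have hyk : ∀ k, Measurable (fun p => y p k) := fun k => by fun_prop
        simp only [S, ofPred_and, ofPred_forall]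
        refine (MeasurableSet.iInter fun k => measurableSet_le measurable_const (hxk k)).inter
          ((MeasurableSet.iInter fun k => measurableSet_le measurable_const (hyk k)).inter
          ((MeasurableSet.iInter fun k => measurableSet_le (hxk k) measurable_const).inter
          (MeasurableSet.iInter fun k => measurableSet_le (hyk k) measurable_const)))
      have hAO : S.indicator (fun p => v q p + ENNReal.ofReal ‖b p (x p) - b p (y p)‖) ≤
          (fun p => ENNReal.ofReal (g p (r q'))) := by
        intro p
        by_cases hp : p ∈ S
        · rw [indicator_of_mem hp]
          have := hbg p (r q) (r q') (x p) (y p) hp.1 hp.2.1 hp.2.2.1 hp.2.2.2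
          calc v q p + ENNReal.ofReal ‖b p (x p) - b p (y p)‖
              ≤ ENNReal.ofReal (g p (r q)) + ENNReal.ofReal (g p (r q') - g p (r q)) :=
                add_le_add (hvle q p) (ENNReal.ofReal_le_ofReal this)
            _ = ENNReal.ofReal (g p (r q')) := by
                rw [← ENNReal.ofReal_add (hg0 _ _) ((norm_nonneg _).trans this)]
                congr 1; ring
        · rw [indicator_of_notMem hp]; exact zero_le
      have hfin : ∫⁻ p, ENNReal.ofReal (g p (r q')) ∂μ ≠ ⊤ := by
        refine ne_top_of_le_ne_top ?_ (lintegral_mono fun p =>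
          ENNReal.ofReal_le_ofReal (hgM p (r q')))
        rw [lintegral_const]
        exact ENNReal.mul_ne_top ENNReal.ofReal_ne_top (measure_ne_top _ _)
      have := ae_le_of_le_of_lintegral_eq (((hvm q).add hbm).indicator hS) (hvm q') (hvle q') hAO
        (hvint q') hfin
      filter_upwards [this] with p hp hpS
      rwa [indicator_of_mem (show p ∈ S from hpS)] at hp
    have key2 : ∀ᵐ p ∂μ, ∀ q q' : Fin d → ℚ, ((∀ k, (q k : ℝ) ≤ x p k) ∧
        (∀ k, (q k : ℝ) ≤ y p k) ∧ (∀ k, x p k ≤ q' k) ∧ (∀ k, y p k ≤ q' k)) →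
        v q p + ENNReal.ofReal ‖b p (x p) - b p (y p)‖ ≤ v q' p :=
      ae_all_iff.2 fun q => ae_all_iff.2 fun q' => key q q'
    filter_upwards [key2] with p hp hθ
    have habs := fun k => abs_le.1 (hθ k)
    have hθ0 := fun k => (abs_nonneg _).trans (hθ k)
    have hq' : ∀ k, ∃ c : ℚ, y p k + θ p < c ∧ (c : ℝ) < y p k + θ p + κ := fun k =>
      exists_rat_btwn (by linarith)
    choose q' hq'1 hq'2 using hq'
    have hq0 : ∀ k, ∃ c : ℚ, (c : ℝ) < y p k - (θ p + κ) := fun k => exists_rat_lt _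
    choose q₀ hq₀ using hq0
    have hstep : ∀ q : Fin d → ℚ, (∀ k, (q k : ℝ) ≤ y p k - (θ p + κ)) →
        v q p + ENNReal.ofReal ‖b p (x p) - b p (y p)‖ ≤ VE p (y p + (θ p + κ) • diagVec d) := by
      intro q hq
      refine (hp q q' ⟨fun k => ?_, fun k => ?_, fun k => ?_, fun k => ?_⟩).trans ?_
      · linarith [hq k, habs k]
      · linarith [hq k, hθ0 k]
      · linarith [hq'1 k, habs k]
      · linarith [hq'1 k, hθ0 k]
      · refine le_iSup_of_le q' ?_
        rw [if_pos]
        intro k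
        simp only [PiLp.add_apply, PiLp.smul_apply, diagVec_apply, smul_eq_mul, mul_one]
        linarith [hq'2 k]
    have hmain : VE p (y p - (θ p + κ) • diagVec d) + ENNReal.ofReal ‖b p (x p) - b p (y p)‖ ≤
        VE p (y p + (θ p + κ) • diagVec d) := by
      simp only [VE]
      rw [ENNReal.iSup_add]
      refine iSup_le fun q => ?_
      split_ifs with hc
      · refine hstep q fun k => ?_
        have := hc k
        simpa using this
      · rw [zero_add]
        exact le_add_self.trans (hstep q₀ fun k => (hq₀ k).le)
    have h5 := ENNReal.toReal_mono (hVEtop _ _) hmain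
    rw [ENNReal.toReal_add (hVEtop _ _) ENNReal.ofReal_ne_top,
      ENNReal.toReal_ofReal (norm_nonneg _)] at h5
    linarith

/-- A bounded difference of componentwise nondecreasing maps is dominated. -/
lemma exists_dominates_of_sub {α : Type*} [MeasurableSpace α] {d : ℕ} (μ : Measure α)
    [IsFiniteMeasure μ]
    {b bhat bcheck : α → EuclideanSpace ℝ (Fin d) → EuclideanSpace ℝ (Fin d)}
    (hb : Measurable (fun q : α × EuclideanSpace ℝ (Fin d) => b q.1 q.2))
    {K : ℝ} (hK : ∀ p x, ‖bhat p x‖ ≤ K ∧ ‖bcheck p x‖ ≤ K)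
    (hdecomp : ∀ p x, b p x = bhat p x - bcheck p x)
    (hmono : ∀ p (x y : EuclideanSpace ℝ (Fin d)), (∀ j, x j ≤ y j) →
      ∀ i, bhat p x i ≤ bhat p y i ∧ bcheck p x i ≤ bcheck p y i) :
    ∃ V M, Dominates μ b V M := by
  have hcoord : ∀ (z : EuclideanSpace ℝ (Fin d)) k, |z k| ≤ ‖z‖ := fun z k => by
    simpa using PiLp.norm_apply_le z k
  let g : α → EuclideanSpace ℝ (Fin d) → ℝ := fun p x =>
    ∑ k, ((bhat p x k + K) + (bcheck p x k + K))
  have hterm : ∀ p x k, 0 ≤ (bhat p x k + K) + (bcheck p x k + K) ∧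
      (bhat p x k + K) + (bcheck p x k + K) ≤ 4 * K := by
    intro p x k
    have h1 := abs_le.1 ((hcoord (bhat p x) k).trans (hK p x).1)
    have h2 := abs_le.1 ((hcoord (bcheck p x) k).trans (hK p x).2)
    constructor <;> linarith
  obtain ⟨V, hV⟩ := exists_dominates μ hb (g := g) (M := ∑ _k : Fin d, 4 * K)
    (fun p x => Finset.sum_nonneg fun k _ => (hterm p x k).1)
    (fun p x => Finset.sum_le_sum fun k _ => (hterm p x k).2) (by
      intro p q q' x y h1 h2 h3 h4
      have hn : ‖b p x - b p y‖ ≤ ∑ k, |(b p x - b p y) k| := by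
        rw [EuclideanSpace.norm_eq]
        simpa only [Real.norm_eq_abs] using Real.sqrt_le_iff.2 ⟨Finset.sum_nonneg fun k _ => abs_nonneg _,
          Finset.sum_sq_le_sq_sum_of_nonneg fun k _ => abs_nonneg _⟩
      refine hn.trans ?_
      simp only [g]
      rw [← Finset.sum_sub_distrib]
      refine Finset.sum_le_sum fun k _ => ?_
      have a1 := hmono p q x h1 k
      have a2 := hmono p q y h2 k
      have a3 := hmono p x q' h3 k
      have a4 := hmono p y q' h4 k
      simp only [hdecomp, PiLp.sub_apply]
      rw [abs_le]
      constructor <;> linarith)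
  exact ⟨V, _, hV⟩

end

section

lemma sum_div_sqrt_le {τ : ℝ} (hτ : 0 < τ) (k : ℕ) :
    ∑ m ∈ Finset.range k, τ / √((m + 1) * τ) ≤ 2 * √(k * τ) := by
  induction k with
  | zero => simp
  | succ k ih =>
    rw [Finset.sum_range_succ]
    have h1 : 0 < √(((k : ℝ) + 1) * τ) := Real.sqrt_pos.2 (by positivity)
    have h2 : √(((k : ℝ) + 1) * τ) ^ 2 = (k + 1) * τ := Real.sq_sqrt (by positivity)
    have h3 : √((k : ℝ) * τ) ^ 2 = k * τ := Real.sq_sqrt (by positivity)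
    have h4 : τ / √(((k : ℝ) + 1) * τ) ≤ 2 * √(((k : ℝ) + 1) * τ) - 2 * √((k : ℝ) * τ) := by
      rw [div_le_iff₀ h1]
      nlinarith [sq_nonneg (√(((k : ℝ) + 1) * τ) - √((k : ℝ) * τ))]
    push_cast
    linarith

lemma sum_Ico_div_sqrt_le {τ T : ℝ} (hτ : 0 < τ) {j ℓ I : ℕ} (hℓ : 1 ≤ ℓ)
    (hT : ((I : ℝ) - j) * τ ≤ T) :
    ∑ i ∈ Finset.Ico (j + ℓ) I, τ / √(((i : ℝ) - j) * τ) ≤ 2 * √T := by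
  have hsub : Finset.Ico (j + ℓ) I ⊆ Finset.Ico (j + 1) I :=
    Finset.Ico_subset_Ico_left (by omega)
  refine (Finset.sum_le_sum_of_subset_of_nonneg hsub fun i _ _ => by positivity).trans ?_
  rw [Finset.sum_Ico_eq_sum_range]
  have e : ∀ m : ℕ, τ / √((((j + 1 + m : ℕ) : ℝ) - j) * τ) = τ / √(((m : ℝ) + 1) * τ) := by
    intro m; congr 3; push_cast; ring
  simp_rw [e]
  refine (sum_div_sqrt_le hτ _).trans ?_
  rcases le_total (j + 1) I with h | h
  · gcongr
    refine le_trans ?_ hT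
    rw [Nat.cast_sub h]
    push_cast
    nlinarith
  · rw [Nat.sub_eq_zero_of_le h]
    simp

lemma sum_Ico_one_div_le {ℓ : ℕ} (hℓ : 1 ≤ ℓ) (k : ℕ) :
    ∑ m ∈ Finset.Ico ℓ (ℓ + k + 1), 1 / (m : ℝ) ≤ 1 + (Real.log (ℓ + k) - Real.log ℓ) := by
  have hℓ' : (1 : ℝ) ≤ ℓ := by exact_mod_cast hℓ
  induction k with
  | zero =>
    simp
    exact inv_le_one_of_one_le₀ hℓ'
  | succ k ih =>
    rw [Finset.sum_Ico_succ_top (by omega)]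
    have h0 : (0 : ℝ) < ℓ + k := by positivity
    have := Real.one_sub_inv_le_log_of_pos (x := ((ℓ : ℝ) + k + 1) / (ℓ + k)) (by positivity)
    rw [Real.log_div (by positivity) (by positivity)] at this
    have e : 1 - (((ℓ : ℝ) + k + 1) / (ℓ + k))⁻¹ = 1 / (ℓ + k + 1) := by
      field_simp; ring
    rw [e] at this
    push_cast
    rw [← add_assoc]
    have e2 : ((ℓ : ℝ) + (k + 1)) = ℓ + k + 1 := by ring
    rw [e2]
    linarith

lemma sum_Ico_inv_le_log {τ : ℝ} {ℓ n : ℕ} (hℓ : 1 ≤ ℓ) (hτ : 0 < τ) (hℓτ : ℓ * τ ≤ 1)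
    (hn : n * τ ≤ 1) : ∑ m ∈ Finset.Ico ℓ n, 1 / (m : ℝ) ≤ 1 + Real.log (1 / (ℓ * τ)) := by
  have hℓ' : (1 : ℝ) ≤ ℓ := by exact_mod_cast hℓ
  have hlog : 0 ≤ Real.log (1 / (ℓ * τ)) := Real.log_nonneg (by
    rw [le_div_iff₀ (by positivity)]; simpa using hℓτ)
  rcases le_or_gt n ℓ with h | h
  · rw [Finset.Ico_eq_empty_of_le h]
    simp only [Finset.sum_empty]
    linarith
  · obtain ⟨k, rfl⟩ : ∃ k, n = ℓ + k + 1 := ⟨n - ℓ - 1, by omega⟩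
    refine (sum_Ico_one_div_le hℓ k).trans ?_
    have hlk : (0 : ℝ) < ℓ + k := by positivity
    rw [← Real.log_div hlk.ne' (by positivity)]
    push_cast at hn
    gcongr 1 + Real.log ?_
    rw [div_le_div_iff₀ (by positivity) (by positivity)]
    nlinarith

lemma le_geometric_of_le_sum {y : ℕ → ℝ} {G c : ℝ} (hc : 0 ≤ c) {n : ℕ}
    (h : ∀ k ≤ n, y k ≤ G + c * ∑ i ∈ Finset.range k, y i) :
    ∀ k ≤ n, y k ≤ G * (1 + c) ^ k := by
  have key : ∀ k ≤ n, G + c * ∑ i ∈ Finset.range k, y i ≤ G * (1 + c) ^ k := by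
    intro k
    induction k with
    | zero => simp
    | succ k ih =>
      intro hk
      have h1 := ih (by omega)
      have h2 := (h k (by omega)).trans h1
      rw [Finset.sum_range_succ, pow_succ]
      nlinarith
  exact fun k hk => (h k hk).trans (key k hk)

/-- The recursive bound satisfied by the expected error of the Euler scheme. -/
structure RecBound (A B C M τ : ℝ) (N : ℕ) (Y : ℕ → ℝ) : Prop where
  zero : Y 0 = 0
  mono : Monotone Y
  step : ∀ i, Y (i + 1) - Y i ≤ M * τ
  rec_le : ∀ a ℓ i : ℕ, 1 ≤ ℓ → a + ℓ ≤ i → i < N →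
    Y (i + 1) - Y i ≤ τ * (A * (Y a + C * (ℓ + 1) * τ) / √(((i : ℝ) - a) * τ) +
      ∑ j ∈ Finset.Ico a (i - ℓ), (A * (Y (j + 1) - Y j) / √(((i : ℝ) - (j + 1)) * τ) +
        B * (Y i + C * (ℓ + 1) * τ) / ((i : ℝ) - (j + 1))))

lemma RecBound.step_sum {A B C M τ : ℝ} {N : ℕ} {Y : ℕ → ℝ} (h : RecBound A B C M τ N Y)
    (a k : ℕ) : Y (a + k) - Y a ≤ k * (M * τ) := by
  induction k with
  | zero => simp
  | succ k ih =>
    have := h.step (a + k)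
    rw [← add_assoc]
    push_cast
    linarith

lemma RecBound.window_aux {A B C M τ T : ℝ} {N : ℕ} {Y : ℕ → ℝ} (h : RecBound A B C M τ N Y)
    (hA : 0 ≤ A) (hB : 0 ≤ B) (hC : 0 ≤ C) (hM : 0 ≤ M) (hτ : 0 < τ) (hT1 : T ≤ 1)
    (hAT : 4 * A * √T ≤ 1) {a ℓ I : ℕ} (hℓ : 1 ≤ ℓ) (hℓτ : ℓ * τ ≤ 1)
    (haI : a ≤ I) (hIN : I ≤ N) (hIT : ((I : ℝ) - a) * τ ≤ T) :
    Y I + C * (ℓ + 1) * τ ≤ (2 * Y a + 2 * M * (ℓ * τ) + 2 * (C * (ℓ + 1) * τ)) +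
      (2 * B * (1 + Real.log (1 / (ℓ * τ))) * τ) *
        ∑ i ∈ Finset.Ico a I, (Y i + C * (ℓ + 1) * τ) := by
  set β := C * (ℓ + 1) * τ with hβ
  set H := 1 + Real.log (1 / (ℓ * τ)) with hH
  have hβ0 : 0 ≤ β := by positivity
  have hY0 : ∀ i, 0 ≤ Y i := fun i => h.zero ▸ h.mono (Nat.zero_le i)
  have hℓ' : (1 : ℝ) ≤ ℓ := by exact_mod_cast hℓ
  have hH0 : 0 ≤ H := by
    have : 0 ≤ Real.log (1 / (ℓ * τ)) := Real.log_nonneg (by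
      rw [le_div_iff₀ (by positivity)]; simpa using hℓτ)
    positivity
  have hS0 : 0 ≤ ∑ i ∈ Finset.Ico a I, (Y i + β) :=
    Finset.sum_nonneg fun i _ => add_nonneg (hY0 i) hβ0
  have hterm : 0 ≤ (2 * B * H * τ) * ∑ i ∈ Finset.Ico a I, (Y i + β) := by positivity
  have hyal := h.step_sum a ℓ
  rcases le_or_gt I (a + ℓ) with hI | hI
  · have := h.mono hI
    have h0 := hY0 a
    have : 0 ≤ M * (ℓ * τ) := by positivity
    nlinarith
  · -- telescoping from `a + ℓ`
    have htel : Y I - Y (a + ℓ) = ∑ i ∈ Finset.Ico (a + ℓ) I, (Y (i + 1) - Y i) :=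
      (Finset.sum_Ico_sub Y hI.le).symm
    have htel2 : Y I - Y a = ∑ i ∈ Finset.Ico a I, (Y (i + 1) - Y i) :=
      (Finset.sum_Ico_sub Y haI).symm
    have hbd : ∀ i ∈ Finset.Ico (a + ℓ) I, Y (i + 1) - Y i ≤
        A * (Y a + β) * (τ / √(((i : ℝ) - a) * τ)) +
        (∑ j ∈ Finset.Ico a (i - ℓ), A * (Y (j + 1) - Y j) *
          (τ / √(((i : ℝ) - ((j + 1 : ℕ) : ℝ)) * τ)) + B * H * τ * (Y i + β)) := by
      intro i hi
      rw [Finset.mem_Ico] at hi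
      refine (h.rec_le a ℓ i hℓ hi.1 (by omega)).trans ?_
      rw [← hβ, Finset.sum_add_distrib, mul_add τ, mul_add τ, Finset.mul_sum]
      refine add_le_add (le_of_eq (by ring)) (add_le_add (le_of_eq ?_) ?_)
      · refine Finset.sum_congr rfl fun j _ => ?_
        push_cast
        ring
      · have e : ∑ j ∈ Finset.Ico a (i - ℓ), B * (Y i + β) / ((i : ℝ) - (j + 1)) =
            B * (Y i + β) * ∑ m ∈ Finset.Ico ℓ (i - a), 1 / (m : ℝ) := by
          rw [Finset.mul_sum]
          refine Finset.sum_bij' (fun j _ => i - (j + 1)) (fun m _ => i - (m + 1)) ?_ ?_ ?_ ?_ ?_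
          · intro j hj; rw [Finset.mem_Ico] at hj ⊢; omega
          · intro j hj; rw [Finset.mem_Ico] at hj ⊢; omega
          · intro j hj; rw [Finset.mem_Ico] at hj; omega
          · intro j hj; rw [Finset.mem_Ico] at hj; omega
          · intro j hj
            rw [Finset.mem_Ico] at hj
            rw [Nat.cast_sub (by omega)]
            push_cast
            ring
        rw [e]
        have hlog := sum_Ico_inv_le_log (τ := τ) (n := i - a) hℓ hτ hℓτ (by
          rw [Nat.cast_sub (by omega)]
          have : (i : ℝ) ≤ I := by exact_mod_cast hi.2.le
          nlinarith)
        have : 0 ≤ B * (Y i + β) := mul_nonneg hB (add_nonneg (hY0 i) hβ0)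
        calc τ * (B * (Y i + β) * ∑ m ∈ Finset.Ico ℓ (i - a), 1 / (m : ℝ))
            ≤ τ * (B * (Y i + β) * H) := by gcongr
          _ = _ := by ring
    have hsum := Finset.sum_le_sum hbd
    rw [← htel, Finset.sum_add_distrib, Finset.sum_add_distrib, ← Finset.mul_sum,
      ← Finset.mul_sum] at hsum
    have h1 : ∑ i ∈ Finset.Ico (a + ℓ) I, τ / √(((i : ℝ) - a) * τ) ≤ 2 * √T :=
      sum_Ico_div_sqrt_le hτ hℓ hIT
    have h2 : ∑ i ∈ Finset.Ico (a + ℓ) I, ∑ j ∈ Finset.Ico a (i - ℓ), A * (Y (j + 1) - Y j) *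
          (τ / √(((i : ℝ) - ((j + 1 : ℕ) : ℝ)) * τ)) ≤ A * (Y I - Y a) * (2 * √T) := by
      rw [Finset.sum_comm' (t' := Finset.Ico a I)
        (s' := fun j => Finset.Ico (j + 1 + ℓ) I)]
      · rw [htel2, Finset.mul_sum, Finset.sum_mul]
        refine Finset.sum_le_sum fun j hj => ?_
        rw [← Finset.mul_sum]
        have hd : 0 ≤ Y (j + 1) - Y j := sub_nonneg.2 (h.mono (Nat.le_succ j))
        rw [Finset.mem_Ico] at hj
        have haj : (a : ℝ) ≤ j := by exact_mod_cast hj.1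
        refine mul_le_mul_of_nonneg_left (sum_Ico_div_sqrt_le hτ hℓ ?_) (by positivity)
        refine le_trans ?_ hIT
        push_cast
        gcongr
        linarith
      · intro i j
        simp only [Finset.mem_Ico]
        omega
    have h3 : ∑ i ∈ Finset.Ico (a + ℓ) I, (Y i + β) ≤ ∑ i ∈ Finset.Ico a I, (Y i + β) :=
      Finset.sum_le_sum_of_subset_of_nonneg (Finset.Ico_subset_Ico_left (by omega))
        fun i _ _ => add_nonneg (hY0 i) hβ0
    have h4 : A * (Y a + β) * ∑ i ∈ Finset.Ico (a + ℓ) I, τ / √(((i : ℝ) - a) * τ) ≤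
        (Y a + β) / 2 := by
      have : 0 ≤ Y a + β := add_nonneg (hY0 a) hβ0
      calc _ ≤ A * (Y a + β) * (2 * √T) := by gcongr
        _ = (4 * A * √T) * ((Y a + β) / 2) := by ring
        _ ≤ 1 * ((Y a + β) / 2) := by gcongr
        _ = _ := one_mul _
    have h5 : A * (Y I - Y a) * (2 * √T) ≤ (Y I - Y a) / 2 := by
      have : 0 ≤ Y I - Y a := sub_nonneg.2 (h.mono haI)
      calc _ = (4 * A * √T) * ((Y I - Y a) / 2) := by ring
        _ ≤ 1 * ((Y I - Y a) / 2) := by gcongr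
        _ = _ := one_mul _
    have h6 : B * H * τ * ∑ i ∈ Finset.Ico (a + ℓ) I, (Y i + β) ≤
      B * H * τ * ∑ i ∈ Finset.Ico a I, (Y i + β) := by gcongr
    have h0 := hY0 a
    linarith

lemma RecBound.window {A B C M τ T : ℝ} {N : ℕ} {Y : ℕ → ℝ} (h : RecBound A B C M τ N Y)
    (hA : 0 ≤ A) (hB : 0 ≤ B) (hC : 0 ≤ C) (hM : 0 ≤ M) (hτ : 0 < τ) (hT1 : T ≤ 1)
    (hAT : 4 * A * √T ≤ 1) (hBT : 4 * B * T ≤ 1) {a ℓ I : ℕ} (hℓ : 1 ≤ ℓ) (hℓτ : ℓ * τ ≤ 1)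
    (haI : a ≤ I) (hIN : I ≤ N) (hIT : ((I : ℝ) - a) * τ ≤ T) (hYa : Y a ≤ ℓ * τ) :
    Y I ≤ (2 + 2 * M + 4 * C) * Real.exp 1 * √(ℓ * τ) := by
  set β := C * (ℓ + 1) * τ with hβ
  set H := 1 + Real.log (1 / (ℓ * τ)) with hH
  set δ := (ℓ : ℝ) * τ with hδ
  have hℓ' : (1 : ℝ) ≤ ℓ := by exact_mod_cast hℓ
  have hδ0 : 0 < δ := by positivity
  have hlog : 0 ≤ Real.log (1 / δ) := Real.log_nonneg (by
      rw [le_div_iff₀ (by positivity)]; simpa using hℓτ)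
  have hH0 : 0 ≤ H := by positivity
  have hβ0 : 0 ≤ β := by positivity
  have hβδ : β ≤ 2 * C * δ := by
    have : C * τ ≤ C * τ * ℓ := le_mul_of_one_le_right (by positivity) hℓ'
    rw [hβ, hδ]; nlinarith
  have hY0 : ∀ i, 0 ≤ Y i := fun i => h.zero ▸ h.mono (Nat.zero_le i)
  set G := 2 * Y a + 2 * M * δ + 2 * β with hG
  have hgr := le_geometric_of_le_sum (y := fun k => Y (a + k) + β) (G := G) (c := 2 * B * H * τ)
    (by positivity) (n := I - a) (by
      intro k hk
      have := h.window_aux hA hB hC hM hτ hT1 hAT (a := a) (I := a + k) hℓ hℓτ (by omega)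
        (by omega) (by
          refine le_trans ?_ hIT
          have : ((a + k : ℕ) : ℝ) ≤ I := by exact_mod_cast (by omega : a + k ≤ I)
          gcongr)
      rw [Finset.sum_Ico_eq_sum_range, Nat.add_sub_cancel_left] at this
      exact this) (I - a) le_rfl
  simp only [Nat.add_sub_cancel' haI] at hgr
  have hG1 : G ≤ (2 + 2 * M + 4 * C) * δ := by rw [hG]; nlinarith
  have hG0 : 0 ≤ G := by have := hY0 a; positivity
  have hpow : (1 + 2 * B * H * τ) ^ (I - a) ≤ Real.exp (H / 2) := by
    have h1 : 1 + 2 * B * H * τ ≤ Real.exp (2 * B * H * τ) := by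
      have := Real.add_one_le_exp (2 * B * H * τ); linarith
    calc (1 + 2 * B * H * τ) ^ (I - a) ≤ Real.exp (2 * B * H * τ) ^ (I - a) := by
          gcongr
      _ = Real.exp ((2 * B * H) * (((I : ℝ) - a) * τ)) := by
          rw [← Real.exp_nat_mul, Nat.cast_sub haI]; congr 1; ring
      _ ≤ Real.exp ((2 * B * H) * T) := by gcongr
      _ ≤ Real.exp (H / 2) := by
          gcongr
          nlinarith
  have hexp : δ * Real.exp (H / 2) ≤ Real.exp 1 * √δ := by
    have e1 : Real.exp (H / 2) = Real.exp (1 / 2) * (√δ)⁻¹ := by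
      rw [hH, add_div, Real.exp_add]
      congr 1
      rw [Real.log_div one_ne_zero hδ0.ne', Real.log_one, zero_sub, neg_div, Real.exp_neg]
      congr 1
      rw [Real.exp_half, Real.exp_log hδ0]
    have hs : 0 < √δ := Real.sqrt_pos.2 hδ0
    have e2 : δ * (Real.exp (1 / 2) * (√δ)⁻¹) = Real.exp (1 / 2) * √δ := by
      have := Real.mul_self_sqrt hδ0.le
      field_simp
      rw [sq, this]
    rw [e1, e2]
    gcongr
    norm_num
  calc Y I ≤ Y I + β := by linarith
    _ ≤ G * (1 + 2 * B * H * τ) ^ (I - a) := hgr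
    _ ≤ ((2 + 2 * M + 4 * C) * δ) * Real.exp (H / 2) := by gcongr
    _ = (2 + 2 * M + 4 * C) * (δ * Real.exp (H / 2)) := by ring
    _ ≤ (2 + 2 * M + 4 * C) * (Real.exp 1 * √δ) := by gcongr
    _ = _ := by ring

theorem RecBound.eventually_le {A B C M : ℝ} (hA : 0 ≤ A) (hB : 0 ≤ B) (hC : 0 ≤ C) (hM : 0 ≤ M)
    {ε : ℝ} (hε : 0 < ε) : ∃ N₀ : ℕ, ∀ N ≥ N₀, ∀ Y : ℕ → ℝ,
      RecBound A B C M (1 / (N : ℝ)) N Y → Y N ≤ ε := by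
  obtain ⟨T, hT0, hT1, hAT, hBT⟩ : ∃ T : ℝ, 0 < T ∧ T ≤ 1 ∧ 4 * A * √T ≤ 1 ∧ 4 * B * T ≤ 1 := by
    have hD : (1 : ℝ) ≤ 1 + 4 * A + 4 * B := by linarith
    refine ⟨(1 / (1 + 4 * A + 4 * B)) ^ 2, by positivity, ?_, ?_, ?_⟩
    · exact pow_le_one₀ (by positivity) (by rw [div_le_one (by positivity)]; exact hD)
    · rw [Real.sqrt_sq (by positivity), mul_one_div, div_le_one (by positivity)]; linarith
    · rw [div_pow, one_pow, mul_one_div, div_le_one (by positivity)]; nlinarith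
  have key : ∀ k : ℕ, ∀ ε > 0, ∃ N₀ : ℕ, ∀ N ≥ N₀, ∀ Y : ℕ → ℝ,
      RecBound A B C M (1 / (N : ℝ)) N Y → Y (min (k * ⌊T * N⌋₊) N) ≤ ε := by
    intro k
    induction k with
    | zero =>
      intro ε hε
      refine ⟨0, fun N _ Y hY => ?_⟩
      simp only [Nat.zero_mul, Nat.zero_min, hY.zero]
      exact hε.le
    | succ k ih =>
      intro ε hε
      set D := (2 + 2 * M + 4 * C) * Real.exp 1 with hD
      have hD0 : 0 < D := by positivity
      obtain ⟨η, hη0, hη1, hη2⟩ : ∃ η : ℝ, 0 < η ∧ 2 * η ≤ 1 ∧ D * √(2 * η) ≤ ε := by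
        refine ⟨min 1 ((ε / D) ^ 2) / 2, by positivity, ?_, ?_⟩
        · have := min_le_left 1 ((ε / D) ^ 2); linarith
        · have := min_le_right 1 ((ε / D) ^ 2)
          calc D * √(2 * (min 1 ((ε / D) ^ 2) / 2)) ≤ D * √((ε / D) ^ 2) := by
                gcongr; linarith
            _ = ε := by rw [Real.sqrt_sq (by positivity)]; field_simp
      obtain ⟨N₁, hN₁⟩ := ih η hη0
      obtain ⟨N₂, hN₂⟩ := exists_nat_gt (1 / η)
      refine ⟨max N₁ (max N₂ 1), fun N hN Y hY => ?_⟩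
      have hNN₁ : N₁ ≤ N := (le_max_left _ _).trans hN
      have hNN₂ : N₂ ≤ N := (le_max_left _ _).trans ((le_max_right _ _).trans hN)
      have hN1 : 1 ≤ N := (le_max_right _ _).trans ((le_max_right _ _).trans hN)
      have hN0 : (0 : ℝ) < N := by exact_mod_cast hN1
      have hNη : 1 / (N : ℝ) ≤ η := by
        have : (N₂ : ℝ) ≤ N := by exact_mod_cast hNN₂
        rw [div_le_comm₀ hN0 hη0]; linarith
      have hYa := hN₁ N hNN₁ Y hY
      have hδ1 : η ≤ (⌈η * N⌉₊ : ℝ) * (1 / N) := by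
        rw [mul_one_div, le_div_iff₀ hN0]; exact Nat.le_ceil _
      have hδ2 : (⌈η * N⌉₊ : ℝ) * (1 / N) ≤ 2 * η := by
        have := (Nat.ceil_lt_add_one (by positivity : 0 ≤ η * N)).le
        calc (⌈η * N⌉₊ : ℝ) * (1 / N) ≤ (η * N + 1) * (1 / N) := by gcongr
          _ = η + 1 / N := by field_simp
          _ ≤ _ := by linarith
      have := hY.window hA hB hC hM (by positivity) hT1 hAT hBT
        (a := min (k * ⌊T * N⌋₊) N) (ℓ := ⌈η * N⌉₊) (I := min ((k + 1) * ⌊T * N⌋₊) N)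
        (Nat.one_le_ceil_iff.2 (by positivity)) (hδ2.trans hη1)
        (by rw [add_mul]; omega) (min_le_right _ _) (by
          have h1 : min ((k + 1) * ⌊T * N⌋₊) N ≤ min (k * ⌊T * N⌋₊) N + ⌊T * (N : ℝ)⌋₊ := by
            rw [add_mul]; omega
          have h2 : ((min ((k + 1) * ⌊T * N⌋₊) N : ℕ) : ℝ) ≤
            ((min (k * ⌊T * N⌋₊) N : ℕ) : ℝ) + ⌊T * (N : ℝ)⌋₊ := by exact_mod_cast h1
          have h3 := Nat.floor_le (by positivity : 0 ≤ T * N)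
          rw [mul_one_div, div_le_iff₀ hN0]
          linarith) (hYa.trans hδ1)
      refine this.trans (le_trans ?_ hη2)
      gcongr
  obtain ⟨k, hk⟩ := exists_nat_gt (2 / T)
  obtain ⟨N₁, hN₁⟩ := key k ε hε
  obtain ⟨N₂, hN₂⟩ := exists_nat_gt (2 / T)
  refine ⟨max N₁ N₂, fun N hN Y hY => ?_⟩
  have h1 := hN₁ N ((le_max_left _ _).trans hN) Y hY
  rwa [min_eq_right] at h1
  have hN2 : (2 / T : ℝ) < N := hN₂.trans_le (by exact_mod_cast (le_max_right _ _).trans hN)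
  have hfl := (Nat.lt_floor_add_one (T * (N : ℝ))).le
  have hTN : 2 ≤ T * N := by
    rw [div_lt_iff₀ hT0] at hN2; linarith
  have hkT : 2 ≤ k * T := by
    rw [div_lt_iff₀ hT0] at hk; linarith
  have : (N : ℝ) ≤ ((k * ⌊T * N⌋₊ : ℕ) : ℝ) := by
    push_cast
    calc (N : ℝ) ≤ (k * T) * (N / 2) := by nlinarith [Nat.cast_nonneg (α := ℝ) N]
      _ = k * (T * N / 2) := by ring
      _ ≤ k * ⌊T * N⌋₊ := by
        gcongr; linarith
  exact_mod_cast this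

end

section

/-- The part over `(0, s]` of the `i`-th horizontal strip of height `τ`. -/
def strip (τ : ℝ) (i : ℕ) (s : ℝ) : Set (ℝ × ℝ) :=
  Ioc 0 s ×ˢ Ioc ((i : ℝ) * τ) (((i + 1 : ℕ) : ℝ) * τ)

lemma measurableSet_strip (τ : ℝ) (i : ℕ) (s : ℝ) : MeasurableSet (strip τ i s) :=
  measurableSet_Ioc.prod measurableSet_Ioc

lemma strip_mono (τ : ℝ) (i : ℕ) {s s' : ℝ} (h : s ≤ s') : strip τ i s ⊆ strip τ i s' :=
  prod_mono (Ioc_subset_Ioc_right h) le_rfl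

lemma volume_rect (s a c : ℝ) :
    volume (Ioc 0 s ×ˢ Ioc a c : Set (ℝ × ℝ)) = ENNReal.ofReal s * ENNReal.ofReal (c - a) := by
  rw [Measure.volume_eq_prod, Measure.prod_prod, Real.volume_Ioc, Real.volume_Ioc, sub_zero]

lemma volume_rect_lt_top (s a c : ℝ) : volume (Ioc 0 s ×ˢ Ioc a c : Set (ℝ × ℝ)) < ⊤ := by
  rw [volume_rect]; exact ENNReal.mul_lt_top ENNReal.ofReal_lt_top ENNReal.ofReal_lt_top

lemma volumeReal_rect {s a c : ℝ} (hs : 0 ≤ s) (hac : a ≤ c) :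
    volume.real (Ioc 0 s ×ˢ Ioc a c : Set (ℝ × ℝ)) = s * (c - a) := by
  rw [Measure.real, volume_rect, ENNReal.toReal_mul, ENNReal.toReal_ofReal hs,
    ENNReal.toReal_ofReal (sub_nonneg.2 hac)]

lemma volumeReal_strip {τ s : ℝ} (hτ : 0 ≤ τ) (hs : 0 ≤ s) (i : ℕ) :
    volume.real (strip τ i s) = s * τ := by
  have h : (i : ℝ) * τ ≤ ((i + 1 : ℕ) : ℝ) * τ := by push_cast; nlinarith
  rw [strip, volumeReal_rect hs h]
  push_cast; ring

lemma integrableOn_rect_of_norm_le {F : Type*} [NormedAddCommGroup F] [MeasurableSpace F]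
    [BorelSpace F] [SecondCountableTopology F] {g : ℝ × ℝ → F} (hg : Measurable g) {K : ℝ}
    (hK : ∀ p, ‖g p‖ ≤ K) (s a c : ℝ) : IntegrableOn g (Ioc 0 s ×ˢ Ioc a c) := by
  have : IsFiniteMeasure (volume.restrict (Ioc 0 s ×ˢ Ioc a c : Set (ℝ × ℝ))) :=
    ⟨by rw [Measure.restrict_apply_univ]; exact volume_rect_lt_top s a c⟩
  exact Integrable.of_bound hg.aestronglyMeasurable K (ae_of_all _ hK)

lemma norm_integral_rect_le {F : Type*} [NormedAddCommGroup F] [NormedSpace ℝ F]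
    {g : ℝ × ℝ → F} {K : ℝ} (hK : ∀ p, ‖g p‖ ≤ K) {s a c : ℝ} (hs : 0 ≤ s) (hac : a ≤ c) :
    ‖∫ p in Ioc 0 s ×ˢ Ioc a c, g p‖ ≤ K * (s * (c - a)) := by
  rw [← volumeReal_rect hs hac]
  exact norm_setIntegral_le_of_norm_le_const (volume_rect_lt_top s a c) fun p _ => hK p

lemma measurable_integral_strip {Ω F : Type*} [MeasurableSpace Ω] [NormedAddCommGroup F]
    [NormedSpace ℝ F] [MeasurableSpace F] [BorelSpace F] [SecondCountableTopology F]
    {g : Ω → ℝ × ℝ → F} (hg : Measurable (fun q : Ω × (ℝ × ℝ) => g q.1 q.2)) (τ : ℝ) (i : ℕ) :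
    Measurable (fun q : Ω × ℝ => ∫ p in strip τ i q.2, g q.1 p) := by
  simp_rw [← integral_indicator (measurableSet_strip _ _ _)]
  refine (StronglyMeasurable.integral_prod_right
    (f := fun (q : Ω × ℝ) p => (strip τ i q.2).indicator (g q.1) p) ?_).measurable
  refine Measurable.stronglyMeasurable ?_
  have hS : MeasurableSet {x : (Ω × ℝ) × (ℝ × ℝ) | x.2 ∈ strip τ i x.1.2} := by
    have : {x : (Ω × ℝ) × (ℝ × ℝ) | x.2 ∈ strip τ i x.1.2} =
        ({x | 0 < x.2.1} ∩ {x | x.2.1 ≤ x.1.2}) ∩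
          ({x | (i : ℝ) * τ < x.2.2} ∩ {x | x.2.2 ≤ ((i + 1 : ℕ) : ℝ) * τ}) := by
      ext x; simp [strip, mem_prod]
    rw [this]
    exact ((measurableSet_lt (by fun_prop) (by fun_prop)).inter
      (measurableSet_le (by fun_prop) (by fun_prop))).inter
      ((measurableSet_lt (by fun_prop) (by fun_prop)).inter
      (measurableSet_le (by fun_prop) (by fun_prop)))
  have h2 : Measurable (fun x : (Ω × ℝ) × (ℝ × ℝ) => g x.1.1 x.2) :=
    hg.comp ((measurable_fst.comp measurable_fst).prodMk measurable_snd)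
  exact h2.indicator hS

variable {d : ℕ}

/-- The Euler scheme with step `τ` in the second parameter for the drift `b` along `w`. -/
def euler (b : ℝ × ℝ → EuclideanSpace ℝ (Fin d) → EuclideanSpace ℝ (Fin d))
    (w : ℝ × ℝ → EuclideanSpace ℝ (Fin d)) (τ : ℝ) : ℕ → ℝ → EuclideanSpace ℝ (Fin d)
  | 0 => fun _ => 0
  | i + 1 => fun s => euler b w τ i s + ∫ p in strip τ i s, b p (w p + euler b w τ i p.1)

/-- The oscillation of a monotone function over a diagonal segment. -/
def diagOsc (V : ℝ × ℝ → EuclideanSpace ℝ (Fin d) → ℝ) (p : ℝ × ℝ)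
    (x : EuclideanSpace ℝ (Fin d)) (θ : ℝ) : ℝ :=
  V p (x + θ • diagVec d) - V p (x - θ • diagVec d)

/-- The error bound accompanying the Euler scheme. -/
def eulerErr (V : ℝ × ℝ → EuclideanSpace ℝ (Fin d) → ℝ)
    (b : ℝ × ℝ → EuclideanSpace ℝ (Fin d) → EuclideanSpace ℝ (Fin d))
    (w : ℝ × ℝ → EuclideanSpace ℝ (Fin d)) (τ κ : ℝ) : ℕ → ℝ → ℝ
  | 0 => fun _ => 0
  | i + 1 => fun s => eulerErr V b w τ κ i s +
      ∫ p in strip τ i s, diagOsc V p (w p + euler b w τ i p.1) (eulerErr V b w τ κ i p.1 + κ)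

section
variable {b : ℝ × ℝ → EuclideanSpace ℝ (Fin d) → EuclideanSpace ℝ (Fin d)}
  {V : ℝ × ℝ → EuclideanSpace ℝ (Fin d) → ℝ} {M K τ κ : ℝ} {μ : Measure (ℝ × ℝ)}

lemma measurable_diagOsc {α : Type*} [MeasurableSpace α]
    (hV : Measurable (fun q : (ℝ × ℝ) × EuclideanSpace ℝ (Fin d) => V q.1 q.2))
    {p : α → ℝ × ℝ} {x : α → EuclideanSpace ℝ (Fin d)} {θ : α → ℝ} (hp : Measurable p)
    (hx : Measurable x) (hθ : Measurable θ) : Measurable (fun a => diagOsc V (p a) (x a) (θ a)) :=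
  (hV.comp (hp.prodMk (hx.add (hθ.smul_const _)))).sub
    (hV.comp (hp.prodMk (hx.sub (hθ.smul_const _))))

lemma Dominates.diagOsc_mono (hV : Dominates μ b V M) (p : ℝ × ℝ)
    {x y : EuclideanSpace ℝ (Fin d)} {θ η : ℝ} (h : ∀ k, |x k - y k| + θ ≤ η) :
    diagOsc V p x θ ≤ diagOsc V p y η := by
  refine sub_le_sub (hV.mono p _ _ fun k => ?_) (hV.mono p _ _ fun k => ?_)
  · have := abs_le.1 (le_sub_iff_add_le.2 (h k))
    simp only [PiLp.add_apply, PiLp.smul_apply, diagVec_apply, smul_eq_mul, mul_one]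
    linarith
  · have := abs_le.1 (le_sub_iff_add_le.2 (h k))
    simp only [PiLp.sub_apply, PiLp.smul_apply, diagVec_apply, smul_eq_mul, mul_one]
    linarith

lemma Dominates.diagOsc_nonneg (hV : Dominates μ b V M) (p : ℝ × ℝ)
    (x : EuclideanSpace ℝ (Fin d)) {θ : ℝ} (hθ : 0 ≤ θ) : 0 ≤ diagOsc V p x θ := by
  have := hV.diagOsc_mono p (x := x) (y := x) (θ := 0) (η := θ) fun k => by simpa using hθ
  simpa [diagOsc] using this

lemma Dominates.bound_nonneg (hV : Dominates μ b V M) : 0 ≤ M :=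
  (hV.nonneg 0 0).trans (hV.le 0 0)

lemma Dominates.norm_diagOsc_le (hV : Dominates μ b V M) (p : ℝ × ℝ)
    (x : EuclideanSpace ℝ (Fin d)) (θ : ℝ) : ‖diagOsc V p x θ‖ ≤ M := by
  have h1 := hV.le p (x + θ • diagVec d)
  have h2 := hV.nonneg p (x - θ • diagVec d)
  have h3 := hV.le p (x - θ • diagVec d)
  have h4 := hV.nonneg p (x + θ • diagVec d)
  rw [Real.norm_eq_abs, abs_le, diagOsc]
  constructor <;> linarith

section Measurability
variable {Ω : Type*} [MeasurableSpace Ω] {w : Ω → ℝ × ℝ → EuclideanSpace ℝ (Fin d)}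

lemma measurable_euler (hb : Measurable (fun q : (ℝ × ℝ) × EuclideanSpace ℝ (Fin d) => b q.1 q.2))
    (hw : Measurable (fun q : Ω × (ℝ × ℝ) => w q.1 q.2)) (τ : ℝ) (i : ℕ) :
    Measurable (fun q : Ω × ℝ => euler b (w q.1) τ i q.2) := by
  induction i with
  | zero => exact measurable_const
  | succ i ih =>
    refine ih.add (measurable_integral_strip
      (g := fun ω p => b p (w ω p + euler b (w ω) τ i p.1)) ?_ τ i)
    exact hb.comp (measurable_snd.prodMk (hw.add
      (ih.comp (measurable_fst.prodMk (measurable_fst.comp measurable_snd)))))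

lemma measurable_eulerErr
    (hb : Measurable (fun q : (ℝ × ℝ) × EuclideanSpace ℝ (Fin d) => b q.1 q.2))
    (hV : Measurable (fun q : (ℝ × ℝ) × EuclideanSpace ℝ (Fin d) => V q.1 q.2))
    (hw : Measurable (fun q : Ω × (ℝ × ℝ) => w q.1 q.2)) (τ κ : ℝ) (i : ℕ) :
    Measurable (fun q : Ω × ℝ => eulerErr V b (w q.1) τ κ i q.2) := by
  induction i with
  | zero => exact measurable_const
  | succ i ih =>
    refine ih.add (measurable_integral_strip
      (g := fun ω p => diagOsc V p (w ω p + euler b (w ω) τ i p.1)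
        (eulerErr V b (w ω) τ κ i p.1 + κ)) ?_ τ i)
    have he := measurable_euler hb hw τ i
    have hpr : Measurable (fun q : Ω × (ℝ × ℝ) => (q.1, q.2.1)) :=
      measurable_fst.prodMk (measurable_fst.comp measurable_snd)
    exact measurable_diagOsc hV measurable_snd (hw.add (he.comp hpr))
      ((ih.comp hpr).add_const _)

end Measurability

lemma euler_congr {w w' : ℝ × ℝ → EuclideanSpace ℝ (Fin d)} (hτ : 0 ≤ τ) {i : ℕ}
    (h : ∀ p : ℝ × ℝ, p.2 ≤ i * τ → w p = w' p) : euler b w τ i = euler b w' τ i := by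
  induction i with
  | zero => rfl
  | succ i ih =>
    have hi := ih fun p hp => h p (hp.trans (by gcongr; omega))
    funext s
    simp only [euler, hi]
    congr 1
    refine setIntegral_congr_fun (measurableSet_strip _ _ _) fun p hp => ?_
    simp only [h p hp.2.2]

lemma eulerErr_congr {w w' : ℝ × ℝ → EuclideanSpace ℝ (Fin d)} (hτ : 0 ≤ τ) {i : ℕ}
    (h : ∀ p : ℝ × ℝ, p.2 ≤ i * τ → w p = w' p) :
    eulerErr V b w τ κ i = eulerErr V b w' τ κ i := by
  induction i with
  | zero => rfl
  | succ i ih =>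
    have hle : ∀ p : ℝ × ℝ, p.2 ≤ i * τ → w p = w' p :=
      fun p hp => h p (hp.trans (by gcongr; omega))
    have hi := ih hle
    have he := euler_congr (b := b) hτ hle
    funext s
    simp only [eulerErr, hi, he]
    congr 1
    refine setIntegral_congr_fun (measurableSet_strip _ _ _) fun p hp => ?_
    simp only [h p hp.2.2]

section Path
variable {w : ℝ × ℝ → EuclideanSpace ℝ (Fin d)}

lemma measurable_euler_path
    (hb : Measurable (fun q : (ℝ × ℝ) × EuclideanSpace ℝ (Fin d) => b q.1 q.2))
    (hw : Measurable w) (τ : ℝ) (i : ℕ) : Measurable (euler b w τ i) :=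
  (measurable_euler (Ω := Unit) (w := fun _ => w) hb (hw.comp measurable_snd) τ i).comp
    (measurable_const.prodMk measurable_id : Measurable fun s : ℝ => ((), s))

lemma measurable_eulerErr_path
    (hb : Measurable (fun q : (ℝ × ℝ) × EuclideanSpace ℝ (Fin d) => b q.1 q.2))
    (hV : Measurable (fun q : (ℝ × ℝ) × EuclideanSpace ℝ (Fin d) => V q.1 q.2))
    (hw : Measurable w) (τ κ : ℝ) (i : ℕ) : Measurable (eulerErr V b w τ κ i) :=
  (measurable_eulerErr (Ω := Unit) (w := fun _ => w) hb hV (hw.comp measurable_snd) τ κ i).comp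
    (measurable_const.prodMk measurable_id : Measurable fun s : ℝ => ((), s))

lemma measurable_diagOsc_path (hV : Dominates μ b V M)
    (hb : Measurable (fun q : (ℝ × ℝ) × EuclideanSpace ℝ (Fin d) => b q.1 q.2))
    (hw : Measurable w) (τ κ : ℝ) (i : ℕ) :
    Measurable (fun p : ℝ × ℝ =>
      diagOsc V p (w p + euler b w τ i p.1) (eulerErr V b w τ κ i p.1 + κ)) :=
  measurable_diagOsc hV.meas measurable_id
    (hw.add ((measurable_euler_path hb hw τ i).comp measurable_fst))
    (((measurable_eulerErr_path hb hV.meas hw τ κ i).comp measurable_fst).add_const _)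

lemma norm_euler_succ_sub_le (hK : ∀ p x, ‖b p x‖ ≤ K) (hτ : 0 ≤ τ) (i : ℕ) {s : ℝ} (hs : 0 ≤ s) :
    ‖euler b w τ (i + 1) s - euler b w τ i s‖ ≤ K * (s * τ) := by
  have h : (i : ℝ) * τ ≤ ((i + 1 : ℕ) : ℝ) * τ := by push_cast; nlinarith
  simp only [euler, add_sub_cancel_left]
  refine (norm_integral_rect_le (fun p => hK p _) hs h).trans (le_of_eq ?_)
  push_cast; ring

lemma norm_euler_sub_le (hK : ∀ p x, ‖b p x‖ ≤ K) (hτ : 0 ≤ τ) (i k : ℕ) {s : ℝ} (hs : 0 ≤ s) :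
    ‖euler b w τ (i + k) s - euler b w τ i s‖ ≤ K * (s * (k * τ)) := by
  induction k with
  | zero => simp
  | succ k ih =>
    have h1 := norm_euler_succ_sub_le (w := w) hK hτ (i + k) hs
    have h2 := norm_sub_le_norm_sub_add_norm_sub (euler b w τ (i + k + 1) s)
      (euler b w τ (i + k) s) (euler b w τ i s)
    rw [← add_assoc]
    push_cast
    linarith

lemma eulerErr_nonneg (hV : Dominates μ b V M) (hκ : 0 ≤ κ) (i : ℕ) (s : ℝ) :
    0 ≤ eulerErr V b w τ κ i s := by
  induction i generalizing s with
  | zero => exact le_rfl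
  | succ i ih =>
    exact add_nonneg (ih s) (integral_nonneg fun p => hV.diagOsc_nonneg _ _ (add_nonneg (ih _) hκ))

lemma eulerErr_succ_sub_nonneg (hV : Dominates μ b V M) (hκ : 0 ≤ κ) (i : ℕ) (s : ℝ) :
    0 ≤ eulerErr V b w τ κ (i + 1) s - eulerErr V b w τ κ i s := by
  simp only [eulerErr, add_sub_cancel_left]
  exact integral_nonneg fun p => hV.diagOsc_nonneg _ _ (add_nonneg (eulerErr_nonneg hV hκ _ _) hκ)

lemma eulerErr_mono_index (hV : Dominates μ b V M) (hκ : 0 ≤ κ) (s : ℝ) :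
    Monotone (fun i => eulerErr V b w τ κ i s) :=
  monotone_nat_of_le_succ fun i => sub_nonneg.1 (eulerErr_succ_sub_nonneg hV hκ i s)

lemma eulerErr_succ_sub_mono (hV : Dominates μ b V M)
    (hb : Measurable (fun q : (ℝ × ℝ) × EuclideanSpace ℝ (Fin d) => b q.1 q.2))
    (hw : Measurable w) (hκ : 0 ≤ κ) (i : ℕ) {s s' : ℝ} (h : s ≤ s') :
    eulerErr V b w τ κ (i + 1) s - eulerErr V b w τ κ i s ≤
      eulerErr V b w τ κ (i + 1) s' - eulerErr V b w τ κ i s' := by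
  simp only [eulerErr, add_sub_cancel_left]
  refine setIntegral_mono_set (integrableOn_rect_of_norm_le
    (measurable_diagOsc_path hV hb hw τ κ i) (fun p => hV.norm_diagOsc_le _ _ _) _ _ _)
    (ae_of_all _ fun p => hV.diagOsc_nonneg _ _ (add_nonneg (eulerErr_nonneg hV hκ _ _) hκ))
    (LE.le.eventuallyLE (strip_mono τ i h))

lemma eulerErr_mono (hV : Dominates μ b V M)
    (hb : Measurable (fun q : (ℝ × ℝ) × EuclideanSpace ℝ (Fin d) => b q.1 q.2))
    (hw : Measurable w) (hκ : 0 ≤ κ) (i : ℕ) : Monotone (eulerErr V b w τ κ i) := by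
  intro s s' h
  induction i with
  | zero => exact le_rfl
  | succ i ih => linarith [eulerErr_succ_sub_mono hV hb hw hκ (τ := τ) i h]

lemma eulerErr_succ_sub_le (hV : Dominates μ b V M) (hτ : 0 ≤ τ) (i : ℕ) {s : ℝ} (hs : 0 ≤ s) :
    eulerErr V b w τ κ (i + 1) s - eulerErr V b w τ κ i s ≤ M * (s * τ) := by
  have h : (i : ℝ) * τ ≤ ((i + 1 : ℕ) : ℝ) * τ := by push_cast; nlinarith
  simp only [eulerErr, add_sub_cancel_left]
  refine (Real.le_norm_self _).trans
    ((norm_integral_rect_le (fun p => hV.norm_diagOsc_le _ _ _) hs h).trans (le_of_eq ?_))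
  push_cast; ring

lemma eulerErr_sub_le (hV : Dominates μ b V M) (hτ : 0 ≤ τ) (i k : ℕ) {s : ℝ} (hs : 0 ≤ s) :
    eulerErr V b w τ κ (i + k) s - eulerErr V b w τ κ i s ≤ M * (s * (k * τ)) := by
  induction k with
  | zero => simp
  | succ k ih =>
    have h1 := eulerErr_succ_sub_le (w := w) (κ := κ) hV hτ (i + k) hs
    rw [← add_assoc]
    push_cast
    linarith

end Path
end

end

section

variable {d : ℕ}

/-- The integrated drift along the path `w + z`. -/
def driftInt (b : ℝ × ℝ → EuclideanSpace ℝ (Fin d) → EuclideanSpace ℝ (Fin d))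
    (w z : ℝ × ℝ → EuclideanSpace ℝ (Fin d)) (p : ℝ × ℝ) : EuclideanSpace ℝ (Fin d) :=
  ∫ q in Ioc 0 p.1 ×ˢ Ioc 0 p.2, b q (w q + z q)

/-- The Euler scheme with `N` steps, as a function on the plane. -/
def eulerPath (b : ℝ × ℝ → EuclideanSpace ℝ (Fin d) → EuclideanSpace ℝ (Fin d))
    (w : ℝ × ℝ → EuclideanSpace ℝ (Fin d)) (N : ℕ) (p : ℝ × ℝ) : EuclideanSpace ℝ (Fin d) :=
  euler b w (1 / (N : ℝ)) (⌈p.2 * N⌉₊ - 1) p.1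

section
variable {b : ℝ × ℝ → EuclideanSpace ℝ (Fin d) → EuclideanSpace ℝ (Fin d)}
  {V : ℝ × ℝ → EuclideanSpace ℝ (Fin d) → ℝ} {M K τ κ : ℝ}
  {w z : ℝ × ℝ → EuclideanSpace ℝ (Fin d)}

lemma measurable_drift
    (hb : Measurable (fun q : (ℝ × ℝ) × EuclideanSpace ℝ (Fin d) => b q.1 q.2))
    (hw : Measurable w) (hz : Measurable z) : Measurable (fun q => b q (w q + z q)) :=
  hb.comp (measurable_id.prodMk (hw.add hz))

lemma driftInt_sub_driftInt_right
    (hb : Measurable (fun q : (ℝ × ℝ) × EuclideanSpace ℝ (Fin d) => b q.1 q.2))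
    (hK : ∀ p x, ‖b p x‖ ≤ K) (hw : Measurable w) (hz : Measurable z) (s : ℝ) {a c : ℝ}
    (ha : 0 ≤ a) (hac : a ≤ c) :
    driftInt b w z (s, c) - driftInt b w z (s, a) =
      ∫ q in Ioc 0 s ×ˢ Ioc a c, b q (w q + z q) := by
  have hint := fun a c => integrableOn_rect_of_norm_le (measurable_drift hb hw hz)
    (fun p => hK p _) s a c
  have hU : (Ioc 0 s ×ˢ Ioc 0 c : Set (ℝ × ℝ)) = Ioc 0 s ×ˢ Ioc 0 a ∪ Ioc 0 s ×ˢ Ioc a c := by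
    rw [← prod_union, Ioc_union_Ioc_eq_Ioc ha hac]
  simp only [driftInt]
  rw [hU, setIntegral_union _ (measurableSet_Ioc.prod measurableSet_Ioc) (hint _ _) (hint _ _),
    add_sub_cancel_left]
  exact disjoint_left.2 fun p hp hp' => absurd hp.2.2 (not_le.2 hp'.2.1)

lemma norm_driftInt_sub_right_le
    (hb : Measurable (fun q : (ℝ × ℝ) × EuclideanSpace ℝ (Fin d) => b q.1 q.2))
    (hK : ∀ p x, ‖b p x‖ ≤ K) (hw : Measurable w) (hz : Measurable z) {s a c : ℝ}
    (hs : 0 ≤ s) (hs1 : s ≤ 1) (ha : 0 ≤ a) (hc : 0 ≤ c) :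
    ‖driftInt b w z (s, c) - driftInt b w z (s, a)‖ ≤ K * |c - a| := by
  have hK0 : 0 ≤ K := (norm_nonneg _).trans (hK 0 0)
  have key : ∀ a c : ℝ, 0 ≤ a → a ≤ c →
      ‖driftInt b w z (s, c) - driftInt b w z (s, a)‖ ≤ K * (c - a) := by
    intro a c ha hac
    rw [driftInt_sub_driftInt_right hb hK hw hz s ha hac]
    refine (norm_integral_rect_le (fun p => hK p _) hs hac).trans ?_
    have : s * (c - a) ≤ 1 * (c - a) := by gcongr
    rw [one_mul] at this
    gcongr
  rcases le_total a c with h | h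
  · rw [abs_of_nonneg (sub_nonneg.2 h)]; exact key a c ha h
  · rw [norm_sub_rev, abs_sub_comm, abs_of_nonneg (sub_nonneg.2 h)]; exact key c a hc h

lemma driftInt_swap (p : ℝ × ℝ) : driftInt b w z p =
    driftInt (fun q => b q.swap) (fun q => w q.swap) (fun q => z q.swap) p.swap := by
  simp only [driftInt, Prod.fst_swap, Prod.snd_swap]
  rw [Measure.volume_eq_prod, ← setIntegral_prod_swap]

lemma continuousOn_driftInt
    (hb : Measurable (fun q : (ℝ × ℝ) × EuclideanSpace ℝ (Fin d) => b q.1 q.2))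
    (hK : ∀ p x, ‖b p x‖ ≤ K) (hw : Measurable w) (hz : Measurable z) :
    ContinuousOn (driftInt b w z) (Icc 0 1) := by
  have hK0 : 0 ≤ K := (norm_nonneg _).trans (hK 0 0)
  have hb' : Measurable (fun q : (ℝ × ℝ) × EuclideanSpace ℝ (Fin d) => b q.1.swap q.2) :=
    hb.comp (((measurable_swap).comp measurable_fst).prodMk measurable_snd)
  have hL : LipschitzOnWith (Real.toNNReal (2 * K)) (driftInt b w z) (Icc 0 1) := by
    refine LipschitzOnWith.of_dist_le_mul fun p hp q hq => ?_
    obtain ⟨s, t⟩ := p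
    obtain ⟨s', t'⟩ := q
    simp only [mem_Icc, Prod.le_def, Prod.fst_zero, Prod.snd_zero, Prod.fst_one, Prod.snd_one]
      at hp hq
    have h1 := norm_driftInt_sub_right_le hb hK hw hz hp.1.1 hp.2.1 hq.1.2 hp.1.2
    have h2 := norm_driftInt_sub_right_le (b := fun q => b q.swap) hb' (fun p x => hK p.swap x)
      (hw.comp measurable_swap) (hz.comp measurable_swap) hq.1.2 hq.2.2 hq.1.1 hp.1.1
    have e1 := driftInt_swap (b := b) (w := w) (z := z) (s, t')
    have e2 := driftInt_swap (b := b) (w := w) (z := z) (s', t')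
    simp only [Prod.swap_prod_mk] at e1 e2
    simp only [Function.comp_def] at h2
    rw [← e1, ← e2] at h2
    have h3 := norm_sub_le_norm_sub_add_norm_sub (driftInt b w z (s, t)) (driftInt b w z (s, t'))
      (driftInt b w z (s', t'))
    rw [dist_eq_norm, Real.coe_toNNReal _ (by positivity), Prod.dist_eq, Real.dist_eq,
      Real.dist_eq]
    have h4 := le_max_left |s - s'| |t - t'|
    have h5 := le_max_right |s - s'| |t - t'|
    dsimp only
    nlinarith
  exact hL.continuousOn

lemma integral_norm_sub_euler_le
    (hV : Dominates (volume.restrict (Ioc 0 1 ×ˢ Ioc 0 1)) b V M)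
    (hb : Measurable (fun q : (ℝ × ℝ) × EuclideanSpace ℝ (Fin d) => b q.1 q.2))
    (hK : ∀ p x, ‖b p x‖ ≤ K) (hw : Measurable w) (hz : Measurable z) (hτ : 0 ≤ τ)
    (hκ : K * τ < κ) {i : ℕ} (hi : ((i + 1 : ℕ) : ℝ) * τ ≤ 1)
    (h : ∀ p ∈ strip τ i 1, ‖z p - euler b w τ i p.1‖ ≤ eulerErr V b w τ κ i p.1 + K * τ)
    {s : ℝ} (hs : s ≤ 1) :
    ∫ p in strip τ i s, ‖b p (w p + z p) - b p (w p + euler b w τ i p.1)‖ ≤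
      eulerErr V b w τ κ (i + 1) s - eulerErr V b w τ κ i s := by
  have hsub : strip τ i s ⊆ Ioc 0 1 ×ˢ Ioc 0 1 :=
    prod_mono (Ioc_subset_Ioc_right hs) (Ioc_subset_Ioc (by positivity) hi)
  have hem : Measurable (fun p : ℝ × ℝ => euler b w τ i p.1) :=
    (measurable_euler_path hb hw τ i).comp measurable_fst
  have h1 := measurable_drift hb hw hz
  have h2 := measurable_drift hb hw hem
  have hosc := hV.osc (fun p => w p + z p) (fun p => w p + euler b w τ i p.1) (hw.add hz)
    (hw.add hem) (fun p => eulerErr V b w τ κ i p.1 + K * τ) (κ - K * τ) (sub_pos.2 hκ)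
  have hosc' := ae_restrict_of_ae_restrict_of_subset hsub hosc
  simp only [eulerErr, add_sub_cancel_left]
  refine setIntegral_mono_ae_restrict ?_ (integrableOn_rect_of_norm_le
    (measurable_diagOsc_path hV hb hw τ κ i) (fun p => hV.norm_diagOsc_le _ _ _) _ _ _) ?_
  · exact ((integrableOn_rect_of_norm_le h1 (fun p => hK p _) _ _ _).sub
      (integrableOn_rect_of_norm_le h2 (fun p => hK p _) _ _ _)).norm
  · filter_upwards [hosc', ae_restrict_mem (measurableSet_strip τ i s)] with p hp hps
    refine (hp fun k => ?_).trans (le_of_eq ?_)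
    · have h3 := PiLp.norm_apply_le (z p - euler b w τ i p.1) k
      rw [Real.norm_eq_abs] at h3
      have h4 := h p (strip_mono τ i hs hps)
      simp only [PiLp.add_apply, add_sub_add_left_eq_sub]
      exact h3.trans h4
    · simp only [diagOsc]
      ring_nf

lemma norm_driftInt_sub_euler_le
    (hV : Dominates (volume.restrict (Ioc 0 1 ×ˢ Ioc 0 1)) b V M)
    (hb : Measurable (fun q : (ℝ × ℝ) × EuclideanSpace ℝ (Fin d) => b q.1 q.2))
    (hK : ∀ p x, ‖b p x‖ ≤ K) (hw : Measurable w) (hz : Measurable z) (hτ : 0 ≤ τ)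
    (hκ : K * τ < κ) {N : ℕ} (hN : (N : ℝ) * τ ≤ 1)
    (h : ∀ i < N, (∀ s : ℝ, 0 ≤ s → s ≤ 1 →
        ‖driftInt b w z (s, i * τ) - euler b w τ i s‖ ≤ eulerErr V b w τ κ i s) →
      ∀ p ∈ strip τ i 1, ‖z p - euler b w τ i p.1‖ ≤ eulerErr V b w τ κ i p.1 + K * τ) :
    ∀ i ≤ N, ∀ s : ℝ, 0 ≤ s → s ≤ 1 →
      ‖driftInt b w z (s, i * τ) - euler b w τ i s‖ ≤ eulerErr V b w τ κ i s := by
  intro i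
  induction i with
  | zero => intro _ s _ _; simp [driftInt, euler, eulerErr]
  | succ i ih =>
    intro hi s hs hs1
    have ih := ih (by omega)
    have hiτ : (i : ℝ) * τ ≤ ((i + 1 : ℕ) : ℝ) * τ := by push_cast; nlinarith
    have hi1 : ((i + 1 : ℕ) : ℝ) * τ ≤ 1 := le_trans (by gcongr) hN
    have hint := integral_norm_sub_euler_le hV hb hK hw hz hτ hκ hi1 (h i (by omega) ih) hs1
    have hem : Measurable (fun p : ℝ × ℝ => euler b w τ i p.1) :=
      (measurable_euler_path hb hw τ i).comp measurable_fst
    have hdiff := driftInt_sub_driftInt_right hb hK hw hz s (a := i * τ) (by positivity) hiτ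
    have e : driftInt b w z (s, ((i + 1 : ℕ) : ℝ) * τ) - euler b w τ (i + 1) s =
        (driftInt b w z (s, i * τ) - euler b w τ i s) +
        ∫ p in strip τ i s, (b p (w p + z p) - b p (w p + euler b w τ i p.1)) := by
      have hsub : ∫ p in strip τ i s, (b p (w p + z p) - b p (w p + euler b w τ i p.1)) =
          (∫ p in strip τ i s, b p (w p + z p)) -
            ∫ p in strip τ i s, b p (w p + euler b w τ i p.1) :=
        integral_sub (integrableOn_rect_of_norm_le (measurable_drift hb hw hz)
          (fun p => hK p _) _ _ _) (integrableOn_rect_of_norm_le (measurable_drift hb hw hem)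
          (fun p => hK p _) _ _ _)
      rw [hsub, euler]
      simp only [strip] at hdiff ⊢
      rw [← hdiff]
      abel
    rw [e]
    refine (norm_add_le _ _).trans ?_
    have := norm_integral_le_integral_norm (μ := volume.restrict (strip τ i s))
      (fun p => b p (w p + z p) - b p (w p + euler b w τ i p.1))
    linarith [ih s hs hs1]

lemma norm_sub_euler_le
    (hV : Dominates (volume.restrict (Ioc 0 1 ×ˢ Ioc 0 1)) b V M)
    (hb : Measurable (fun q : (ℝ × ℝ) × EuclideanSpace ℝ (Fin d) => b q.1 q.2))
    (hK : ∀ p x, ‖b p x‖ ≤ K) (hw : Measurable w) (hz : Measurable z) (hτ : 0 ≤ τ)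
    (hκ : K * τ < κ) {N : ℕ} (hN : (N : ℝ) * τ ≤ 1)
    (h : ∀ i < N, ∀ p ∈ strip τ i 1, ‖z p - driftInt b w z (p.1, i * τ)‖ ≤ K * τ) :
    ∀ i < N, ∀ p ∈ strip τ i 1,
      ‖z p - euler b w τ i p.1‖ ≤ eulerErr V b w τ κ i p.1 + K * τ := by
  have hcomb : ∀ i < N, (∀ s : ℝ, 0 ≤ s → s ≤ 1 →
        ‖driftInt b w z (s, i * τ) - euler b w τ i s‖ ≤ eulerErr V b w τ κ i s) →
      ∀ p ∈ strip τ i 1, ‖z p - euler b w τ i p.1‖ ≤ eulerErr V b w τ κ i p.1 + K * τ := by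
    intro i hi hd p hp
    have h1 := h i hi p hp
    have h2 := hd p.1 hp.1.1.le hp.1.2
    have h3 := norm_sub_le_norm_sub_add_norm_sub (z p) (driftInt b w z (p.1, i * τ))
      (euler b w τ i p.1)
    linarith
  intro i hi
  exact hcomb i hi (norm_driftInt_sub_euler_le hV hb hK hw hz hτ hκ hN hcomb i hi.le)

lemma eulerErr_le_last (hV : Dominates (volume.restrict (Ioc 0 1 ×ˢ Ioc 0 1)) b V M)
    (hb : Measurable (fun q : (ℝ × ℝ) × EuclideanSpace ℝ (Fin d) => b q.1 q.2))
    (hw : Measurable w) (hκ : 0 ≤ κ) {i N : ℕ} (hi : i ≤ N) {s : ℝ} (hs : s ≤ 1) :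
    eulerErr V b w τ κ i s ≤ eulerErr V b w τ κ N 1 :=
  (eulerErr_mono hV hb hw hκ i hs).trans (eulerErr_mono_index hV hκ 1 hi)

lemma exists_mem_strip {N : ℕ} (hN : 1 ≤ N) {p : ℝ × ℝ} (hp : p ∈ Ioc (0 : ℝ) 1 ×ˢ Ioc (0 : ℝ) 1) :
    ∃ i < N, p ∈ strip (1 / (N : ℝ)) i 1 := by
  have hN0 : (0 : ℝ) < N := by exact_mod_cast hN
  have hpos : 0 < p.2 * N := mul_pos hp.2.1 hN0
  have hc : 1 ≤ ⌈p.2 * N⌉₊ := Nat.one_le_ceil_iff.2 hpos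
  have hle : ⌈p.2 * N⌉₊ ≤ N := Nat.ceil_le.2 (by nlinarith [hp.2.2])
  refine ⟨⌈p.2 * N⌉₊ - 1, by omega, hp.1, ?_, ?_⟩
  · have := (Nat.ceil_lt_add_one hpos.le)
    rw [Nat.cast_sub hc, mul_one_div, div_lt_iff₀ hN0]
    push_cast
    linarith
  · rw [Nat.sub_add_cancel hc, mul_one_div, le_div_iff₀ hN0]
    exact Nat.le_ceil _

lemma eulerPath_of_mem_strip {N : ℕ} (hN : 1 ≤ N) {i : ℕ} {s : ℝ} {p : ℝ × ℝ}
    (hp : p ∈ strip (1 / (N : ℝ)) i s) :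
    eulerPath b w N p = euler b w (1 / (N : ℝ)) i p.1 := by
  have hN0 : (0 : ℝ) < N := by exact_mod_cast hN
  have h1 := hp.2.1
  have h2 := hp.2.2
  rw [mul_one_div, div_lt_iff₀ hN0] at h1
  rw [mul_one_div, le_div_iff₀ hN0] at h2
  have : ⌈p.2 * N⌉₊ = i + 1 := (Nat.ceil_eq_iff (by omega)).2 ⟨by simpa using h1, h2⟩
  rw [eulerPath, this, Nat.add_sub_cancel]

lemma measurable_eulerPath
    (hb : Measurable (fun q : (ℝ × ℝ) × EuclideanSpace ℝ (Fin d) => b q.1 q.2))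
    (hw : Measurable w) (N : ℕ) : Measurable (eulerPath b w N) := by
  have h : Measurable (fun q : ℕ × ℝ => euler b w (1 / (N : ℝ)) q.1 q.2) :=
    measurable_from_prod_countable_right fun i => measurable_euler_path hb hw _ i
  refine h.comp (Measurable.prodMk ?_ measurable_fst)
  exact (measurable_from_top (f := fun n : ℕ => n - 1)).comp
    (Nat.measurable_ceil.comp (measurable_snd.mul_const _))

lemma driftInt_eulerPath
    (hb : Measurable (fun q : (ℝ × ℝ) × EuclideanSpace ℝ (Fin d) => b q.1 q.2))
    (hK : ∀ p x, ‖b p x‖ ≤ K) (hw : Measurable w) {N : ℕ} (hN : 1 ≤ N) (i : ℕ) (s : ℝ) :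
    driftInt b w (eulerPath b w N) (s, i * (1 / (N : ℝ))) = euler b w (1 / (N : ℝ)) i s := by
  have hN0 : (0 : ℝ) < N := by exact_mod_cast hN
  have hτ : 0 ≤ 1 / (N : ℝ) := by positivity
  induction i with
  | zero => simp [driftInt, euler]
  | succ i ih =>
    have hiτ : (i : ℝ) * (1 / (N : ℝ)) ≤ ((i + 1 : ℕ) : ℝ) * (1 / (N : ℝ)) := by push_cast; nlinarith
    have h := driftInt_sub_driftInt_right hb hK hw (measurable_eulerPath hb hw N) s
      (a := i * (1 / (N : ℝ))) (by positivity) hiτ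
    rw [sub_eq_iff_eq_add', ih] at h
    rw [h, euler]
    congr 1
    refine setIntegral_congr_fun (measurableSet_strip (1 / (N : ℝ)) i s) fun p hp => ?_
    simp only [eulerPath_of_mem_strip hN hp]

lemma norm_eulerPath_sub_euler_le
    (hV : Dominates (volume.restrict (Ioc 0 1 ×ˢ Ioc 0 1)) b V M)
    (hb : Measurable (fun q : (ℝ × ℝ) × EuclideanSpace ℝ (Fin d) => b q.1 q.2))
    (hK : ∀ p x, ‖b p x‖ ≤ K) (hw : Measurable w) {N L : ℕ} (hN : 1 ≤ N) (hNL : N ≤ L)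
    (hκ : K * (1 / (N : ℝ)) < κ) :
    ∀ i < N, ∀ p ∈ strip (1 / (N : ℝ)) i 1, ‖eulerPath b w L p - euler b w (1 / (N : ℝ)) i p.1‖ ≤
      eulerErr V b w (1 / (N : ℝ)) κ i p.1 + K * (1 / (N : ℝ)) := by
  have hN0 : (0 : ℝ) < N := by exact_mod_cast hN
  have hL0 : (0 : ℝ) < L := by exact_mod_cast hN.trans hNL
  have hK0 : 0 ≤ K := (norm_nonneg _).trans (hK 0 0)
  refine norm_sub_euler_le hV hb hK hw (measurable_eulerPath hb hw L) (by positivity) hκ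
    (by field_simp; exact le_rfl) ?_
  intro i hi p hp
  have hi1 : ((i + 1 : ℕ) : ℝ) * (1 / (N : ℝ)) ≤ 1 := by
    rw [mul_one_div, div_le_one hN0]; exact_mod_cast hi
  have hp1 : p ∈ Ioc (0 : ℝ) 1 ×ˢ Ioc (0 : ℝ) 1 :=
    ⟨hp.1, lt_of_le_of_lt (by positivity) hp.2.1, hp.2.2.trans hi1⟩
  obtain ⟨j, hj, hpj⟩ := exists_mem_strip (hN.trans hNL) hp1
  rw [eulerPath_of_mem_strip (hN.trans hNL) hpj, ← driftInt_eulerPath hb hK hw (hN.trans hNL)]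
  refine (norm_driftInt_sub_right_le hb hK hw (measurable_eulerPath hb hw L) hp.1.1.le hp.1.2
    (by positivity) (by positivity)).trans ?_
  gcongr
  have hLN : 1 / (L : ℝ) ≤ 1 / N := by gcongr
  have a1 := hp.2.1
  have a2 := hp.2.2
  have a3 := hpj.2.1
  have a4 := hpj.2.2
  push_cast [add_mul] at a2 a4
  rw [abs_le]
  constructor <;> linarith

lemma abs_sub_left_endpoint_le {i : ℕ} {s : ℝ} {p : ℝ × ℝ} (hp : p ∈ strip τ i s) :
    |p.2 - i * τ| ≤ τ := by
  have h1 := hp.2.1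
  have h2 := hp.2.2
  push_cast [add_mul] at h2
  rw [abs_le]
  constructor <;> linarith

lemma mem_unitSquare_of_mem_strip {N i : ℕ} (hi : i < N) {p : ℝ × ℝ}
    (hp : p ∈ strip (1 / (N : ℝ)) i 1) : p ∈ Ioc (0 : ℝ) 1 ×ˢ Ioc (0 : ℝ) 1 := by
  have hN0 : (0 : ℝ) < N := by exact_mod_cast (Nat.zero_le i).trans_lt hi
  have hi1 : ((i + 1 : ℕ) : ℝ) * (1 / (N : ℝ)) ≤ 1 := by
    rw [mul_one_div, div_le_one hN0]; exact_mod_cast hi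
  exact ⟨hp.1, lt_of_le_of_lt (by positivity) hp.2.1, hp.2.2.trans hi1⟩

lemma norm_driftInt_sub_le
    (hV : Dominates (volume.restrict (Ioc 0 1 ×ˢ Ioc 0 1)) b V M)
    (hb : Measurable (fun q : (ℝ × ℝ) × EuclideanSpace ℝ (Fin d) => b q.1 q.2))
    (hK : ∀ p x, ‖b p x‖ ≤ K) (hw : Measurable w) (hz : Measurable z) {N : ℕ} (hN : 1 ≤ N)
    (hκ : K * (1 / (N : ℝ)) < κ)
    (h : ∀ i < N, ∀ p ∈ strip (1 / (N : ℝ)) i 1, ‖z p - euler b w (1 / (N : ℝ)) i p.1‖ ≤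
      eulerErr V b w (1 / (N : ℝ)) κ i p.1 + K * (1 / (N : ℝ)))
    {p : ℝ × ℝ} (hp : p ∈ Ioc (0 : ℝ) 1 ×ˢ Ioc (0 : ℝ) 1) :
    ‖z p - driftInt b w z p‖ ≤
      2 * (eulerErr V b w (1 / (N : ℝ)) κ N 1 + K * (1 / (N : ℝ))) := by
  have hN0 : (0 : ℝ) < N := by exact_mod_cast hN
  have hK0 : 0 ≤ K := (norm_nonneg _).trans (hK 0 0)
  obtain ⟨i, hi, hpi⟩ := exists_mem_strip hN hp
  have h1 := norm_driftInt_sub_euler_le hV hb hK hw hz (by positivity) hκ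
    (by field_simp; exact le_rfl) (fun i hi _ => h i hi) i hi.le p.1 hp.1.1.le hp.1.2
  have h2 := (norm_driftInt_sub_right_le hb hK hw hz (s := p.1) (a := i * (1 / (N : ℝ))) (c := p.2)
    hp.1.1.le hp.1.2 (by positivity) hp.2.1.le).trans
    (mul_le_mul_of_nonneg_left (abs_sub_left_endpoint_le hpi) hK0)
  have h3 := h i hi p hpi
  have h4 := eulerErr_le_last hV hb hw ((by positivity : 0 ≤ K * (1 / (N : ℝ))).trans hκ.le) hi.le
    hp.1.2 (τ := 1 / (N : ℝ))
  have h5 := norm_sub_le_norm_sub_add_norm_sub (z p) (euler b w (1 / (N : ℝ)) i p.1)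
    (driftInt b w z p)
  have h6 := norm_sub_le_norm_sub_add_norm_sub (driftInt b w z p)
    (driftInt b w z (p.1, i * (1 / (N : ℝ)))) (euler b w (1 / (N : ℝ)) i p.1)
  rw [norm_sub_rev (euler _ _ _ _ _)] at h5
  linarith

lemma norm_sub_eulerPath_le_of_eq
    (hV : Dominates (volume.restrict (Ioc 0 1 ×ˢ Ioc 0 1)) b V M)
    (hb : Measurable (fun q : (ℝ × ℝ) × EuclideanSpace ℝ (Fin d) => b q.1 q.2))
    (hK : ∀ p x, ‖b p x‖ ≤ K) (hw : Measurable w) (hz : Measurable z) {N : ℕ} (hN : 1 ≤ N)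
    (hκ : K * (1 / (N : ℝ)) < κ)
    (hzs : ∀ p ∈ Ioc (0 : ℝ) 1 ×ˢ Ioc (0 : ℝ) 1, z p = driftInt b w z p)
    {p : ℝ × ℝ} (hp : p ∈ Ioc (0 : ℝ) 1 ×ˢ Ioc (0 : ℝ) 1) :
    ‖z p - eulerPath b w N p‖ ≤ eulerErr V b w (1 / (N : ℝ)) κ N 1 + K * (1 / (N : ℝ)) := by
  have hN0 : (0 : ℝ) < N := by exact_mod_cast hN
  have hK0 : 0 ≤ K := (norm_nonneg _).trans (hK 0 0)
  obtain ⟨i, hi, hpi⟩ := exists_mem_strip hN hp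
  have h1 := norm_sub_euler_le hV hb hK hw hz (by positivity) hκ
    (N := N) (by field_simp; exact le_rfl) (by
      intro i hi p hpi
      have hp := mem_unitSquare_of_mem_strip hi hpi
      rw [hzs p hp]
      exact (norm_driftInt_sub_right_le hb hK hw hz (s := p.1) (a := i * (1 / (N : ℝ))) (c := p.2)
        hp.1.1.le hp.1.2 (by positivity) hp.2.1.le).trans
        (mul_le_mul_of_nonneg_left (abs_sub_left_endpoint_le hpi) hK0)) i hi p hpi
  have h4 := eulerErr_le_last hV hb hw ((by positivity : 0 ≤ K * (1 / (N : ℝ))).trans hκ.le) hi.le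
    hp.1.2 (τ := 1 / (N : ℝ))
  rw [eulerPath_of_mem_strip hN hpi]
  linarith

lemma exists_eulerErr_add_le
    (herr : ∀ ε > 0, ∀ N₀ : ℕ, ∃ N ≥ N₀,
      eulerErr V b w (1 / (N : ℝ)) ((K + 1) * (1 / (N : ℝ))) N 1 ≤ ε) {ε : ℝ} (hε : 0 < ε) :
    ∃ N : ℕ, 1 ≤ N ∧ K * (1 / (N : ℝ)) < (K + 1) * (1 / (N : ℝ)) ∧
      eulerErr V b w (1 / (N : ℝ)) ((K + 1) * (1 / (N : ℝ))) N 1 + K * (1 / (N : ℝ)) ≤ ε := by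
  obtain ⟨N₀, hN₀⟩ := exists_nat_gt (2 * K / ε)
  obtain ⟨N, hN, hNe⟩ := herr (ε / 2) (by positivity) (max N₀ 1)
  have hN1 : 1 ≤ N := (le_max_right _ _).trans hN
  have hN0 : (0 : ℝ) < N := by exact_mod_cast hN1
  have hNN : (N₀ : ℝ) ≤ N := by exact_mod_cast (le_max_left _ _).trans hN
  refine ⟨N, hN1, by gcongr; linarith, ?_⟩
  have : K * (1 / (N : ℝ)) ≤ ε / 2 := by
    rw [mul_one_div, div_le_iff₀ hN0]
    rw [div_lt_iff₀ hε] at hN₀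
    nlinarith
  linarith

/-- If the error bounds of the Euler schemes vanish along a sequence of step numbers, the integral
equation has a solution. -/
lemma exists_eq_driftInt
    (hV : Dominates (volume.restrict (Ioc 0 1 ×ˢ Ioc 0 1)) b V M)
    (hb : Measurable (fun q : (ℝ × ℝ) × EuclideanSpace ℝ (Fin d) => b q.1 q.2))
    (hK : ∀ p x, ‖b p x‖ ≤ K) (hw : Measurable w)
    (herr : ∀ ε > 0, ∀ N₀ : ℕ, ∃ N ≥ N₀,
      eulerErr V b w (1 / (N : ℝ)) ((K + 1) * (1 / (N : ℝ))) N 1 ≤ ε) :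
    ∃ z, Measurable z ∧ ∀ p ∈ Ioc (0 : ℝ) 1 ×ˢ Ioc (0 : ℝ) 1, z p = driftInt b w z p := by
  have hK0 : 0 ≤ K := (norm_nonneg _).trans (hK 0 0)
  have hconv : ∀ p ∈ Ioc (0 : ℝ) 1 ×ˢ Ioc (0 : ℝ) 1, ∃ l,
      Tendsto (fun N => eulerPath b w N p) atTop (nhds l) := by
    intro p hp
    refine cauchySeq_tendsto_of_complete (Metric.cauchySeq_iff'.2 fun ε hε => ?_)
    obtain ⟨N, hN, hκ, hNe⟩ := exists_eulerErr_add_le herr (half_pos hε)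
    refine ⟨N, fun L hL => ?_⟩
    obtain ⟨i, hi, hpi⟩ := exists_mem_strip hN hp
    rw [dist_eq_norm, eulerPath_of_mem_strip hN hpi]
    have h1 := norm_eulerPath_sub_euler_le hV hb hK hw hN hL hκ i hi p hpi
    have h2 := eulerErr_le_last hV hb hw (by positivity : 0 ≤ (K + 1) * (1 / (N : ℝ))) hi.le hpi.1.2
      (τ := 1 / (N : ℝ))
    linarith
  choose! u hu using hconv
  have hzm : Measurable ((Ioc (0 : ℝ) 1 ×ˢ Ioc (0 : ℝ) 1).indicator u) := by
    refine measurable_of_tendsto_metrizable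
      (f := fun N => (Ioc (0 : ℝ) 1 ×ˢ Ioc (0 : ℝ) 1).indicator (eulerPath b w N))
      (fun N => (measurable_eulerPath hb hw N).indicator
        (measurableSet_Ioc.prod measurableSet_Ioc)) (tendsto_pi_nhds.2 fun p => ?_)
    by_cases hp : p ∈ Ioc (0 : ℝ) 1 ×ˢ Ioc (0 : ℝ) 1
    · simpa only [indicator_of_mem hp] using hu p hp
    · simpa only [indicator_of_notMem hp] using tendsto_const_nhds
  refine ⟨_, hzm, ?_⟩
  · set z := (Ioc (0 : ℝ) 1 ×ˢ Ioc (0 : ℝ) 1).indicator u with hzdef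
    intro p hp
    refine eq_of_forall_dist_le fun ε hε => ?_
    obtain ⟨N, hN, hκ, hNe⟩ := exists_eulerErr_add_le herr (half_pos hε)
    rw [dist_eq_norm]
    refine (norm_driftInt_sub_le hV hb hK hw hzm hN hκ ?_ hp).trans (by linarith)
    intro i hi q hq
    have hq1 := mem_unitSquare_of_mem_strip hi hq
    rw [hzdef, indicator_of_mem hq1]
    refine le_of_tendsto ((hu q hq1).sub_const _).norm ?_
    filter_upwards [eventually_ge_atTop N] with L hL
    exact norm_eulerPath_sub_euler_le hV hb hK hw hN hL hκ i hi q hq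

/-- Solutions of the integral equation are unique if the error bounds of the Euler schemes vanish
along a sequence of step numbers. -/
lemma eq_of_eq_driftInt
    (hV : Dominates (volume.restrict (Ioc 0 1 ×ˢ Ioc 0 1)) b V M)
    (hb : Measurable (fun q : (ℝ × ℝ) × EuclideanSpace ℝ (Fin d) => b q.1 q.2))
    (hK : ∀ p x, ‖b p x‖ ≤ K) (hw : Measurable w)
    (herr : ∀ ε > 0, ∀ N₀ : ℕ, ∃ N ≥ N₀,
      eulerErr V b w (1 / (N : ℝ)) ((K + 1) * (1 / (N : ℝ))) N 1 ≤ ε)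
    {z z' : ℝ × ℝ → EuclideanSpace ℝ (Fin d)} (hz : Measurable z) (hz' : Measurable z')
    (hzs : ∀ p ∈ Ioc (0 : ℝ) 1 ×ˢ Ioc (0 : ℝ) 1, z p = driftInt b w z p)
    (hzs' : ∀ p ∈ Ioc (0 : ℝ) 1 ×ˢ Ioc (0 : ℝ) 1, z' p = driftInt b w z' p) :
    ∀ p ∈ Ioc (0 : ℝ) 1 ×ˢ Ioc (0 : ℝ) 1, z p = z' p := by
  have hK0 : 0 ≤ K := (norm_nonneg _).trans (hK 0 0)
  intro p hp
  refine eq_of_forall_dist_le fun ε hε => ?_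
  obtain ⟨N, hN, hκ, hNe⟩ := exists_eulerErr_add_le herr (half_pos hε)
  have h1 := norm_sub_eulerPath_le_of_eq hV hb hK hw hz hN hκ hzs hp
  have h2 := norm_sub_eulerPath_le_of_eq hV hb hK hw hz' hN hκ hzs' hp
  have h3 := norm_sub_le_norm_sub_add_norm_sub (z p) (eulerPath b w N p) (z' p)
  rw [norm_sub_rev (eulerPath b w N p)] at h3
  rw [dist_eq_norm]
  linarith
end

end

section Probabilistic

variable {Ω : Type*} {d : ℕ}
variable {W : ℝ × ℝ → Ω → EuclideanSpace ℝ (Fin d)}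
variable {b : ℝ × ℝ → EuclideanSpace ℝ (Fin d) → EuclideanSpace ℝ (Fin d)}
variable {V : ℝ × ℝ → EuclideanSpace ℝ (Fin d) → ℝ} {μ : Measure (ℝ × ℝ)} {M K τ κ : ℝ}

/-- The sample path of the extended sheet. -/
def sheetPath (W : ℝ × ℝ → Ω → EuclideanSpace ℝ (Fin d)) (ω : Ω) (p : ℝ × ℝ) :
    EuclideanSpace ℝ (Fin d) := sheetExt W p ω

lemma sheetPath_eq_stoppedSheet {u : ℝ} (ω : Ω) {p : ℝ × ℝ} (hp : p.2 ≤ u) :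
    sheetPath W ω p = stoppedSheet W u ω p := by
  simp [sheetPath, stoppedSheet, min_eq_left hp]

variable [MeasurableSpace Ω] {P : Measure Ω}

lemma IsBrownianSheet.measurable_sheetPath (hW : IsBrownianSheet P d W) (ω : Ω) :
    Measurable (sheetPath W ω) := (hW.continuous_sheetExt ω).measurable

lemma IsBrownianSheet.measurable_uncurry_sheetPath (hW : IsBrownianSheet P d W) :
    Measurable (fun q : Ω × (ℝ × ℝ) => sheetPath W q.1 q.2) :=
  (measurable_uncurry_of_continuous_of_measurable (u := fun p ω => sheetExt W p ω)
    hW.continuous_sheetExt hW.measurable_sheetExt).comp measurable_swap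

lemma IsBrownianSheet.measurable_uncurry_stoppedSheet (hW : IsBrownianSheet P d W) (u : ℝ) :
    Measurable[(MeasurableSpace.comap (stoppedSheet W u) inferInstance).prod inferInstance]
      (fun q : Ω × (ℝ × ℝ) => stoppedSheet W u q.1 q.2) := by
  have hc : ∀ ω, Continuous (stoppedSheet W u ω) := fun ω =>
    (hW.continuous_sheetExt ω).comp (by fun_prop : Continuous fun q : ℝ × ℝ => (q.1, min q.2 u))
  let m : MeasurableSpace Ω := MeasurableSpace.comap (stoppedSheet W u) inferInstance
  have hm : ∀ p, Measurable[m] (fun ω => stoppedSheet W u ω p) := fun p =>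
    (measurable_pi_apply p).comp (comap_measurable (stoppedSheet W u))
  exact (measurable_uncurry_of_continuous_of_measurable (u := fun p ω => stoppedSheet W u ω p)
    hc hm).comp measurable_swap

lemma IsBrownianSheet.measurable_euler_comap (hW : IsBrownianSheet P d W)
    (hb : Measurable (fun q : (ℝ × ℝ) × EuclideanSpace ℝ (Fin d) => b q.1 q.2)) (hτ : 0 ≤ τ)
    {j : ℕ} {u : ℝ} (hu : j * τ ≤ u) (s : ℝ) :
    Measurable[MeasurableSpace.comap (stoppedSheet W u) inferInstance]
      (fun ω => euler b (sheetPath W ω) τ j s) := by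
  have e : ∀ ω, euler b (sheetPath W ω) τ j = euler b (stoppedSheet W u ω) τ j := fun ω =>
    euler_congr hτ fun p hp => sheetPath_eq_stoppedSheet ω (hp.trans hu)
  simp_rw [e]
  have h := hW.measurable_uncurry_stoppedSheet u
  let m : MeasurableSpace Ω := MeasurableSpace.comap (stoppedSheet W u) inferInstance
  exact (measurable_euler (Ω := Ω) hb h τ j).comp (measurable_id.prodMk measurable_const)

lemma IsBrownianSheet.measurable_eulerErr_comap (hW : IsBrownianSheet P d W)
    (hb : Measurable (fun q : (ℝ × ℝ) × EuclideanSpace ℝ (Fin d) => b q.1 q.2))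
    (hV : Measurable (fun q : (ℝ × ℝ) × EuclideanSpace ℝ (Fin d) => V q.1 q.2)) (hτ : 0 ≤ τ)
    (κ : ℝ) {j : ℕ} {u : ℝ} (hu : j * τ ≤ u) (s : ℝ) :
    Measurable[MeasurableSpace.comap (stoppedSheet W u) inferInstance]
      (fun ω => eulerErr V b (sheetPath W ω) τ κ j s) := by
  have e : ∀ ω, eulerErr V b (sheetPath W ω) τ κ j = eulerErr V b (stoppedSheet W u ω) τ κ j :=
    fun ω => eulerErr_congr hτ fun p hp => sheetPath_eq_stoppedSheet ω (hp.trans hu)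
  simp_rw [e]
  have h := hW.measurable_uncurry_stoppedSheet u
  let m : MeasurableSpace Ω := MeasurableSpace.comap (stoppedSheet W u) inferInstance
  exact (measurable_eulerErr (Ω := Ω) hb hV h τ κ j).comp (measurable_id.prodMk measurable_const)

lemma IsBrownianSheet.comap_stoppedSheet_le (hW : IsBrownianSheet P d W) (u : ℝ) :
    MeasurableSpace.comap (stoppedSheet W u) inferInstance ≤ (inferInstance : MeasurableSpace Ω) :=
  Measurable.comap_le (measurable_pi_lambda _ fun _ => hW.measurable_sheetExt _)

lemma IsBrownianSheet.integral_comp_add [IsProbabilityMeasure P] (hW : IsBrownianSheet P d W)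
    {s u t : ℝ} (hs : 0 ≤ s) (hs1 : s ≤ 1) (hu : 0 ≤ u) (hut : u ≤ t) (ht : t ≤ 1)
    {U : EuclideanSpace ℝ (Fin d) → ℝ} (hU : Measurable U) (hM : ∀ x, |U x| ≤ M)
    {X : Ω → EuclideanSpace ℝ (Fin d)}
    (hX : Measurable[MeasurableSpace.comap (stoppedSheet W u) inferInstance] X) :
    ∫ ω, U (sheetPath W ω (s, t) + X ω) ∂P =
      ∫ ω, gaussAvg U √(s * (t - u)) (sheetPath W ω (s, u) + X ω) ∂P := by
  have hXm : Measurable (fun ω => sheetPath W ω (s, u) + X ω) :=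
    (hW.measurable_sheetExt _).add (hX.mono (hW.comap_stoppedSheet_le u) le_rfl)
  have hw : Measurable[MeasurableSpace.comap (stoppedSheet W u) inferInstance]
      (fun ω => sheetPath W ω (s, u)) := by
    simp_rw [fun ω => sheetPath_eq_stoppedSheet (W := W) (u := u) ω (p := (s, u)) le_rfl]
    exact (measurable_pi_apply (s, u)).comp (comap_measurable (stoppedSheet W u))
  rw [← hW.integral_comp_increment_add hs hs1 hu hut ht hU hM hXm (hw.add hX)]
  congr 1 with ω
  congr 1
  simp only [sheetPath]
  abel

lemma measurable_gaussAvg {U : EuclideanSpace ℝ (Fin d) → ℝ} (hU : Measurable U) (σ : ℝ) :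
    Measurable (gaussAvg U σ) :=
  (StronglyMeasurable.integral_prod_right (f := fun x z : EuclideanSpace ℝ (Fin d) => U (σ • z + x))
    (Measurable.stronglyMeasurable (by fun_prop))).measurable

lemma abs_gaussAvg_le {U : EuclideanSpace ℝ (Fin d) → ℝ} (hM : ∀ x, |U x| ≤ M) (σ : ℝ)
    (x : EuclideanSpace ℝ (Fin d)) : |gaussAvg U σ x| ≤ M := by
  have := norm_integral_le_of_norm_le_const (μ := stdGaussian (EuclideanSpace ℝ (Fin d)))
    (f := fun z => U (σ • z + x)) (C := M) (ae_of_all _ fun z => by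
      rw [Real.norm_eq_abs]; exact hM _)
  simpa [gaussAvg] using this

lemma IsBrownianSheet.abs_integral_sub_le [IsProbabilityMeasure P] (hW : IsBrownianSheet P d W)
    {s u t : ℝ} (hs : 0 < s) (hs1 : s ≤ 1) (hu : 0 ≤ u) (hut : u < t) (ht : t ≤ 1)
    {U : EuclideanSpace ℝ (Fin d) → ℝ} (hU : Measurable U) (hM : ∀ x, |U x| ≤ M)
    {X Y : Ω → EuclideanSpace ℝ (Fin d)}
    (hX : Measurable[MeasurableSpace.comap (stoppedSheet W u) inferInstance] X)
    (hY : Measurable[MeasurableSpace.comap (stoppedSheet W u) inferInstance] Y)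
    {r : Ω → ℝ} (hr : Integrable r P) (hXY : ∀ ω, ‖X ω - Y ω‖ ≤ r ω) :
    |∫ ω, U (sheetPath W ω (s, t) + X ω) ∂P - ∫ ω, U (sheetPath W ω (s, t) + Y ω) ∂P| ≤
      2 * M * (∫ ω, r ω ∂P) / √(s * (t - u)) := by
  have hσ : 0 < √(s * (t - u)) := Real.sqrt_pos.2 (mul_pos hs (sub_pos.2 hut))
  have hM0 : 0 ≤ M := (abs_nonneg _).trans (hM 0)
  have hw : Measurable (fun ω => sheetPath W ω (s, u)) := hW.measurable_sheetExt _
  have hXm := hX.mono (hW.comap_stoppedSheet_le u) le_rfl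
  have hYm := hY.mono (hW.comap_stoppedSheet_le u) le_rfl
  have hG := measurable_gaussAvg hU √(s * (t - u))
  have hI : ∀ Z : Ω → EuclideanSpace ℝ (Fin d), Measurable Z →
      Integrable (fun ω => gaussAvg U √(s * (t - u)) (sheetPath W ω (s, u) + Z ω)) P :=
    fun Z hZ => integrable_of_abs_le (hG.comp (hw.add hZ)) fun _ => abs_gaussAvg_le hM _ _
  rw [hW.integral_comp_add hs.le hs1 hu hut.le ht hU hM hX,
    hW.integral_comp_add hs.le hs1 hu hut.le ht hU hM hY, ← integral_sub (hI X hXm) (hI Y hYm),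
    mul_div_assoc, ← integral_div, ← integral_const_mul, ← Real.norm_eq_abs]
  refine norm_integral_le_of_norm_le ((hr.div_const _).const_mul _) (ae_of_all _ fun ω => ?_)
  refine (abs_gaussAvg_sub_le hU hM hσ _ _).trans ?_
  rw [add_sub_add_left_eq_sub]
  gcongr
  exact hXY ω

lemma IsBrownianSheet.abs_integral_second_difference_le [IsProbabilityMeasure P]
    (hW : IsBrownianSheet P d W)
    {s u t : ℝ} (hs : 0 < s) (hs1 : s ≤ 1) (hu : 0 ≤ u) (hut : u < t) (ht : t ≤ 1)
    {U : EuclideanSpace ℝ (Fin d) → ℝ} (hU : Measurable U) (hM : ∀ x, |U x| ≤ M)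
    {X A H : Ω → EuclideanSpace ℝ (Fin d)}
    (hX : Measurable[MeasurableSpace.comap (stoppedSheet W u) inferInstance] X)
    (hA : Measurable[MeasurableSpace.comap (stoppedSheet W u) inferInstance] A)
    (hH : Measurable[MeasurableSpace.comap (stoppedSheet W u) inferInstance] H)
    {r : Ω → ℝ} (hr : Integrable r P) (hAH : ∀ ω, ‖A ω‖ * ‖H ω‖ ≤ r ω) :
    |∫ ω, U (sheetPath W ω (s, t) + (X ω + A ω + H ω)) ∂P -
        ∫ ω, U (sheetPath W ω (s, t) + (X ω + A ω)) ∂P -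
        ∫ ω, U (sheetPath W ω (s, t) + (X ω + H ω)) ∂P +
        ∫ ω, U (sheetPath W ω (s, t) + X ω) ∂P| ≤
      8 * M * (∫ ω, r ω ∂P) / (s * (t - u)) := by
  have hσ2 : 0 < s * (t - u) := mul_pos hs (sub_pos.2 hut)
  have hσ : 0 < √(s * (t - u)) := Real.sqrt_pos.2 hσ2
  have hM0 : 0 ≤ M := (abs_nonneg _).trans (hM 0)
  have hw : Measurable (fun ω => sheetPath W ω (s, u)) := hW.measurable_sheetExt _
  have hG := measurable_gaussAvg hU √(s * (t - u))
  have hI : ∀ Z : Ω → EuclideanSpace ℝ (Fin d),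
      Measurable[MeasurableSpace.comap (stoppedSheet W u) inferInstance] Z →
      Integrable (fun ω => gaussAvg U √(s * (t - u)) (sheetPath W ω (s, u) + Z ω)) P :=
    fun Z hZ => integrable_of_abs_le
      (hG.comp (hw.add (hZ.mono (hW.comap_stoppedSheet_le u) le_rfl)))
      fun _ => abs_gaussAvg_le hM _ _
  have h1 := hI (fun ω => X ω + A ω + H ω) ((hX.add hA).add hH)
  have h2 := hI (fun ω => X ω + A ω) (hX.add hA)
  have h3 := hI (fun ω => X ω + H ω) (hX.add hH)
  have h4 := hI _ hX
  have hE := fun Z => hW.integral_comp_add hs.le hs1 hu hut.le ht hU hM (X := Z)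
  have h12 : Integrable (fun ω => gaussAvg U √(s * (t - u))
      (sheetPath W ω (s, u) + (X ω + A ω + H ω)) -
      gaussAvg U √(s * (t - u)) (sheetPath W ω (s, u) + (X ω + A ω))) P := h1.sub h2
  have h123 : Integrable (fun ω => gaussAvg U √(s * (t - u))
      (sheetPath W ω (s, u) + (X ω + A ω + H ω)) -
      gaussAvg U √(s * (t - u)) (sheetPath W ω (s, u) + (X ω + A ω)) -
      gaussAvg U √(s * (t - u)) (sheetPath W ω (s, u) + (X ω + H ω))) P := h12.sub h3
  rw [hE (fun ω => X ω + A ω + H ω) ((hX.add hA).add hH), hE (fun ω => X ω + A ω) (hX.add hA),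
    hE (fun ω => X ω + H ω) (hX.add hH), hE X hX,
    ← integral_sub h1 h2, ← integral_sub h12 h3, ← integral_add h123 h4,
    mul_div_assoc, ← integral_div, ← integral_const_mul, ← Real.norm_eq_abs]
  refine norm_integral_le_of_norm_le ((hr.div_const _).const_mul _) (ae_of_all _ fun ω => ?_)
  have := abs_gaussAvg_second_difference_le hU hM hσ (sheetPath W ω (s, u) + X ω) (A ω) (H ω)
  rw [Real.sq_sqrt hσ2.le] at this
  simp only [Real.norm_eq_abs, ← add_assoc] at this ⊢
  refine this.trans ?_
  gcongr
  exact hAH ω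

end Probabilistic

section Mean

variable {Ω : Type*} [MeasurableSpace Ω] {P : Measure Ω} {d : ℕ}
variable {W : ℝ × ℝ → Ω → EuclideanSpace ℝ (Fin d)}
variable {b : ℝ × ℝ → EuclideanSpace ℝ (Fin d) → EuclideanSpace ℝ (Fin d)}
variable {V : ℝ × ℝ → EuclideanSpace ℝ (Fin d) → ℝ} {μ : Measure (ℝ × ℝ)} {M K τ κ β : ℝ}

/-- The mean terminal error bound after `i` steps of the Euler scheme along the sheet. -/
def meanErr (P : Measure Ω) (W : ℝ × ℝ → Ω → EuclideanSpace ℝ (Fin d))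
    (V : ℝ × ℝ → EuclideanSpace ℝ (Fin d) → ℝ)
    (b : ℝ × ℝ → EuclideanSpace ℝ (Fin d) → EuclideanSpace ℝ (Fin d)) (τ κ : ℝ) (i : ℕ) : ℝ :=
  ∫ ω, eulerErr V b (sheetPath W ω) τ κ i 1 ∂P

/-- The mean oscillation at `p` around the sheet shifted by the `j`-th Euler approximation. -/
def meanOsc (P : Measure Ω) (W : ℝ × ℝ → Ω → EuclideanSpace ℝ (Fin d))
    (V : ℝ × ℝ → EuclideanSpace ℝ (Fin d) → ℝ)
    (b : ℝ × ℝ → EuclideanSpace ℝ (Fin d) → EuclideanSpace ℝ (Fin d)) (τ κ β : ℝ) (j : ℕ)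
    (p : ℝ × ℝ) : ℝ :=
  ∫ ω, diagOsc V p (sheetPath W ω p + euler b (sheetPath W ω) τ j p.1)
    (eulerErr V b (sheetPath W ω) τ κ j p.1 + β) ∂P

lemma measurable_sheetPath_add_euler (hW : IsBrownianSheet P d W)
    (hb : Measurable (fun q : (ℝ × ℝ) × EuclideanSpace ℝ (Fin d) => b q.1 q.2)) (j : ℕ) :
    Measurable (fun q : Ω × (ℝ × ℝ) =>
      sheetPath W q.1 q.2 + euler b (sheetPath W q.1) τ j q.2.1) :=
  hW.measurable_uncurry_sheetPath.add
    ((measurable_euler hb hW.measurable_uncurry_sheetPath τ j).comp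
      (measurable_fst.prodMk (measurable_fst.comp measurable_snd)))

lemma measurable_diagOsc_sheetPath (hW : IsBrownianSheet P d W) (hV : Dominates μ b V M)
    (hb : Measurable (fun q : (ℝ × ℝ) × EuclideanSpace ℝ (Fin d) => b q.1 q.2)) (j : ℕ) :
    Measurable (fun q : Ω × (ℝ × ℝ) =>
      diagOsc V q.2 (sheetPath W q.1 q.2 + euler b (sheetPath W q.1) τ j q.2.1)
        (eulerErr V b (sheetPath W q.1) τ κ j q.2.1 + β)) :=
  measurable_diagOsc hV.meas measurable_snd (measurable_sheetPath_add_euler hW hb j)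
    (((measurable_eulerErr hb hV.meas hW.measurable_uncurry_sheetPath τ κ j).comp
      (measurable_fst.prodMk (measurable_fst.comp measurable_snd))).add_const β)

variable [IsProbabilityMeasure P]

lemma integrable_eulerErr (hW : IsBrownianSheet P d W) (hV : Dominates μ b V M)
    (hb : Measurable (fun q : (ℝ × ℝ) × EuclideanSpace ℝ (Fin d) => b q.1 q.2))
    (hτ : 0 ≤ τ) (hκ : 0 ≤ κ) (i : ℕ) {s : ℝ} (hs : 0 ≤ s) :
    Integrable (fun ω => eulerErr V b (sheetPath W ω) τ κ i s) P := by
  refine integrable_of_abs_le (M := M * (s * (i * τ))) ?_ fun ω => ?_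
  · exact (measurable_eulerErr hb hV.meas hW.measurable_uncurry_sheetPath τ κ i).comp
      (measurable_id.prodMk measurable_const)
  · rw [abs_of_nonneg (eulerErr_nonneg hV hκ i s)]
    simpa [eulerErr] using eulerErr_sub_le (w := sheetPath W ω) (κ := κ) hV hτ 0 i hs

lemma integral_eulerErr_le (hW : IsBrownianSheet P d W) (hV : Dominates μ b V M)
    (hb : Measurable (fun q : (ℝ × ℝ) × EuclideanSpace ℝ (Fin d) => b q.1 q.2))
    (hτ : 0 ≤ τ) (hκ : 0 ≤ κ) (i : ℕ) {s : ℝ} (hs : 0 ≤ s) (hs1 : s ≤ 1) :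
    ∫ ω, eulerErr V b (sheetPath W ω) τ κ i s ∂P ≤ meanErr P W V b τ κ i :=
  integral_mono (integrable_eulerErr hW hV hb hτ hκ i hs)
    (integrable_eulerErr hW hV hb hτ hκ i zero_le_one)
    fun ω => eulerErr_mono hV hb (hW.measurable_sheetPath ω) hκ i hs1

lemma integral_eulerErr_succ_sub_le (hW : IsBrownianSheet P d W) (hV : Dominates μ b V M)
    (hb : Measurable (fun q : (ℝ × ℝ) × EuclideanSpace ℝ (Fin d) => b q.1 q.2))
    (hτ : 0 ≤ τ) (hκ : 0 ≤ κ) (i : ℕ) {s : ℝ} (hs : 0 ≤ s) (hs1 : s ≤ 1) :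
    ∫ ω, (eulerErr V b (sheetPath W ω) τ κ (i + 1) s - eulerErr V b (sheetPath W ω) τ κ i s) ∂P ≤
      meanErr P W V b τ κ (i + 1) - meanErr P W V b τ κ i := by
  have h := fun i => integrable_eulerErr (P := P) hW hV hb hτ hκ i hs
  have h1 := fun i => integrable_eulerErr (P := P) hW hV hb hτ hκ i zero_le_one
  rw [meanErr, meanErr, ← integral_sub (h1 _) (h1 _)]
  exact integral_mono ((h _).sub (h _)) ((h1 _).sub (h1 _))
    fun ω => eulerErr_succ_sub_mono hV hb (hW.measurable_sheetPath ω) hκ i hs1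

lemma meanErr_mono (hW : IsBrownianSheet P d W) (hV : Dominates μ b V M)
    (hb : Measurable (fun q : (ℝ × ℝ) × EuclideanSpace ℝ (Fin d) => b q.1 q.2))
    (hτ : 0 ≤ τ) (hκ : 0 ≤ κ) : Monotone (meanErr P W V b τ κ) := fun i j h =>
  integral_mono (integrable_eulerErr hW hV hb hτ hκ i zero_le_one)
    (integrable_eulerErr hW hV hb hτ hκ j zero_le_one)
    fun _ => eulerErr_mono_index hV hκ 1 h

lemma meanErr_succ_sub_le (hW : IsBrownianSheet P d W) (hV : Dominates μ b V M)
    (hb : Measurable (fun q : (ℝ × ℝ) × EuclideanSpace ℝ (Fin d) => b q.1 q.2))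
    (hτ : 0 ≤ τ) (hκ : 0 ≤ κ) (i : ℕ) :
    meanErr P W V b τ κ (i + 1) - meanErr P W V b τ κ i ≤ M * τ := by
  have h1 := fun i => integrable_eulerErr (P := P) hW hV hb hτ hκ i zero_le_one
  rw [meanErr, meanErr, ← integral_sub (h1 _) (h1 _)]
  refine (integral_mono ((h1 _).sub (h1 _)) (integrable_const (M * τ)) fun ω => ?_).trans (by simp)
  simpa using eulerErr_succ_sub_le (w := sheetPath W ω) (κ := κ) hV hτ i zero_le_one

lemma Dominates.abs_le (hV : Dominates μ b V M) (p : ℝ × ℝ) (x : EuclideanSpace ℝ (Fin d)) :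
    |V p x| ≤ M := by
  rw [abs_of_nonneg (hV.nonneg p x)]
  exact hV.le p x

lemma Dominates.measurable (hV : Dominates μ b V M) (p : ℝ × ℝ) : Measurable (V p) :=
  hV.meas.comp (measurable_const.prodMk measurable_id)

lemma integral_diagOsc (hW : IsBrownianSheet P d W) (hV : Dominates μ b V M) (p : ℝ × ℝ)
    {x : Ω → EuclideanSpace ℝ (Fin d)} {θ : Ω → ℝ} (hx : Measurable x) (hθ : Measurable θ) :
    ∫ ω, diagOsc V p (sheetPath W ω p + x ω) (θ ω) ∂P =
      ∫ ω, V p (sheetPath W ω p + (x ω + θ ω • diagVec d)) ∂P -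
        ∫ ω, V p (sheetPath W ω p + (x ω - θ ω • diagVec d)) ∂P := by
  have hw : Measurable (fun ω => sheetPath W ω p) := hW.measurable_sheetExt p
  have hVp := hV.measurable p
  rw [← integral_sub
    (integrable_of_abs_le (M := M) (by fun_prop) fun _ => hV.abs_le _ _)
    (integrable_of_abs_le (M := M) (by fun_prop) fun _ => hV.abs_le _ _)]
  simp only [diagOsc, add_assoc, add_sub_assoc]

lemma meanOsc_le (hW : IsBrownianSheet P d W) (hV : Dominates μ b V M)
    (hb : Measurable (fun q : (ℝ × ℝ) × EuclideanSpace ℝ (Fin d) => b q.1 q.2))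
    (hτ : 0 ≤ τ) (hκ : 0 ≤ κ) (hβ : 0 ≤ β) {j : ℕ} {s t : ℝ} (hs : 0 < s) (hs1 : s ≤ 1)
    (hjt : j * τ < t) (ht : t ≤ 1) :
    meanOsc P W V b τ κ β j (s, t) ≤
      4 * M * ‖diagVec d‖ * (meanErr P W V b τ κ j + β) / √(s * (t - j * τ)) := by
  have hM := hV.bound_nonneg
  have hc := hW.measurable_euler_comap hb hτ (le_refl (j * τ)) s
  have hr := hW.measurable_eulerErr_comap hb hV.meas hτ κ (le_refl (j * τ)) s
  have hle := hW.comap_stoppedSheet_le (j * τ)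
  have hI := (integrable_eulerErr hW hV hb hτ hκ j hs.le).add (integrable_const β)
  rw [meanOsc, integral_diagOsc hW hV (s, t) (hc.mono hle le_rfl)
    ((hr.add_const β).mono hle le_rfl)]
  refine (le_abs_self _).trans ((hW.abs_integral_sub_le hs hs1 (by positivity) hjt ht
    (hV.measurable _) (hV.abs_le _) (hc.add ((hr.add_const β).smul_const _))
    (hc.sub ((hr.add_const β).smul_const _)) (hI.const_mul (2 * ‖diagVec d‖))
    fun ω => le_of_eq ?_).trans ?_)
  · have h0 := eulerErr_nonneg (w := sheetPath W ω) (τ := τ) hV hκ j s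
    simp only [Pi.add_apply, Pi.sub_apply]
    rw [add_sub_sub_cancel, ← two_smul ℝ, norm_smul, norm_smul, Real.norm_eq_abs, Real.norm_eq_abs,
      abs_of_nonneg (add_nonneg h0 hβ)]
    norm_num
    ring
  · rw [integral_const_mul, integral_add' (integrable_eulerErr hW hV hb hτ hκ j hs.le)
      (integrable_const β)]
    have := integral_eulerErr_le hW hV hb hτ hκ j hs.le hs1
    simp only [integral_const, probReal_univ, one_smul]
    rw [show 2 * M * (2 * ‖diagVec d‖ * (∫ ω, eulerErr V b (sheetPath W ω) τ κ j s ∂P + β)) =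
      4 * M * ‖diagVec d‖ * (∫ ω, eulerErr V b (sheetPath W ω) τ κ j s ∂P + β) by ring]
    gcongr

lemma meanOsc_succ_sub_le (hW : IsBrownianSheet P d W) (hV : Dominates μ b V M)
    (hb : Measurable (fun q : (ℝ × ℝ) × EuclideanSpace ℝ (Fin d) => b q.1 q.2))
    (hK : ∀ p x, ‖b p x‖ ≤ K) (hτ : 0 ≤ τ) (hκ : 0 ≤ κ) (hβ : 0 ≤ β) {j : ℕ} {s t : ℝ}
    (hs : 0 < s) (hs1 : s ≤ 1) (hjt : ((j + 1 : ℕ) : ℝ) * τ < t) (ht : t ≤ 1) :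
    meanOsc P W V b τ κ β (j + 1) (s, t) - meanOsc P W V b τ κ β j (s, t) ≤
      4 * M * ‖diagVec d‖ * (meanErr P W V b τ κ (j + 1) - meanErr P W V b τ κ j) /
          √(s * (t - ((j + 1 : ℕ) : ℝ) * τ)) +
        16 * M * K * ‖diagVec d‖ * τ * (meanErr P W V b τ κ j + β) /
          (t - ((j + 1 : ℕ) : ℝ) * τ) := by
  have hM := hV.bound_nonneg
  have hK0 : 0 ≤ K := (norm_nonneg _).trans (hK 0 0)
  set u : ℝ := ((j + 1 : ℕ) : ℝ) * τ with hu
  have hju : (j : ℝ) * τ ≤ u := by rw [hu]; push_cast; nlinarith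
  have hu0 : 0 ≤ u := by positivity
  have htu : 0 < t - u := sub_pos.2 hjt
  have hle := hW.comap_stoppedSheet_le u
  have hc := hW.measurable_euler_comap hb hτ hju s
  have hc' := hW.measurable_euler_comap hb hτ (le_refl u) s
  have hr := (hW.measurable_eulerErr_comap hb hV.meas hτ κ hju s).add_const β
  have hr' := (hW.measurable_eulerErr_comap hb hV.meas hτ κ (le_refl u) s).add_const β
  have hI := integrable_eulerErr (P := P) hW hV hb hτ hκ j hs.le
  have hI' := integrable_eulerErr (P := P) hW hV hb hτ hκ (j + 1) hs.le
  have hΔ := integral_eulerErr_succ_sub_le hW hV hb hτ hκ j hs.le hs1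
  have hY := integral_eulerErr_le hW hV hb hτ hκ j hs.le hs1
  rw [meanOsc, meanOsc,
    integral_diagOsc hW hV (s, t) (hc.mono hle le_rfl) (hr.mono hle le_rfl),
    integral_diagOsc hW hV (s, t) (hc'.mono hle le_rfl) (hr'.mono hle le_rfl)]
  set ρ := fun ω => eulerErr V b (sheetPath W ω) τ κ j s with hρ
  set ρ' := fun ω => eulerErr V b (sheetPath W ω) τ κ (j + 1) s with hρ'
  set c := fun ω => euler b (sheetPath W ω) τ j s with hcd
  set c' := fun ω => euler b (sheetPath W ω) τ (j + 1) s with hcd'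
  have hρ0 : ∀ ω, 0 ≤ ρ ω := fun ω => eulerErr_nonneg hV hκ j s
  have hρΔ : ∀ ω, 0 ≤ ρ' ω - ρ ω := fun ω => eulerErr_succ_sub_nonneg hV hκ j s
  have hre := hr.smul_const (diagVec d)
  have hre' := hr'.smul_const (diagVec d)
  have hID : Integrable (fun ω => ‖diagVec d‖ * (ρ' ω - ρ ω)) P := (hI'.sub hI).const_mul _
  have hfirst : 2 * M * (∫ ω, ‖diagVec d‖ * (ρ' ω - ρ ω) ∂P) / √(s * (t - u)) ≤
      2 * M * ‖diagVec d‖ * (meanErr P W V b τ κ (j + 1) - meanErr P W V b τ κ j) /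
        √(s * (t - u)) := by
    rw [integral_const_mul, ← mul_assoc]
    gcongr
  have e1 := hW.abs_integral_sub_le hs hs1 hu0 hjt ht (hV.measurable (s, t)) (hV.abs_le (s, t))
    (X := fun ω => c' ω + (ρ' ω + β) • diagVec d) (Y := fun ω => c' ω + (ρ ω + β) • diagVec d)
    (hc'.add hre') (hc'.add hre) hID fun ω => le_of_eq <| by
      rw [add_sub_add_left_eq_sub, ← sub_smul, norm_smul, add_sub_add_right_eq_sub,
        Real.norm_eq_abs, abs_of_nonneg (hρΔ ω), mul_comm]
  have e2 := hW.abs_integral_sub_le hs hs1 hu0 hjt ht (hV.measurable (s, t)) (hV.abs_le (s, t))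
    (X := fun ω => c' ω - (ρ ω + β) • diagVec d) (Y := fun ω => c' ω - (ρ' ω + β) • diagVec d)
    (hc'.sub hre) (hc'.sub hre') hID fun ω => le_of_eq <| by
      rw [sub_sub_sub_cancel_left, ← sub_smul, norm_smul, add_sub_add_right_eq_sub,
        Real.norm_eq_abs, abs_of_nonneg (hρΔ ω), mul_comm]
  have e3 := hW.abs_integral_second_difference_le hs hs1 hu0 hjt ht (hV.measurable (s, t))
    (hV.abs_le (s, t)) (X := fun ω => c ω - (ρ ω + β) • diagVec d)
    (A := fun ω => (2 * (ρ ω + β)) • diagVec d) (H := fun ω => c' ω - c ω)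
    (r := fun ω => 2 * ‖diagVec d‖ * (K * (s * τ)) * (ρ ω + β))
    (hc.sub hre) ((hr.const_mul 2).smul_const _) (hc'.sub hc)
    ((hI.add (integrable_const β)).const_mul _) fun ω => by
      rw [norm_smul, Real.norm_eq_abs,
        abs_of_nonneg (mul_nonneg zero_le_two (add_nonneg (hρ0 ω) hβ))]
      have := norm_euler_succ_sub_le (w := sheetPath W ω) hK hτ j hs.le
      have h0 := add_nonneg (hρ0 ω) hβ
      calc 2 * (ρ ω + β) * ‖diagVec d‖ * ‖c' ω - c ω‖
          ≤ 2 * (ρ ω + β) * ‖diagVec d‖ * (K * (s * τ)) := by gcongr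
        _ = _ := by ring
  have hsecond : 8 * M * (∫ ω, 2 * ‖diagVec d‖ * (K * (s * τ)) * (ρ ω + β) ∂P) / (s * (t - u)) ≤
      16 * M * K * ‖diagVec d‖ * τ * (meanErr P W V b τ κ j + β) / (t - u) := by
    rw [integral_const_mul, integral_add hI (integrable_const β)]
    simp only [integral_const, probReal_univ, one_smul]
    rw [show 8 * M * (2 * ‖diagVec d‖ * (K * (s * τ)) * (∫ ω, ρ ω ∂P + β)) / (s * (t - u)) =
      16 * M * K * ‖diagVec d‖ * τ * (∫ ω, ρ ω ∂P + β) / (t - u) by field_simp; ring]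
    gcongr
  have hx1 : ∀ ω, c ω + (ρ ω + β) • diagVec d + (c' ω - c ω) =
      c' ω + (ρ ω + β) • diagVec d := fun ω => by module
  have hx2 : ∀ ω, c ω - (ρ ω + β) • diagVec d + (2 * (ρ ω + β)) • diagVec d =
      c ω + (ρ ω + β) • diagVec d := fun ω => by module
  have hx3 : ∀ ω, c ω - (ρ ω + β) • diagVec d + (c' ω - c ω) =
      c' ω - (ρ ω + β) • diagVec d := fun ω => by module
  simp only [hx2, hx3, hx1] at e3
  have e1 := (le_abs_self _).trans (e1.trans hfirst)
  have e2 := (le_abs_self _).trans (e2.trans hfirst)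
  have e3 := (le_abs_self _).trans (e3.trans hsecond)
  rw [show 4 * M * ‖diagVec d‖ * (meanErr P W V b τ κ (j + 1) - meanErr P W V b τ κ j) /
        √(s * (t - u)) =
      2 * (2 * M * ‖diagVec d‖ * (meanErr P W V b τ κ (j + 1) - meanErr P W V b τ κ j) /
        √(s * (t - u))) by ring]
  change (∫ ω, V (s, t) (sheetPath W ω (s, t) + (c' ω + (ρ' ω + β) • diagVec d)) ∂P -
      ∫ ω, V (s, t) (sheetPath W ω (s, t) + (c' ω - (ρ' ω + β) • diagVec d)) ∂P) -
    (∫ ω, V (s, t) (sheetPath W ω (s, t) + (c ω + (ρ ω + β) • diagVec d)) ∂P -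
      ∫ ω, V (s, t) (sheetPath W ω (s, t) + (c ω - (ρ ω + β) • diagVec d)) ∂P) ≤ _
  linarith

end Mean

section Recursion

lemma div_sqrt_mul_le {x s v v' : ℝ} (hx : 0 ≤ x) (hs : 0 ≤ s) (hv : 0 < v) (hvv : v ≤ v') :
    x / √(s * v') ≤ 1 / √s * (x / √v) := by
  rw [Real.sqrt_mul hs, div_mul_div_comm, one_mul]
  rcases hs.eq_or_lt with rfl | hs
  · simp
  gcongr

lemma integrableOn_one_div_sqrt : IntegrableOn (fun s : ℝ => 1 / √s) (Ioc 0 1) := by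
  have h := (intervalIntegrable_iff_integrableOn_Ioc_of_le zero_le_one).1
    (intervalIntegral.intervalIntegrable_rpow' (a := 0) (b := 1) (r := -(1 / 2)) (by norm_num))
  refine h.congr_fun (fun s hs => ?_) measurableSet_Ioc
  rw [Real.sqrt_eq_rpow, one_div (s ^ _), ← Real.rpow_neg hs.1.le]

lemma integral_one_div_sqrt : ∫ s : ℝ in Ioc 0 1, 1 / √s = 2 := by
  have h := integral_rpow (a := 0) (b := 1) (r := -(1 / 2)) (Or.inl (by norm_num))
  rw [intervalIntegral.integral_of_le zero_le_one] at h
  rw [setIntegral_congr_fun measurableSet_Ioc fun s hs =>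
    show 1 / √s = s ^ (-(1 / 2) : ℝ) by
      rw [Real.sqrt_eq_rpow, one_div (s ^ _), ← Real.rpow_neg hs.1.le], h]
  norm_num

lemma integrableOn_strip_one_div_sqrt (τ : ℝ) (i : ℕ) (x y : ℝ) :
    IntegrableOn (fun p : ℝ × ℝ => 1 / √p.1 * x + y) (strip τ i 1) := by
  have : IsFiniteMeasure (volume.restrict (strip τ i 1)) :=
    ⟨by rw [Measure.restrict_apply_univ]; exact volume_rect_lt_top _ _ _⟩
  refine Integrable.add ?_ (integrable_const y)
  rw [strip, Measure.volume_eq_prod, ← Measure.prod_restrict]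
  exact (integrableOn_one_div_sqrt.comp_fst _).mul_const x

lemma integral_strip_one_div_sqrt {τ : ℝ} (hτ : 0 ≤ τ) (i : ℕ) (x y : ℝ) :
    ∫ p in strip τ i 1, (1 / √p.1 * x + y) = τ * (2 * x + y) := by
  have hfin : IsFiniteMeasure (volume.restrict (strip τ i 1)) :=
    ⟨by rw [Measure.restrict_apply_univ]; exact volume_rect_lt_top _ _ _⟩
  have h1 := integrableOn_strip_one_div_sqrt τ i x 0
  simp only [add_zero] at h1
  have hi : (i : ℝ) * τ ≤ ((i + 1 : ℕ) : ℝ) * τ := by push_cast; nlinarith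
  have e : ∫ p in strip τ i 1, 1 / √p.1 * x = τ * (2 * x) := by
    rw [strip, Measure.volume_eq_prod, ← Measure.prod_restrict,
      integral_prod_mul (fun s : ℝ => 1 / √s) (fun _ : ℝ => x), integral_one_div_sqrt]
    simp only [integral_const, measureReal_restrict_apply_univ, smul_eq_mul]
    rw [Real.volume_real_Ioc_of_le hi]
    push_cast; ring
  rw [integral_add h1 (integrable_const y), e]
  simp only [integral_const, measureReal_restrict_apply_univ, smul_eq_mul]
  rw [volumeReal_strip hτ zero_le_one]
  ring

variable {Ω : Type*} [MeasurableSpace Ω] {P : Measure Ω} {d : ℕ}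
variable {W : ℝ × ℝ → Ω → EuclideanSpace ℝ (Fin d)}
variable {b : ℝ × ℝ → EuclideanSpace ℝ (Fin d) → EuclideanSpace ℝ (Fin d)}
variable {V : ℝ × ℝ → EuclideanSpace ℝ (Fin d) → ℝ} {μ : Measure (ℝ × ℝ)} {M K τ κ β : ℝ}
variable [IsProbabilityMeasure P]

lemma integrable_diagOsc_sheetPath (hW : IsBrownianSheet P d W) (hV : Dominates μ b V M)
    (hb : Measurable (fun q : (ℝ × ℝ) × EuclideanSpace ℝ (Fin d) => b q.1 q.2)) (j : ℕ)
    (p : ℝ × ℝ) :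
    Integrable (fun ω => diagOsc V p (sheetPath W ω p + euler b (sheetPath W ω) τ j p.1)
      (eulerErr V b (sheetPath W ω) τ κ j p.1 + β)) P :=
  integrable_of_abs_le (M := M) ((measurable_diagOsc_sheetPath hW hV hb j).comp
    (measurable_id.prodMk measurable_const)) fun _ => hV.norm_diagOsc_le _ _ _

lemma meanOsc_le_meanOsc_sub (hW : IsBrownianSheet P d W) (hV : Dominates μ b V M)
    (hb : Measurable (fun q : (ℝ × ℝ) × EuclideanSpace ℝ (Fin d) => b q.1 q.2))
    (hK : ∀ p x, ‖b p x‖ ≤ K) (hτ : 0 ≤ τ) {ℓ i : ℕ} (hℓ : ℓ ≤ i) {p : ℝ × ℝ} (hs : 0 ≤ p.1)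
    (hs1 : p.1 ≤ 1) :
    meanOsc P W V b τ ((K + 1) * τ) ((K + 1) * τ) i p ≤
      meanOsc P W V b τ ((K + 1) * τ) ((K + 1 + M) * (ℓ + 1) * τ) (i - ℓ) p := by
  obtain ⟨k, rfl⟩ := Nat.exists_eq_add_of_le' hℓ
  rw [Nat.add_sub_cancel]
  have hM := hV.bound_nonneg
  have hK0 : 0 ≤ K := (norm_nonneg _).trans (hK 0 0)
  refine integral_mono (integrable_diagOsc_sheetPath hW hV hb _ p)
    (integrable_diagOsc_sheetPath hW hV hb _ p) fun ω => hV.diagOsc_mono p fun m => ?_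
  have h1 := norm_euler_sub_le (w := sheetPath W ω) hK hτ k ℓ hs
  have h2 := eulerErr_sub_le (w := sheetPath W ω) (κ := (K + 1) * τ) hV hτ k ℓ hs
  have h3 := (PiLp.norm_apply_le (euler b (sheetPath W ω) τ (k + ℓ) p.1 -
    euler b (sheetPath W ω) τ k p.1) m).trans h1
  have h4 : p.1 * (ℓ * τ) ≤ ℓ * τ := mul_le_of_le_one_left (by positivity) hs1
  have h5 : K * (p.1 * (ℓ * τ)) ≤ K * (ℓ * τ) := by gcongr
  have h6 : M * (p.1 * (ℓ * τ)) ≤ M * (ℓ * τ) := by gcongr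
  have h7 : 0 ≤ ℓ * τ := by positivity
  have h8 : 0 ≤ M * τ := by positivity
  simp only [PiLp.add_apply, PiLp.sub_apply, Real.norm_eq_abs] at h3 ⊢
  rw [add_sub_add_left_eq_sub]
  linarith [show (K + 1 + M) * (ℓ + 1) * τ =
    K * (ℓ * τ) + M * (ℓ * τ) + (K + 1) * τ + M * τ + ℓ * τ by ring]

lemma meanOsc_sub_le (hW : IsBrownianSheet P d W) (hV : Dominates μ b V M)
    (hb : Measurable (fun q : (ℝ × ℝ) × EuclideanSpace ℝ (Fin d) => b q.1 q.2))
    (hK : ∀ p x, ‖b p x‖ ≤ K) (hτ : 0 < τ) (hκ : 0 ≤ κ) (hβ : 0 ≤ β) {a ℓ i : ℕ} (hℓ : 1 ≤ ℓ)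
    (hai : a + ℓ ≤ i) {s t : ℝ} (hs : 0 < s) (hs1 : s ≤ 1) (hit : i * τ < t) (ht : t ≤ 1) :
    meanOsc P W V b τ κ β (i - ℓ) (s, t) ≤
      1 / √s * (4 * M * ‖diagVec d‖ * (meanErr P W V b τ κ a + β) / √(((i : ℝ) - a) * τ) +
        ∑ j ∈ Finset.Ico a (i - ℓ),
          4 * M * ‖diagVec d‖ * (meanErr P W V b τ κ (j + 1) - meanErr P W V b τ κ j) /
            √(((i : ℝ) - (j + 1)) * τ)) +
        ∑ j ∈ Finset.Ico a (i - ℓ),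
          16 * M * K * ‖diagVec d‖ * (meanErr P W V b τ κ i + β) / ((i : ℝ) - (j + 1)) := by
  have hM := hV.bound_nonneg
  have hK0 : 0 ≤ K := (norm_nonneg _).trans (hK 0 0)
  have hmono := meanErr_mono (P := P) hW hV hb hτ.le hκ
  have hY : ∀ j, 0 ≤ meanErr P W V b τ κ j := fun j =>
    integral_nonneg fun ω => eulerErr_nonneg hV hκ j 1
  have htel := Finset.sum_Ico_sub (fun j => meanOsc P W V b τ κ β j (s, t))
    (show a ≤ i - ℓ by omega)
  have hlt : ∀ {k : ℕ}, k < i → 0 < (i : ℝ) - k ∧ k * τ < t ∧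
      ((i : ℝ) - k) * τ ≤ t - k * τ := fun {k} hk => by
    have : (k : ℝ) < i := by exact_mod_cast hk
    refine ⟨sub_pos.2 this, ?_, ?_⟩ <;> nlinarith
  have hterm : ∀ j ∈ Finset.Ico a (i - ℓ),
      meanOsc P W V b τ κ β (j + 1) (s, t) - meanOsc P W V b τ κ β j (s, t) ≤
      1 / √s * (4 * M * ‖diagVec d‖ * (meanErr P W V b τ κ (j + 1) - meanErr P W V b τ κ j) /
            √(((i : ℝ) - (j + 1)) * τ)) +
      16 * M * K * ‖diagVec d‖ * (meanErr P W V b τ κ i + β) / ((i : ℝ) - (j + 1)) := by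
    intro j hj
    obtain ⟨h1, h2⟩ := Finset.mem_Ico.1 hj
    obtain ⟨h3, h4, h5⟩ := hlt (k := j + 1) (by omega)
    have h6 := hY i
    have h7 := hmono (show j ≤ i by omega)
    have h8 := sub_nonneg.2 (hmono (show j ≤ j + 1 by omega))
    refine (meanOsc_succ_sub_le hW hV hb hK hτ.le hκ hβ hs hs1 h4 ht).trans ?_
    rw [← Nat.cast_add_one]
    refine add_le_add (div_sqrt_mul_le (by positivity) hs.le (by positivity) h5) ?_
    calc 16 * M * K * ‖diagVec d‖ * τ * (meanErr P W V b τ κ j + β) / (t - (j + 1 : ℕ) * τ)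
        ≤ 16 * M * K * ‖diagVec d‖ * τ * (meanErr P W V b τ κ i + β) /
            (((i : ℝ) - (j + 1 : ℕ)) * τ) := by gcongr
      _ = _ := by field_simp
  have h0 : meanOsc P W V b τ κ β a (s, t) ≤
      1 / √s * (4 * M * ‖diagVec d‖ * (meanErr P W V b τ κ a + β) / √(((i : ℝ) - a) * τ)) := by
    obtain ⟨h3, h4, h5⟩ := hlt (k := a) (by omega)
    have := hY a
    exact (meanOsc_le hW hV hb hτ.le hκ hβ hs hs1 h4 ht).trans
      (div_sqrt_mul_le (by positivity) hs.le (by positivity) h5)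
  have hsum := Finset.sum_le_sum hterm
  rw [Finset.sum_add_distrib, ← Finset.mul_sum, htel] at hsum
  linarith [mul_add (1 / √s) (4 * M * ‖diagVec d‖ * (meanErr P W V b τ κ a + β) /
    √(((i : ℝ) - a) * τ)) (∑ j ∈ Finset.Ico a (i - ℓ),
          4 * M * ‖diagVec d‖ * (meanErr P W V b τ κ (j + 1) - meanErr P W V b τ κ j) /
            √(((i : ℝ) - (j + 1)) * τ))]

lemma meanErr_succ_sub_eq (hW : IsBrownianSheet P d W) (hV : Dominates μ b V M)
    (hb : Measurable (fun q : (ℝ × ℝ) × EuclideanSpace ℝ (Fin d) => b q.1 q.2))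
    (hτ : 0 ≤ τ) (hκ : 0 ≤ κ) (i : ℕ) :
    meanErr P W V b τ κ (i + 1) - meanErr P W V b τ κ i =
      ∫ p in strip τ i 1, meanOsc P W V b τ κ κ i p := by
  have hfin : IsFiniteMeasure (volume.restrict (strip τ i 1)) :=
    ⟨by rw [Measure.restrict_apply_univ]; exact volume_rect_lt_top _ _ _⟩
  have h1 := fun i => integrable_eulerErr (P := P) hW hV hb hτ hκ i zero_le_one
  rw [meanErr, meanErr, ← integral_sub (h1 _) (h1 _)]
  simp only [eulerErr, add_sub_cancel_left]
  exact integral_integral_swap (integrable_of_abs_le (M := M)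
    (measurable_diagOsc_sheetPath hW hV hb i) fun _ => hV.norm_diagOsc_le _ _ _)

lemma integrableOn_meanOsc (hW : IsBrownianSheet P d W) (hV : Dominates μ b V M)
    (hb : Measurable (fun q : (ℝ × ℝ) × EuclideanSpace ℝ (Fin d) => b q.1 q.2)) (i : ℕ) :
    IntegrableOn (meanOsc P W V b τ κ β i) (strip τ i 1) := by
  have hfin : IsFiniteMeasure (volume.restrict (strip τ i 1)) :=
    ⟨by rw [Measure.restrict_apply_univ]; exact volume_rect_lt_top _ _ _⟩
  have : Integrable (fun q : Ω × (ℝ × ℝ) =>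
      diagOsc V q.2 (sheetPath W q.1 q.2 + euler b (sheetPath W q.1) τ i q.2.1)
        (eulerErr V b (sheetPath W q.1) τ κ i q.2.1 + β))
      (P.prod (volume.restrict (strip τ i 1))) := integrable_of_abs_le (M := M)
    (measurable_diagOsc_sheetPath hW hV hb i) fun _ => hV.norm_diagOsc_le _ _ _
  exact this.integral_prod_right

/-- The mean error bounds satisfy the discrete recursion. -/
lemma recBound_meanErr (hW : IsBrownianSheet P d W) (hV : Dominates μ b V M)
    (hb : Measurable (fun q : (ℝ × ℝ) × EuclideanSpace ℝ (Fin d) => b q.1 q.2))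
    (hK : ∀ p x, ‖b p x‖ ≤ K) (hτ : 0 < τ) {N : ℕ} (hN : N * τ ≤ 1) :
    RecBound (8 * M * ‖diagVec d‖) (16 * M * K * ‖diagVec d‖) (K + 1 + M) M τ N
      (meanErr P W V b τ ((K + 1) * τ)) := by
  have hM := hV.bound_nonneg
  have hK0 : 0 ≤ K := (norm_nonneg _).trans (hK 0 0)
  have hκ : 0 ≤ (K + 1) * τ := by positivity
  refine ⟨by simp [meanErr, eulerErr], meanErr_mono hW hV hb hτ.le hκ,
    meanErr_succ_sub_le hW hV hb hτ.le hκ, fun a ℓ i hℓ hai hiN => ?_⟩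
  have hiτ : ((i + 1 : ℕ) : ℝ) * τ ≤ 1 :=
    le_trans (by gcongr; exact_mod_cast hiN) hN
  have hβ : 0 ≤ (K + 1 + M) * (ℓ + 1) * τ := by positivity
  rw [meanErr_succ_sub_eq hW hV hb hτ.le hκ]
  refine (setIntegral_mono_on (integrableOn_meanOsc hW hV hb i)
    (integrableOn_strip_one_div_sqrt τ i _ _) (measurableSet_strip τ i 1) fun p hp =>
      (meanOsc_le_meanOsc_sub hW hV hb hK hτ.le (by omega : ℓ ≤ i) hp.1.1.le hp.1.2).trans
        (meanOsc_sub_le hW hV hb hK hτ hκ hβ hℓ hai hp.1.1 hp.1.2 hp.2.1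
          (hp.2.2.trans hiτ))).trans (le_of_eq ?_)
  rw [integral_strip_one_div_sqrt hτ.le, mul_add (2 : ℝ), Finset.mul_sum, Finset.sum_add_distrib,
    ← add_assoc]
  congr 3
  · ring
  · exact Finset.sum_congr rfl fun j _ => by ring

end Recursion

section Solution

variable {Ω : Type*} {d : ℕ}
variable {W : ℝ × ℝ → Ω → EuclideanSpace ℝ (Fin d)}
variable {b : ℝ × ℝ → EuclideanSpace ℝ (Fin d) → EuclideanSpace ℝ (Fin d)}
variable {V : ℝ × ℝ → EuclideanSpace ℝ (Fin d) → ℝ} {M K : ℝ}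

lemma sheetPath_of_mem (ω : Ω) {p : ℝ × ℝ} (hp : p ∈ Icc (0 : ℝ × ℝ) 1) :
    sheetPath W ω p = W p ω := by
  rw [sheetPath, sheetExt, clampSquare_of_mem hp]

/-- The integral equation driven by the path `w`. -/
def SolvesSheetEq (b : ℝ × ℝ → EuclideanSpace ℝ (Fin d) → EuclideanSpace ℝ (Fin d))
    (ξ : EuclideanSpace ℝ (Fin d)) (w X : ℝ × ℝ → EuclideanSpace ℝ (Fin d)) : Prop :=
  ∀ p ∈ Icc (0 : ℝ × ℝ) 1,
    X p = ξ + (∫ t₁ in (0:ℝ)..p.2, ∫ s₁ in (0:ℝ)..p.1, b (s₁, t₁) (X (s₁, t₁))) + w p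

lemma solvesSheetEq_sheetPath_iff {ξ : EuclideanSpace ℝ (Fin d)} {ω : Ω}
    {X : ℝ × ℝ → EuclideanSpace ℝ (Fin d)} :
    SolvesSheetEq b ξ (sheetPath W ω) X ↔ SolvesSheetEq b ξ (fun p => W p ω) X :=
  forall₂_congr fun _ hp => by rw [sheetPath_of_mem ω hp]

variable [MeasurableSpace Ω] {P : Measure Ω}

lemma tendsto_meanErr [IsProbabilityMeasure P] (hW : IsBrownianSheet P d W)
    (hV : Dominates (volume.restrict (Ioc 0 1 ×ˢ Ioc 0 1)) b V M)
    (hb : Measurable (fun q : (ℝ × ℝ) × EuclideanSpace ℝ (Fin d) => b q.1 q.2))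
    (hK : ∀ p x, ‖b p x‖ ≤ K) :
    Tendsto (fun N : ℕ => meanErr P W V b (1 / (N : ℝ)) ((K + 1) * (1 / (N : ℝ))) N) atTop
      (nhds 0) := by
  have hK0 : 0 ≤ K := (norm_nonneg _).trans (hK 0 0)
  have hM0 : 0 ≤ M := hV.bound_nonneg
  rw [Metric.tendsto_atTop]
  intro ε hε
  obtain ⟨N₀, hN₀⟩ := RecBound.eventually_le (A := 8 * M * ‖diagVec d‖)
    (B := 16 * M * K * ‖diagVec d‖) (C := K + 1 + M) (M := M) (by positivity) (by positivity)
    (by positivity) hM0 (half_pos hε)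
  refine ⟨max N₀ 1, fun N hN => ?_⟩
  have hN1 : 0 < (N : ℝ) := by exact_mod_cast (le_max_right N₀ 1).trans hN
  have h := hN₀ N ((le_max_left _ _).trans hN) _ (recBound_meanErr hW hV hb hK
    (τ := 1 / (N : ℝ)) (N := N) (by positivity) (by rw [mul_one_div_cancel hN1.ne']))
  have h0 : 0 ≤ meanErr P W V b (1 / (N : ℝ)) ((K + 1) * (1 / (N : ℝ))) N :=
    integral_nonneg fun ω => eulerErr_nonneg hV (by positivity) _ _
  rw [Real.dist_eq, sub_zero, abs_of_nonneg h0]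
  linarith

lemma ae_exists_eulerErr_le [IsProbabilityMeasure P] (hW : IsBrownianSheet P d W)
    (hV : Dominates (volume.restrict (Ioc 0 1 ×ˢ Ioc 0 1)) b V M)
    (hb : Measurable (fun q : (ℝ × ℝ) × EuclideanSpace ℝ (Fin d) => b q.1 q.2))
    (hK : ∀ p x, ‖b p x‖ ≤ K) :
    ∀ᵐ ω ∂P, ∀ ε > 0, ∀ N₀ : ℕ, ∃ N ≥ N₀,
      eulerErr V b (sheetPath W ω) (1 / (N : ℝ)) ((K + 1) * (1 / (N : ℝ))) N 1 ≤ ε := by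
  have hK0 : 0 ≤ K := (norm_nonneg _).trans (hK 0 0)
  let f : ℕ → Ω → ℝ := fun N ω =>
    eulerErr V b (sheetPath W ω) (1 / (N : ℝ)) ((K + 1) * (1 / (N : ℝ))) N 1
  have hf0 : ∀ N ω, 0 ≤ f N ω := fun N ω => eulerErr_nonneg hV (by positivity) _ _
  have hint : ∀ N, Integrable (f N) P := fun N =>
    integrable_eulerErr hW hV hb (by positivity) (by positivity) N zero_le_one
  have hL : Tendsto (fun N => eLpNorm (f N - 0) 1 P) atTop (nhds 0) := by
    have h := ENNReal.tendsto_ofReal (tendsto_meanErr hW hV hb hK)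
    rw [ENNReal.ofReal_zero] at h
    refine h.congr fun N => ?_
    rw [sub_zero, eLpNorm_one_eq_lintegral_enorm, ← ofReal_integral_norm_eq_lintegral_enorm (hint N)]
    congr 1
    exact integral_congr_ae (ae_of_all _ fun ω => (abs_of_nonneg (hf0 N ω)).symm)
  obtain ⟨ns, hns, hae⟩ := (tendstoInMeasure_of_tendsto_eLpNorm one_ne_zero
    (fun N => (hint N).aestronglyMeasurable) aestronglyMeasurable_zero hL).exists_seq_tendsto_ae
  filter_upwards [hae] with ω hω ε hε N₀
  obtain ⟨i, hi, hi'⟩ := ((hω.eventually (gt_mem_nhds (show (0 : Ω → ℝ) ω < ε from hε))).and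
    (eventually_ge_atTop N₀)).exists
  exact ⟨ns i, hi'.trans (hns.le_apply), hi.le⟩

lemma intervalIntegral_intervalIntegral_eq {F : Type*} [NormedAddCommGroup F] [NormedSpace ℝ F]
    [MeasurableSpace F] [BorelSpace F] [SecondCountableTopology F] [CompleteSpace F]
    {g : ℝ × ℝ → F} (hg : Measurable g)
    (hK : ∀ p, ‖g p‖ ≤ K) {p : ℝ × ℝ} (hp : p ∈ Icc (0 : ℝ × ℝ) 1) :
    ∫ t₁ in (0:ℝ)..p.2, ∫ s₁ in (0:ℝ)..p.1, g (s₁, t₁) =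
      ∫ q in Ioc 0 p.1 ×ˢ Ioc 0 p.2, g q := by
  have h1 : 0 ≤ p.1 := hp.1.1
  have h2 : 0 ≤ p.2 := hp.1.2
  have hint := integrableOn_rect_of_norm_le hg hK p.1 0 p.2
  rw [IntegrableOn, Measure.volume_eq_prod, ← Measure.prod_restrict] at hint
  rw [Measure.volume_eq_prod, ← Measure.prod_restrict, integral_prod_symm _ hint,
    intervalIntegral.integral_of_le h2]
  simp_rw [intervalIntegral.integral_of_le h1]

lemma intervalIntegral_drift_eq {ξ : EuclideanSpace ℝ (Fin d)}
    {w z X : ℝ × ℝ → EuclideanSpace ℝ (Fin d)}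
    (hb : Measurable (fun q : (ℝ × ℝ) × EuclideanSpace ℝ (Fin d) => b q.1 q.2))
    (hK : ∀ p x, ‖b p x‖ ≤ K) (hw : Measurable w) (hz : Measurable z)
    (hX : ∀ q ∈ Ioc (0 : ℝ) 1 ×ˢ Ioc (0 : ℝ) 1, X q = ξ + (w q + z q))
    {p : ℝ × ℝ} (hp : p ∈ Icc (0 : ℝ × ℝ) 1) :
    ∫ t₁ in (0:ℝ)..p.2, ∫ s₁ in (0:ℝ)..p.1, b (s₁, t₁) (X (s₁, t₁)) =
      driftInt (fun q x => b q (ξ + x)) w z p := by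
  have h1 : 0 ≤ p.1 := hp.1.1
  have h2 : 0 ≤ p.2 := hp.1.2
  rw [driftInt, ← intervalIntegral_intervalIntegral_eq (g := fun q => b q (ξ + (w q + z q))) ?_
    (fun q => hK q _) hp]
  · rw [intervalIntegral.integral_of_le h2, intervalIntegral.integral_of_le h2]
    refine setIntegral_congr_fun measurableSet_Ioc fun t ht => ?_
    rw [intervalIntegral.integral_of_le h1, intervalIntegral.integral_of_le h1]
    refine setIntegral_congr_fun measurableSet_Ioc fun s hs => ?_
    rw [hX (s, t) ⟨⟨hs.1, hs.2.trans hp.2.1⟩, ht.1, ht.2.trans hp.2.2⟩]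
  · exact hb.comp (measurable_id.prodMk ((hw.add hz).const_add ξ))

section Deterministic

variable {ξ : EuclideanSpace ℝ (Fin d)} {w : ℝ × ℝ → EuclideanSpace ℝ (Fin d)}

lemma Ioc_prod_Ioc_subset_Icc :
    (Ioc (0 : ℝ) 1 ×ˢ Ioc (0 : ℝ) 1 : Set (ℝ × ℝ)) ⊆ Icc (0 : ℝ × ℝ) 1 :=
  fun _ hp => ⟨⟨hp.1.1.le, hp.2.1.le⟩, hp.1.2, hp.2.2⟩

lemma exists_solvesSheetEq
    (hV : Dominates (volume.restrict (Ioc 0 1 ×ˢ Ioc 0 1)) (fun q x => b q (ξ + x)) V M)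
    (hb : Measurable (fun q : (ℝ × ℝ) × EuclideanSpace ℝ (Fin d) => b q.1 q.2))
    (hK : ∀ p x, ‖b p x‖ ≤ K) (hw : Continuous w)
    (herr : ∀ ε > 0, ∀ N₀ : ℕ, ∃ N ≥ N₀,
      eulerErr V (fun q x => b q (ξ + x)) w (1 / (N : ℝ)) ((K + 1) * (1 / (N : ℝ))) N 1 ≤ ε) :
    ∃ X, ContinuousOn X (Icc (0 : ℝ × ℝ) 1) ∧ SolvesSheetEq b ξ w X := by
  have hb' : Measurable (fun q : (ℝ × ℝ) × EuclideanSpace ℝ (Fin d) => b q.1 (ξ + q.2)) :=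
    hb.comp (measurable_fst.prodMk (measurable_snd.const_add ξ))
  have hK' : ∀ p x, ‖b p (ξ + x)‖ ≤ K := fun p x => hK p _
  obtain ⟨z, hz, hzs⟩ := exists_eq_driftInt hV hb' hK' hw.measurable herr
  refine ⟨fun p => ξ + driftInt (fun q x => b q (ξ + x)) w z p + w p,
    (continuousOn_const.add (continuousOn_driftInt hb' hK' hw.measurable hz)).add hw.continuousOn,
    fun p hp => ?_⟩
  rw [intervalIntegral_drift_eq hb hK hw.measurable hz
    (X := fun p => ξ + driftInt (fun q x => b q (ξ + x)) w z p + w p) (fun q hq => ?_) hp]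
  simp only [← hzs q hq]; abel

lemma SolvesSheetEq.eqOn
    (hV : Dominates (volume.restrict (Ioc 0 1 ×ˢ Ioc 0 1)) (fun q x => b q (ξ + x)) V M)
    (hb : Measurable (fun q : (ℝ × ℝ) × EuclideanSpace ℝ (Fin d) => b q.1 q.2))
    (hK : ∀ p x, ‖b p x‖ ≤ K) (hw : Continuous w)
    (herr : ∀ ε > 0, ∀ N₀ : ℕ, ∃ N ≥ N₀,
      eulerErr V (fun q x => b q (ξ + x)) w (1 / (N : ℝ)) ((K + 1) * (1 / (N : ℝ))) N 1 ≤ ε)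
    {X Y : ℝ × ℝ → EuclideanSpace ℝ (Fin d)} (hXc : ContinuousOn X (Icc (0 : ℝ × ℝ) 1))
    (hYc : ContinuousOn Y (Icc (0 : ℝ × ℝ) 1)) (hX : SolvesSheetEq b ξ w X)
    (hY : SolvesSheetEq b ξ w Y) : EqOn X Y (Icc (0 : ℝ × ℝ) 1) := by
  have hb' : Measurable (fun q : (ℝ × ℝ) × EuclideanSpace ℝ (Fin d) => b q.1 (ξ + q.2)) :=
    hb.comp (measurable_fst.prodMk (measurable_snd.const_add ξ))
  have hK' : ∀ p x, ‖b p (ξ + x)‖ ≤ K := fun p x => hK p _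
  have key : ∀ Z, ContinuousOn Z (Icc (0 : ℝ × ℝ) 1) → SolvesSheetEq b ξ w Z →
      ∃ z, Measurable z ∧ (∀ p ∈ Icc (0 : ℝ × ℝ) 1, Z p = ξ + (w p + z p)) ∧
        ∀ p ∈ Ioc (0 : ℝ) 1 ×ˢ Ioc (0 : ℝ) 1, z p = driftInt (fun q x => b q (ξ + x)) w z p := by
    intro Z hZc hZ
    have hz : Measurable (fun p => Z (clampSquare p) - ξ - w p) :=
      ((hZc.comp_continuous continuous_clampSquare clampSquare_mem).measurable.sub_const ξ).sub
        hw.measurable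
    have hrep : ∀ p ∈ Icc (0 : ℝ × ℝ) 1, Z p = ξ + (w p + (Z (clampSquare p) - ξ - w p)) := by
      intro p hp
      rw [clampSquare_of_mem hp]; abel
    refine ⟨_, hz, hrep, fun p hp => ?_⟩
    have hp' := Ioc_prod_Ioc_subset_Icc hp
    rw [← intervalIntegral_drift_eq hb hK hw.measurable hz
      (fun q hq => hrep q (Ioc_prod_Ioc_subset_Icc hq)) hp']
    simp only [clampSquare_of_mem hp']
    rw [sub_sub, sub_eq_iff_eq_add]
    refine (hZ p hp').trans ?_
    abel
  obtain ⟨x, hx, hXx, hxs⟩ := key X hXc hX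
  obtain ⟨y, hy, hYy, hys⟩ := key Y hYc hY
  have hxy := eq_of_eq_driftInt hV hb' hK' hw.measurable herr hx hy hxs hys
  intro p hp
  have hYx : ∀ q ∈ Ioc (0 : ℝ) 1 ×ˢ Ioc (0 : ℝ) 1, Y q = ξ + (w q + x q) := fun q hq => by
    rw [hYy q (Ioc_prod_Ioc_subset_Icc hq), hxy q hq]
  rw [hX p hp, hY p hp, intervalIntegral_drift_eq hb hK hw.measurable hx
    (fun q hq => hXx q (Ioc_prod_Ioc_subset_Icc hq)) hp,
    intervalIntegral_drift_eq hb hK hw.measurable hx hYx hp]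

end Deterministic

lemma exists_measurableSet_of_ae [IsProbabilityMeasure P] {p : Ω → Prop} (h : ∀ᵐ ω ∂P, p ω) :
    ∃ S, MeasurableSet S ∧ P S = 1 ∧ ∀ ω ∈ S, p ω := by
  obtain ⟨t, hts, htm, hnull⟩ := exists_measurable_superset_of_null (ae_iff.1 h)
  exact ⟨tᶜ, htm.compl, (prob_compl_eq_one_iff htm).2 hnull,
    fun ω hω => by_contra fun hn => hω (hts hn)⟩

end Solution

/-- path-by-path existence and uniqueness for a uniformly bounded drift that is
a difference of bounded componentwise nondecreasing functions. -/
theorem statement2 {Ω : Type*} [MeasurableSpace Ω] (P : Measure Ω) [IsProbabilityMeasure P]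
    (d : ℕ) (W : ℝ × ℝ → Ω → EuclideanSpace ℝ (Fin d)) (hW : IsBrownianSheet P d W)
    (ξ : EuclideanSpace ℝ (Fin d))
    (b bhat bcheck : ℝ × ℝ → EuclideanSpace ℝ (Fin d) → EuclideanSpace ℝ (Fin d))
    (hmeas : Measurable fun q : (ℝ × ℝ) × EuclideanSpace ℝ (Fin d) => b q.1 q.2)
    (hbdd : ∃ K : ℝ, ∀ p x, ‖b p x‖ ≤ K)
    (hbddhat : ∃ K : ℝ, ∀ p x, ‖bhat p x‖ ≤ K ∧ ‖bcheck p x‖ ≤ K)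
    (hdecomp : ∀ p x, b p x = bhat p x - bcheck p x)
    (hmono : ∀ p (x y : EuclideanSpace ℝ (Fin d)), (∀ j, x j ≤ y j) →
      ∀ i, bhat p x i ≤ bhat p y i ∧ bcheck p x i ≤ bcheck p y i) :
    ∃ Ω₀ : Set Ω, MeasurableSet Ω₀ ∧ P Ω₀ = 1 ∧
      ∀ ω ∈ Ω₀,
        (∃ X : ℝ × ℝ → EuclideanSpace ℝ (Fin d),
          ContinuousOn X (Set.Icc (0 : ℝ × ℝ) 1) ∧
          ∀ p ∈ Set.Icc (0 : ℝ × ℝ) 1,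
            X p = ξ + (∫ t₁ in (0:ℝ)..p.2, ∫ s₁ in (0:ℝ)..p.1, b (s₁, t₁) (X (s₁, t₁))) + W p ω) ∧
        (∀ X Y : ℝ × ℝ → EuclideanSpace ℝ (Fin d),
          ContinuousOn X (Set.Icc (0 : ℝ × ℝ) 1) →
          (∀ p ∈ Set.Icc (0 : ℝ × ℝ) 1,
            X p = ξ + (∫ t₁ in (0:ℝ)..p.2, ∫ s₁ in (0:ℝ)..p.1, b (s₁, t₁) (X (s₁, t₁))) + W p ω) →
          ContinuousOn Y (Set.Icc (0 : ℝ × ℝ) 1) →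
          (∀ p ∈ Set.Icc (0 : ℝ × ℝ) 1,
            Y p = ξ + (∫ t₁ in (0:ℝ)..p.2, ∫ s₁ in (0:ℝ)..p.1, b (s₁, t₁) (Y (s₁, t₁))) + W p ω) →
          Set.EqOn X Y (Set.Icc (0 : ℝ × ℝ) 1)) := by
  obtain ⟨K, hK⟩ := hbdd
  obtain ⟨K', hK'⟩ := hbddhat
  have hb' : Measurable (fun q : (ℝ × ℝ) × EuclideanSpace ℝ (Fin d) => b q.1 (ξ + q.2)) :=
    hmeas.comp (measurable_fst.prodMk (measurable_snd.const_add ξ))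
  have hfin : IsFiniteMeasure (volume.restrict (Ioc 0 1 ×ˢ Ioc 0 1 : Set (ℝ × ℝ))) :=
    ⟨by rw [Measure.restrict_apply_univ]; exact volume_rect_lt_top 1 0 1⟩
  obtain ⟨V, M, hV⟩ := exists_dominates_of_sub
    (volume.restrict (Ioc 0 1 ×ˢ Ioc 0 1 : Set (ℝ × ℝ))) (b := fun p x => b p (ξ + x))
    (bhat := fun p x => bhat p (ξ + x)) (bcheck := fun p x => bcheck p (ξ + x)) hb'
    (fun p x => hK' p _) (fun p x => hdecomp p _)
    (fun p x y h => hmono p _ _ fun j => by simpa using h j)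
  obtain ⟨Ω₀, hm, h1, hΩ₀⟩ := exists_measurableSet_of_ae
    (ae_exists_eulerErr_le hW hV hb' fun p x => hK p (ξ + x))
  refine ⟨Ω₀, hm, h1, fun ω hω => ⟨?_, fun X Y hXc hX hYc hY => ?_⟩⟩
  · obtain ⟨X, hXc, hX⟩ := exists_solvesSheetEq hV hmeas hK (hW.continuous_sheetExt ω) (hΩ₀ ω hω)
    exact ⟨X, hXc, solvesSheetEq_sheetPath_iff.1 hX⟩
  · exact SolvesSheetEq.eqOn hV hmeas hK (hW.continuous_sheetExt ω) (hΩ₀ ω hω) hXc hYc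
      (solvesSheetEq_sheetPath_iff.2 hX) (solvesSheetEq_sheetPath_iff.2 hY)
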